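/- Let n ≥ 1, let Ω ⊂ ℝ^n be open, and let 1 ≤ p < ∞. Then the functionals κ_ε(·, Ω) Γ_p-converge as ε → 0 to the functional f ↦ (1/4)·Var(f, Ω) on L^1_loc(Ω); that is: (i) for every f ∈ L^1_loc(Ω) and every family {f_ε}_{ε>0} with f_ε − f ∈ L^p_loc(Ω) and f_ε − f → 0 in L^p_loc(Ω), one has liminf_{ε→0} κ_ε(f_ε, Ω) ≥ (1/4)·Var(f, Ω); and (ii) for every f ∈ L^1_loc(Ω) there exists a family {f_ε}_{ε>0} with f_ε − f ∈ L^p_loc(Ω), f_ε − f → 0 in L^p_loc(Ω), and limsup_{ε→0} κ_ε(f_ε, Ω) ≤ (1/4)·Var(f, Ω). -/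

import Mathlib

open MeasureTheory Filter Topology Metric
open scoped ENNReal RealInnerProductSpace Classical

noncomputable section

/-- An open cube in `ℝⁿ` with side length `ε` and arbitrary orientation. -/
def IsCube (n : ℕ) (ε : ℝ) (Q : Set (EuclideanSpace ℝ (Fin n))) : Prop :=
  ∃ (T : EuclideanSpace ℝ (Fin n) ≃ₗᵢ[ℝ] EuclideanSpace ℝ (Fin n))
    (x : EuclideanSpace ℝ (Fin n)),
    Q = (fun y => x + T y) '' {y : EuclideanSpace ℝ (Fin n) | ∀ i, |y i| < ε / 2}

/-- The BMO-type functional `κ_ε(f, Ω)`. -/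
def kappa (n : ℕ) (ε : ℝ) (f : EuclideanSpace ℝ (Fin n) → ℝ)
    (Ω : Set (EuclideanSpace ℝ (Fin n))) : ℝ≥0∞ :=
  ENNReal.ofReal (ε ^ (n - 1)) *
    ⨆ (F : Set (Set (EuclideanSpace ℝ (Fin n))))
      (_ : ∀ Q ∈ F, IsCube n ε Q ∧ Q ⊆ Ω) (_ : F.Pairwise Disjoint),
      ∑' Q : F, ENNReal.ofReal
        (⨍ x in (Q : Set (EuclideanSpace ℝ (Fin n))),
          |f x - ⨍ y in (Q : Set (EuclideanSpace ℝ (Fin n))), f y ∂volume| ∂volume)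

/-- The divergence of a vector field on `ℝⁿ`. -/
def vdiv (n : ℕ) (Φ : EuclideanSpace ℝ (Fin n) → EuclideanSpace ℝ (Fin n))
    (x : EuclideanSpace ℝ (Fin n)) : ℝ :=
  ∑ i : Fin n, fderiv ℝ Φ x (EuclideanSpace.single i 1) i

/-- The variation `Var(f, Ω)`. -/
def variation (n : ℕ) (f : EuclideanSpace ℝ (Fin n) → ℝ)
    (Ω : Set (EuclideanSpace ℝ (Fin n))) : ℝ≥0∞ :=
  ⨆ (Φ : EuclideanSpace ℝ (Fin n) → EuclideanSpace ℝ (Fin n))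
    (_ : ContDiff ℝ 1 Φ) (_ : HasCompactSupport Φ) (_ : tsupport Φ ⊆ Ω)
    (_ : ∀ x, ‖Φ x‖ ≤ 1),
    ENNReal.ofReal (∫ x in Ω, f x * vdiv n Φ x)

/-- The approximate jump set `J_f`. -/
def jumpSet (n : ℕ) (f : EuclideanSpace ℝ (Fin n) → ℝ) : Set (EuclideanSpace ℝ (Fin n)) :=
  {x | ∃ ν : EuclideanSpace ℝ (Fin n), ‖ν‖ = 1 ∧ ∃ a b : ℝ, a ≠ b ∧
    Tendsto (fun r : ℝ =>
        ⨍ y in {y ∈ ball x r | 0 < ⟪y - x, ν⟫}, |f y - a| ∂volume)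
      (𝓝[>] 0) (𝓝 0) ∧
    Tendsto (fun r : ℝ =>
        ⨍ y in {y ∈ ball x r | ⟪y - x, ν⟫ < 0}, |f y - b| ∂volume)
      (𝓝[>] 0) (𝓝 0)}

/-- The approximate discontinuity set `S_f` (the set of non-Lebesgue points). -/
def approxDiscontSet (n : ℕ) (f : EuclideanSpace ℝ (Fin n) → ℝ) :
    Set (EuclideanSpace ℝ (Fin n)) :=
  {x | ¬ ∃ c : ℝ,
    Tendsto (fun r : ℝ => ⨍ y in ball x r, |f y - c| ∂volume) (𝓝[>] 0) (𝓝 0)}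

/-- `(μ, σ)` is the polar decomposition `Df = σ |Df|` of the gradient measure of `f` on `Ω`:
`μ` plays the role of the total variation measure `|Df|` and `σ` of the polar vector field. -/
def IsVariationPair (n : ℕ) (f : EuclideanSpace ℝ (Fin n) → ℝ)
    (Ω : Set (EuclideanSpace ℝ (Fin n))) (μ : Measure (EuclideanSpace ℝ (Fin n)))
    (σ : EuclideanSpace ℝ (Fin n) → EuclideanSpace ℝ (Fin n)) : Prop :=
  IsFiniteMeasure μ ∧ μ Ωᶜ = 0 ∧ AEStronglyMeasurable σ μ ∧ (∀ᵐ x ∂μ, ‖σ x‖ = 1) ∧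
  ∀ Φ : EuclideanSpace ℝ (Fin n) → EuclideanSpace ℝ (Fin n),
    ContDiff ℝ 1 Φ → HasCompactSupport Φ → tsupport Φ ⊆ Ω →
    ∫ x in Ω, f x * vdiv n Φ x = - ∫ x, ⟪Φ x, σ x⟫ ∂μ

/-- `|D^a f|(Ω)`, the total variation of the absolutely continuous part of `Df`,
with the convention that it is `∞` if `f` is not of bounded variation in `Ω`. -/
def absVar (n : ℕ) (f : EuclideanSpace ℝ (Fin n) → ℝ)
    (Ω : Set (EuclideanSpace ℝ (Fin n))) : ℝ≥0∞ :=
  if h : ∃ p : Measure (EuclideanSpace ℝ (Fin n)) ×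
      (EuclideanSpace ℝ (Fin n) → EuclideanSpace ℝ (Fin n)),
      IsVariationPair n f Ω p.1 p.2 then
    volume.withDensity ((h.choose.1).rnDeriv volume) Ω
  else ⊤

/-- `|D^c f|(Ω)`, the total variation of the Cantor part of `Df`,
with the convention that it is `∞` if `f` is not of bounded variation in `Ω`. -/
def cantorVar (n : ℕ) (f : EuclideanSpace ℝ (Fin n) → ℝ)
    (Ω : Set (EuclideanSpace ℝ (Fin n))) : ℝ≥0∞ :=
  if h : ∃ p : Measure (EuclideanSpace ℝ (Fin n)) ×
      (EuclideanSpace ℝ (Fin n) → EuclideanSpace ℝ (Fin n)),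
      IsVariationPair n f Ω p.1 p.2 then
    (h.choose.1.singularPart volume) (Ω \ approxDiscontSet n f)
  else ⊤

/-- `|D^j f|(Ω)`, the total variation of the jump part of `Df`,
with the convention that it is `∞` if `f` is not of bounded variation in `Ω`. -/
def jumpVar (n : ℕ) (f : EuclideanSpace ℝ (Fin n) → ℝ)
    (Ω : Set (EuclideanSpace ℝ (Fin n))) : ℝ≥0∞ :=
  if h : ∃ p : Measure (EuclideanSpace ℝ (Fin n)) ×
      (EuclideanSpace ℝ (Fin n) → EuclideanSpace ℝ (Fin n)),
      IsVariationPair n f Ω p.1 p.2 then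
    (h.choose.1.singularPart volume) (jumpSet n f ∩ Ω)
  else ⊤

/-- `g` is the weak (distributional) gradient of `u` on `Ω`. -/
def HasWeakGradientOn (n : ℕ) (u : EuclideanSpace ℝ (Fin n) → ℝ)
    (g : EuclideanSpace ℝ (Fin n) → EuclideanSpace ℝ (Fin n))
    (Ω : Set (EuclideanSpace ℝ (Fin n))) : Prop :=
  ∀ φ : EuclideanSpace ℝ (Fin n) → ℝ,
    ContDiff ℝ 1 φ → HasCompactSupport φ → tsupport φ ⊆ Ω →
    ∀ k : Fin n,
      ∫ x in Ω, u x * fderiv ℝ φ x (EuclideanSpace.single k 1) =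
        - ∫ x in Ω, φ x * g x k

/-- `f ∈ BV(Ω)`: `f` is integrable on `Ω` and has finite variation in `Ω`. -/
def IsBVOn (n : ℕ) (f : EuclideanSpace ℝ (Fin n) → ℝ)
    (Ω : Set (EuclideanSpace ℝ (Fin n))) : Prop :=
  IntegrableOn f Ω volume ∧ variation n f Ω < ⊤

/-- `f ∈ SBV(Ω)`: `f ∈ BV(Ω)` and the Cantor part of `Df` vanishes. -/
def IsSBVOn (n : ℕ) (f : EuclideanSpace ℝ (Fin n) → ℝ)
    (Ω : Set (EuclideanSpace ℝ (Fin n))) : Prop :=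
  IsBVOn n f Ω ∧ cantorVar n f Ω = 0

section PeakInequality

/-- Even continuous functions whose integrals over all intervals `[0, m]` are nonnegative. -/
structure IsPeakTest (h : ℝ → ℝ) : Prop where
  cont : Continuous h
  even : ∀ x, h (-x) = h x
  nonneg : ∀ m, 0 ≤ m → 0 ≤ ∫ x in (0 : ℝ)..m, h x

lemma IsPeakTest.primitive_odd {h : ℝ → ℝ} (hh : IsPeakTest h) (x : ℝ) :
    ∫ t in (0 : ℝ)..(-x), h t = -∫ t in (0 : ℝ)..x, h t := by
  have := intervalIntegral.integral_comp_neg (a := 0) (b := x) h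
  simp only [hh.even, neg_zero] at this
  rw [this, intervalIntegral.integral_symm]

lemma IsPeakTest.continuous_primitive {h : ℝ → ℝ} (hh : IsPeakTest h) :
    Continuous fun x => ∫ t in (0 : ℝ)..x, h t :=
  intervalIntegral.continuous_primitive (fun _ _ => hh.cont.intervalIntegrable _ _) 0

lemma IsPeakTest.integral_primitive_symm {h : ℝ → ℝ} (hh : IsPeakTest h) (c : ℝ) :
    ∫ x in (-c)..c, (∫ t in (0 : ℝ)..x, h t) = 0 := by
  have := intervalIntegral.integral_comp_neg (a := -c) (b := c) (fun x => ∫ t in (0 : ℝ)..x, h t)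
  simp only [hh.primitive_odd, neg_neg, intervalIntegral.integral_neg] at this
  linarith

lemma IsPeakTest.integral_primitive_nonneg {h : ℝ → ℝ} (hh : IsPeakTest h) {m c : ℝ}
    (hm : 0 ≤ m) (hc : 0 ≤ c) :
    0 ≤ ∫ x in (m - c)..(m + c), (∫ t in (0 : ℝ)..x, h t) := by
  have hi : ∀ a b, IntervalIntegrable (fun x => ∫ t in (0 : ℝ)..x, h t) volume a b :=
    fun a b => hh.continuous_primitive.intervalIntegrable a b
  rcases le_total c m with h1 | h1
  · exact intervalIntegral.integral_nonneg (by linarith) fun x hx => hh.nonneg x (by linarith [hx.1])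
  · have h0 := hh.integral_primitive_symm (c - m)
    rw [← intervalIntegral.integral_add_adjacent_intervals (hi (m - c) (c - m)) (hi _ _)]
    rw [show -(c - m) = m - c by ring] at h0
    rw [h0, zero_add]
    exact intervalIntegral.integral_nonneg (by linarith) fun x hx => hh.nonneg x (by linarith [hx.1])

/-- The class of peak tests is stable under averaging over a symmetric interval. -/
lemma IsPeakTest.average {h : ℝ → ℝ} (hh : IsPeakTest h) (a : ℝ) {s : ℝ} (hs : 0 ≤ s) :
    IsPeakTest fun y => ∫ t in (-s)..s, h (a * t + y) := by
  have hc2 : Continuous fun p : ℝ × ℝ => h (a * p.2 + p.1) := by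
    have := hh.cont
    fun_prop
  refine ⟨?_, ?_, ?_⟩
  · exact intervalIntegral.continuous_parametric_intervalIntegral_of_continuous' hc2 _ _
  · intro x
    have := intervalIntegral.integral_comp_neg (a := -s) (b := s) (fun t => h (a * t + x))
    simp only [neg_neg] at this
    rw [← this]
    refine intervalIntegral.integral_congr fun t _ => ?_
    rw [← hh.even]
    congr 1
    ring
  · intro m hm
    rw [intervalIntegral_intervalIntegral_swap]
    · have h1 : ∀ t : ℝ, ∫ y in (0 : ℝ)..m, h (a * t + y)
          = (∫ y in (0 : ℝ)..(a * t + m), h y) - ∫ y in (0 : ℝ)..(a * t), h y := by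
        intro t
        rw [intervalIntegral.integral_comp_add_left (fun y => h y), add_zero,
          intervalIntegral.integral_interval_sub_left (hh.cont.intervalIntegrable _ _)
            (hh.cont.intervalIntegrable _ _)]
      simp only [h1]
      have hP := hh.continuous_primitive
      rw [intervalIntegral.integral_sub]
      rotate_left
      · exact Continuous.intervalIntegrable (hP.comp (by fun_prop : Continuous fun t => a * t + m)) _ _
      · exact Continuous.intervalIntegrable (hP.comp (by fun_prop : Continuous fun t => a * t)) _ _
      by_cases ha : a = 0
      · subst ha
        simp only [zero_mul, zero_add, intervalIntegral.integral_same,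
          intervalIntegral.integral_const, smul_eq_mul, mul_zero, sub_zero]
        exact mul_nonneg (by linarith) (hh.nonneg m hm)
      · rw [intervalIntegral.integral_comp_mul_left (fun x => ∫ y in (0 : ℝ)..x, h y) ha,
          intervalIntegral.integral_comp_mul_add (fun x => ∫ y in (0 : ℝ)..x, h y) ha]
        rw [show a * -s = -(a * s) by ring, hh.integral_primitive_symm, smul_zero, sub_zero,
          smul_eq_mul, show -(a * s) + m = m - a * s by ring, show a * s + m = m + a * s by ring]
        rcases lt_or_gt_of_ne ha with h2 | h2
        · have := hh.integral_primitive_nonneg hm (c := -(a * s)) (by nlinarith)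
          rw [intervalIntegral.integral_symm]
          have h3 : a⁻¹ ≤ 0 := (inv_lt_zero.2 h2).le
          rw [sub_neg_eq_add, ← sub_eq_add_neg] at this
          nlinarith
        · have := hh.integral_primitive_nonneg hm (c := a * s) (by positivity)
          positivity
    · exact (hc2.continuousOn.integrableOn_compact (isCompact_uIcc.prod isCompact_uIcc)).mono_set
        (Set.prod_mono Set.uIoc_subset_uIcc Set.uIoc_subset_uIcc)

lemma isPeakTest_certificate {α β : ℝ} (hα : 0 ≤ α) (h : 3 ≤ 16 * α * β) :
    IsPeakTest fun x => α * x ^ 2 + β - |x| := by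
  refine ⟨by fun_prop, fun x => by simp, fun m hm => ?_⟩
  have h1 : ∫ x in (0 : ℝ)..m, (α * x ^ 2 + β - |x|) = ∫ x in (0 : ℝ)..m, (α * x ^ 2 + β - x) := by
    refine intervalIntegral.integral_congr fun x hx => ?_
    rw [Set.uIcc_of_le hm] at hx
    simp [abs_of_nonneg hx.1]
  have h2 : ∫ x in (0 : ℝ)..m, (α * x ^ 2 + β - x) = m * (α * m ^ 2 / 3 + β - m / 2) := by
    rw [intervalIntegral.integral_sub, intervalIntegral.integral_add] <;>
      first
      | exact Continuous.intervalIntegrable (by fun_prop) _ _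
      | skip
    simp
    ring
  rw [h1, h2]
  refine mul_nonneg hm ?_
  have hα' : 0 < α := by
    rcases hα.eq_or_lt with h0 | h0
    · rw [← h0] at h; norm_num at h
    · exact h0
  have : 0 ≤ α * (α * m ^ 2 / 3 + β - m / 2) := by nlinarith [sq_nonneg (α * m - 3 / 4)]
  exact nonneg_of_mul_nonneg_right this hα'

end PeakInequality

section Box

/-- The uniform (unnormalised) product measure on the box `(-s, s)ⁿ`. -/
abbrev boxMeasure (n : ℕ) (s : ℝ) : Measure (Fin n → ℝ) :=
  Measure.pi fun _ => volume.restrict (Set.Ioo (-s) s)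

lemma boxMeasure_eq (n : ℕ) (s : ℝ) :
    boxMeasure n s = volume.restrict (Set.univ.pi fun _ => Set.Ioo (-s) s) := by
  rw [volume_pi, Measure.restrict_pi_pi]

instance (n : ℕ) (s : ℝ) : IsFiniteMeasure (boxMeasure n s) := by
  unfold boxMeasure; infer_instance

lemma integrable_boxMeasure {n : ℕ} {s : ℝ} {g : (Fin n → ℝ) → ℝ} (hg : Continuous g) :
    Integrable g (boxMeasure n s) := by
  rw [boxMeasure_eq]
  refine (hg.continuousOn.integrableOn_compact
    (isCompact_univ_pi fun _ => isCompact_Icc (a := -s) (b := s))).mono_set ?_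
  exact Set.pi_mono fun _ _ => Set.Ioo_subset_Icc_self

lemma integral_restrict_Ioo_symm {s : ℝ} (hs : 0 ≤ s) (g : ℝ → ℝ) :
    ∫ t in Set.Ioo (-s) s, g t = ∫ t in (-s)..s, g t := by
  rw [intervalIntegral.integral_of_le (by linarith), integral_Ioc_eq_integral_Ioo]

lemma integral_boxMeasure_peakTest_nonneg {s : ℝ} (hs : 0 ≤ s) (n : ℕ) (a : Fin n → ℝ)
    {h : ℝ → ℝ} (hh : IsPeakTest h) : 0 ≤ ∫ y, h (∑ i, a i * y i) ∂boxMeasure n s := by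
  induction n generalizing h with
  | zero =>
    have h0 : 0 ≤ h 0 := by
      by_contra hneg
      push Not at hneg
      obtain ⟨δ, hδ, hb⟩ := Metric.eventually_nhds_iff.1
        (hh.cont.continuousAt.eventually (gt_mem_nhds hneg))
      have hI := hh.nonneg (δ / 2) (by positivity)
      have : ∫ x in (0 : ℝ)..(δ / 2), h x < ∫ x in (0 : ℝ)..(δ / 2), (0 : ℝ) := by
        refine intervalIntegral.integral_lt_integral_of_continuousOn_of_le_of_exists_lt
          (by positivity) hh.cont.continuousOn continuousOn_const ?_ ?_
        · intro x hx
          exact (hb (by rw [Real.dist_eq, sub_zero, abs_of_pos hx.1]; linarith [hx.2])).le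
        · exact ⟨0, ⟨le_rfl, by positivity⟩, hneg⟩
      simp at this
      linarith
    simp only [Finset.univ_eq_empty, Finset.sum_empty]
    rw [integral_const]
    exact mul_nonneg measureReal_nonneg h0
  | succ n ih =>
    have hmp := (measurePreserving_piFinSuccAbove
      (fun _ : Fin (n + 1) => (volume.restrict (Set.Ioo (-s) s) : Measure ℝ)) 0).symm
    rw [← hmp.integral_comp']
    simp_rw [MeasurableEquiv.piFinSuccAbove_symm_apply, Fin.insertNthEquiv, Fin.sum_univ_succ,
      Fin.insertNth_zero, Equiv.coe_fn_mk, Fin.cons_succ, Fin.cons_zero]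
    rw [integral_prod_symm]
    · simp only [integral_restrict_Ioo_symm hs]
      exact ih (fun i => a i.succ) (hh.average (a 0) hs)
    · have hc := hh.cont
      have hg : Continuous fun y : Fin (n + 1) → ℝ => h (∑ i, a i * y i) := by fun_prop
      have h1 := (hmp.integrable_comp_emb (MeasurableEquiv.measurableEmbedding _)).2
        (integrable_boxMeasure (s := s) hg)
      refine h1.congr (Eventually.of_forall fun p => ?_)
      simp [Fin.insertNthEquiv, Fin.sum_univ_succ, MeasurableEquiv.piFinSuccAbove_symm_apply]

lemma integral_boxMeasure_coord_mul {s : ℝ} (hs : 0 ≤ s) {n : ℕ} (i j : Fin n) :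
    ∫ y, y i * y j ∂boxMeasure n s = if i = j then (2 * s) ^ n * (s ^ 2 / 3) else 0 := by
  have h1 : ∀ y : Fin n → ℝ, y i * y j =
      ∏ k, ((if k = i then y k else 1) * (if k = j then y k else 1)) := by
    intro y
    rw [Finset.prod_mul_distrib]
    simp
  simp_rw [h1]
  rw [integral_fintype_prod_eq_prod
    (fun k t => (if k = i then t else 1) * (if k = j then t else (1 : ℝ)))]
  simp only [integral_restrict_Ioo_symm hs]
  split_ifs with hij
  · subst hij
    have h2 : ∀ k, ∫ t in (-s)..s, (if k = i then t else 1) * (if k = i then t else (1 : ℝ)) =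
        (2 * s) * if k = i then s ^ 2 / 3 else 1 := by
      intro k
      split_ifs with h
      · have : ∀ t : ℝ, t * t = t ^ 2 := fun t => by ring
        simp only [this, integral_pow]
        norm_num
        ring
      · simp; ring
    simp only [h2, Finset.prod_mul_distrib]
    simp [mul_pow]
  · refine Finset.prod_eq_zero (Finset.mem_univ i) ?_
    simp [hij]

lemma integral_boxMeasure_coord {s : ℝ} (hs : 0 ≤ s) {n : ℕ} (i : Fin n) :
    ∫ y, y i ∂boxMeasure n s = 0 := by
  have h1 : ∀ y : Fin n → ℝ, y i = ∏ k, (if k = i then y k else 1) := by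
    intro y
    simp
  simp_rw [h1]
  rw [integral_fintype_prod_eq_prod (fun k t => (if k = i then t else (1 : ℝ)))]
  simp only [integral_restrict_Ioo_symm hs]
  refine Finset.prod_eq_zero (Finset.mem_univ i) ?_
  simp

lemma integral_sign_symm {s : ℝ} :
    ∫ t in (-s)..s, Real.sign t = 0 := by
  have := intervalIntegral.integral_comp_neg (a := -s) (b := s) Real.sign
  simp only [Real.sign_neg, intervalIntegral.integral_neg, neg_neg] at this
  linarith

lemma integral_boxMeasure_sign {s : ℝ} (hs : 0 ≤ s) {n : ℕ} (i : Fin n) :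
    ∫ y, Real.sign (y i) ∂boxMeasure n s = 0 := by
  have h1 : ∀ y : Fin n → ℝ, Real.sign (y i) = ∏ k, (if k = i then Real.sign (y k) else 1) := by
    intro y
    simp
  simp_rw [h1]
  rw [integral_fintype_prod_eq_prod (fun k t => (if k = i then Real.sign t else (1 : ℝ)))]
  simp only [integral_restrict_Ioo_symm hs]
  refine Finset.prod_eq_zero (Finset.mem_univ i) ?_
  simp [integral_sign_symm]

lemma integral_boxMeasure_coord_mul_sign {s : ℝ} (hs : 0 ≤ s) {n : ℕ} (i j : Fin n) :
    ∫ y, y j * Real.sign (y i) ∂boxMeasure n s = if j = i then (2 * s) ^ n * (s / 2) else 0 := by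
  have h1 : ∀ y : Fin n → ℝ, y j * Real.sign (y i) =
      ∏ k, ((if k = j then y k else 1) * (if k = i then Real.sign (y k) else 1)) := by
    intro y
    rw [Finset.prod_mul_distrib]
    simp
  simp_rw [h1]
  rw [integral_fintype_prod_eq_prod
    (fun k t => (if k = j then t else 1) * (if k = i then Real.sign t else (1 : ℝ)))]
  simp only [integral_restrict_Ioo_symm hs]
  split_ifs with hij
  · subst hij
    have h2 : ∀ k, ∫ t in (-s)..s, (if k = j then t else 1) * (if k = j then Real.sign t else (1 : ℝ)) =
        (2 * s) * if k = j then s / 2 else 1 := by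
      intro k
      split_ifs with h
      · have h3 : ∀ t : ℝ, t * Real.sign t = |t| := fun t => by
          rcases lt_trichotomy t 0 with h | h | h
          · simp [Real.sign_of_neg h, abs_of_neg h]
          · simp [h]
          · simp [Real.sign_of_pos h, abs_of_pos h]
        simp only [h3]
        rw [← intervalIntegral.integral_add_adjacent_intervals (b := 0)
          (continuous_abs.intervalIntegrable _ _) (continuous_abs.intervalIntegrable _ _)]
        have e1 : ∫ t in (-s)..0, |t| = ∫ t in (-s)..0, -t := by
          refine intervalIntegral.integral_congr fun t ht => ?_
          rw [Set.uIcc_of_le (by linarith)] at ht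
          exact abs_of_nonpos ht.2
        have e2 : ∫ t in (0 : ℝ)..s, |t| = ∫ t in (0 : ℝ)..s, t := by
          refine intervalIntegral.integral_congr fun t ht => ?_
          rw [Set.uIcc_of_le hs] at ht
          exact abs_of_nonneg ht.1
        rw [e1, e2, intervalIntegral.integral_neg, integral_id, integral_id]
        ring
      · simp; ring
    simp only [h2, Finset.prod_mul_distrib]
    simp [mul_pow]
  · refine Finset.prod_eq_zero (Finset.mem_univ i) ?_
    simp [Ne.symm hij, integral_sign_symm]

/-- The first absolute moment of a linear form on a box is largest along the coordinate axes. -/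
lemma integral_boxMeasure_abs_le {s : ℝ} (hs : 0 < s) {n : ℕ} (a : Fin n → ℝ) :
    ∫ y, |∑ i, a i * y i| ∂boxMeasure n s ≤ √(∑ i, a i ^ 2) * (s / 2) * (2 * s) ^ n := by
  set A := √(∑ i, a i ^ 2) with hA
  have hA2 : A ^ 2 = ∑ i, a i ^ 2 := Real.sq_sqrt (Finset.sum_nonneg fun i _ => sq_nonneg _)
  have hA0 : 0 ≤ A := Real.sqrt_nonneg _
  rcases hA0.eq_or_lt with h0 | h0
  · have : ∀ i, a i = 0 := by
      rw [← h0] at hA2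
      intro i
      have := (Finset.sum_eq_zero_iff_of_nonneg (fun i _ => sq_nonneg (a i))).1
        (by rw [← hA2]; norm_num) i (Finset.mem_univ i)
      exact pow_eq_zero_iff (two_ne_zero) |>.1 this
    simp [this, ← h0]
  · have hp := integral_boxMeasure_peakTest_nonneg hs.le n a
      (isPeakTest_certificate (α := 3 / (4 * A * s)) (β := A * s / 4) (by positivity)
        (by field_simp; norm_num))
    have hsq : ∫ y, (∑ i, a i * y i) ^ 2 ∂boxMeasure n s = A ^ 2 * ((2 * s) ^ n * (s ^ 2 / 3)) := by
      have h1 : ∀ y : Fin n → ℝ, (∑ i, a i * y i) ^ 2 =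
          ∑ i, ∑ j, (a i * a j) * (y i * y j) := by
        intro y
        rw [sq, Finset.sum_mul_sum]
        exact Finset.sum_congr rfl fun i _ => Finset.sum_congr rfl fun j _ => by ring
      simp_rw [h1]
      rw [integral_finsetSum _ fun i _ => integrable_boxMeasure (by fun_prop)]
      have h2 : ∀ i, ∫ y, ∑ j, (a i * a j) * (y i * y j) ∂boxMeasure n s =
          ∑ j, (a i * a j) * if i = j then (2 * s) ^ n * (s ^ 2 / 3) else 0 := by
        intro i
        rw [integral_finsetSum _ fun j _ => integrable_boxMeasure (by fun_prop)]
        simp_rw [integral_const_mul, integral_boxMeasure_coord_mul hs.le]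
      simp_rw [h2]
      simp only [mul_ite, mul_zero, Finset.sum_ite_eq, Finset.mem_univ, if_true]
      rw [hA2, Finset.sum_mul]
      exact Finset.sum_congr rfl fun i _ => by ring
    have hvol : (boxMeasure n s).real Set.univ = (2 * s) ^ n := by
      rw [measureReal_def, Measure.pi_univ]
      simp only [Measure.restrict_apply MeasurableSet.univ, Set.univ_inter, Real.volume_Ioo]
      rw [Finset.prod_const, ENNReal.toReal_pow, ENNReal.toReal_ofReal (by linarith)]
      simp; ring
    rw [integral_sub (integrable_boxMeasure (by fun_prop)) (integrable_boxMeasure (by fun_prop)),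
      integral_add (integrable_boxMeasure (by fun_prop)) (integrable_boxMeasure (by fun_prop)),
      integral_const_mul, hsq, integral_const, hvol, smul_eq_mul] at hp
    have : 3 / (4 * A * s) * (A ^ 2 * ((2 * s) ^ n * (s ^ 2 / 3))) + (2 * s) ^ n * (A * s / 4)
        = A * (s / 2) * (2 * s) ^ n := by
      field_simp
      norm_num
    linarith

end Box

section Cube

variable {n : ℕ}

/-- The open cube centred at `c` with side length `ε`, oriented by the isometry `T`. -/
def cube (T : EuclideanSpace ℝ (Fin n) ≃ₗᵢ[ℝ] EuclideanSpace ℝ (Fin n))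
    (c : EuclideanSpace ℝ (Fin n)) (ε : ℝ) : Set (EuclideanSpace ℝ (Fin n)) :=
  (fun y => c + T y) '' {y : EuclideanSpace ℝ (Fin n) | ∀ i, |y i| < ε / 2}

variable {T : EuclideanSpace ℝ (Fin n) ≃ₗᵢ[ℝ] EuclideanSpace ℝ (Fin n)}
  {c x y : EuclideanSpace ℝ (Fin n)} {ε : ℝ}

lemma isCube_cube : IsCube n ε (cube T c ε) := ⟨T, c, rfl⟩

lemma mem_cube : x ∈ cube T c ε ↔ ∀ i, |T.symm (x - c) i| < ε / 2 := by
  constructor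
  · rintro ⟨y, hy, rfl⟩
    simpa using hy
  · intro h
    exact ⟨T.symm (x - c), h, by simp⟩

lemma cube_eq_preimage : cube T c ε = (fun x => T.symm (x - c)) ⁻¹' {y | ∀ i, |y i| < ε / 2} :=
  Set.ext fun _ => mem_cube

lemma isOpen_cube : IsOpen (cube T c ε) := by
  rw [cube_eq_preimage]
  refine IsOpen.preimage (T.symm.continuous.comp (by fun_prop)) ?_
  simp only [Set.ofPred_forall]
  exact isOpen_iInter_of_finite fun i => isOpen_lt (by fun_prop) continuous_const

lemma measurableSet_cube : MeasurableSet (cube T c ε) := isOpen_cube.measurableSet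

lemma center_mem_cube (hε : 0 < ε) : c ∈ cube T c ε := by
  rw [mem_cube]
  simpa using fun _ => hε

lemma convex_cube : Convex ℝ (cube T c ε) := by
  have h : Convex ℝ {y : EuclideanSpace ℝ (Fin n) | ∀ i, |y i| < ε / 2} := by
    intro x hx y hy a b ha hb hab i
    simp only [Set.mem_ofPred_eq] at hx hy
    simp only [PiLp.add_apply, PiLp.smul_apply, smul_eq_mul]
    have h1 := abs_lt.1 (hx i)
    have h2 := abs_lt.1 (hy i)
    rw [abs_lt]
    have : b = 1 - a := by linarith
    subst this
    rcases ha.eq_or_lt with h | h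
    · rw [← h]; constructor <;> linarith
    · constructor <;> nlinarith
  have h2 := (h.linear_image T.toLinearEquiv.toLinearMap).translate c
  rw [Set.image_image] at h2
  exact h2

lemma norm_sub_center_le (hx : x ∈ cube T c ε) : ‖x - c‖ ≤ n * ε / 2 := by
  rw [mem_cube] at hx
  rw [← T.symm.norm_map, EuclideanSpace.norm_eq]
  rcases Nat.eq_zero_or_pos n with rfl | hn
  · simp
  have hε : 0 < ε / 2 := (abs_nonneg _).trans_lt (hx ⟨0, hn⟩)
  refine Real.sqrt_le_iff.2 ⟨by nlinarith [(Nat.cast_nonneg n : (0 : ℝ) ≤ n)], ?_⟩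
  calc ∑ i, ‖T.symm (x - c) i‖ ^ 2 ≤ ∑ _i : Fin n, (ε / 2) ^ 2 := by
        refine Finset.sum_le_sum fun i _ => ?_
        rw [Real.norm_eq_abs]
        exact pow_le_pow_left₀ (abs_nonneg _) (hx i).le 2
    _ = n * (ε / 2) ^ 2 := by simp
    _ ≤ (n * ε / 2) ^ 2 := by
        have h1 : (1 : ℝ) ≤ n := by exact_mod_cast hn
        have : (n : ℝ) ≤ n ^ 2 := by nlinarith
        calc (n : ℝ) * (ε / 2) ^ 2 ≤ n ^ 2 * (ε / 2) ^ 2 := by gcongr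
          _ = _ := by ring

lemma norm_sub_le_of_mem_cube (hx : x ∈ cube T c ε) (hy : y ∈ cube T c ε) :
    ‖x - y‖ ≤ n * ε := by
  have h1 := norm_sub_center_le hx
  have h2 := norm_sub_center_le hy
  calc ‖x - y‖ = ‖(x - c) - (y - c)‖ := by simp
    _ ≤ ‖x - c‖ + ‖y - c‖ := norm_sub_le _ _
    _ ≤ _ := by linarith

lemma cube_subset_closedBall : cube T c ε ⊆ closedBall c (n * ε / 2) := fun x hx => by
  rw [mem_closedBall, dist_eq_norm]
  exact norm_sub_center_le hx

lemma sub_mem_cube {z : EuclideanSpace ℝ (Fin n)} : x - z ∈ cube T (c - z) ε ↔ x ∈ cube T c ε := by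
  simp [mem_cube]

lemma measurePreserving_cubeParam (T : EuclideanSpace ℝ (Fin n) ≃ₗᵢ[ℝ] EuclideanSpace ℝ (Fin n))
    (c : EuclideanSpace ℝ (Fin n)) :
    MeasurePreserving (fun y : Fin n → ℝ => c + T (WithLp.toLp 2 y)) :=
  (measurePreserving_add_left volume c).comp
    (T.measurePreserving.comp (PiLp.volume_preserving_toLp (Fin n)))

lemma measurableEmbedding_cubeParam
    (T : EuclideanSpace ℝ (Fin n) ≃ₗᵢ[ℝ] EuclideanSpace ℝ (Fin n))
    (c : EuclideanSpace ℝ (Fin n)) :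
    MeasurableEmbedding (fun y : Fin n → ℝ => c + T (WithLp.toLp 2 y)) :=
  (measurableEmbedding_addLeft c).comp
    (T.toMeasurableEquiv.measurableEmbedding.comp
      (MeasurableEquiv.toLp 2 (Fin n → ℝ)).measurableEmbedding)

lemma preimage_cubeParam : (fun y : Fin n → ℝ => c + T (WithLp.toLp 2 y)) ⁻¹' cube T c ε =
    Set.univ.pi fun _ => Set.Ioo (-(ε / 2)) (ε / 2) := by
  ext y
  simp [mem_cube, abs_lt]

lemma setIntegral_cube (g : EuclideanSpace ℝ (Fin n) → ℝ) :
    ∫ x in cube T c ε, g x = ∫ y, g (c + T (WithLp.toLp 2 y)) ∂boxMeasure n (ε / 2) := by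
  rw [← (measurePreserving_cubeParam T c).setIntegral_preimage_emb
    (measurableEmbedding_cubeParam T c), preimage_cubeParam, boxMeasure_eq]

lemma volume_cube (hε : 0 ≤ ε) : volume (cube T c ε) = ENNReal.ofReal (ε ^ n) := by
  rw [← (measurePreserving_cubeParam T c).measure_preimage measurableSet_cube.nullMeasurableSet,
    preimage_cubeParam, volume_pi, Measure.pi_pi]
  simp [ENNReal.ofReal_pow hε]

lemma volume_cube_lt_top (hε : 0 ≤ ε) : volume (cube T c ε) < ⊤ := by
  rw [volume_cube hε]; exact ENNReal.ofReal_lt_top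

lemma volume_real_cube (hε : 0 ≤ ε) : volume.real (cube T c ε) = ε ^ n := by
  rw [measureReal_def, volume_cube hε, ENNReal.toReal_ofReal (by positivity)]

lemma inner_cubeParam (v : EuclideanSpace ℝ (Fin n)) (y : Fin n → ℝ) :
    ⟪v, (c + T (WithLp.toLp 2 y)) - c⟫ = ∑ i, T.symm v i * y i := by
  rw [add_sub_cancel_left, ← T.symm.inner_map_map, T.symm_apply_apply, PiLp.inner_apply]
  simp [mul_comm]

lemma setIntegral_cube_abs_inner_le (hε : 0 < ε) (v : EuclideanSpace ℝ (Fin n)) :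
    ∫ x in cube T c ε, |⟪v, x - c⟫| ≤ ‖v‖ * (ε / 4) * ε ^ n := by
  rw [setIntegral_cube]
  simp only [inner_cubeParam]
  refine (integral_boxMeasure_abs_le (by positivity) _).trans_eq ?_
  rw [← T.symm.norm_map v, EuclideanSpace.norm_eq]
  simp only [Real.norm_eq_abs, sq_abs]
  ring_nf

lemma setIntegral_cube_inner (hε : 0 < ε) (v : EuclideanSpace ℝ (Fin n)) :
    ∫ x in cube T c ε, ⟪v, x - c⟫ = 0 := by
  rw [setIntegral_cube]
  simp only [inner_cubeParam]
  rw [integral_finsetSum _ fun i _ => integrable_boxMeasure (by fun_prop)]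
  simp_rw [integral_const_mul, integral_boxMeasure_coord (by positivity : 0 ≤ ε / 2)]
  simp

lemma setIntegral_cube_sign (hε : 0 < ε) (i : Fin n) :
    ∫ x in cube T c ε, Real.sign ⟪T (EuclideanSpace.single i 1), x - c⟫ = 0 := by
  rw [setIntegral_cube]
  simp only [inner_cubeParam, T.symm_apply_apply]
  simpa using integral_boxMeasure_sign (by positivity : 0 ≤ ε / 2) i

lemma measurable_real_sign : Measurable Real.sign := by
  unfold Real.sign
  exact Measurable.ite measurableSet_Iio measurable_const
    (Measurable.ite measurableSet_Ioi measurable_const measurable_const)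

lemma abs_real_sign_le (t : ℝ) : |Real.sign t| ≤ 1 := by
  rcases Real.sign_apply_eq t with h | h | h <;> simp [h]

lemma setIntegral_cube_inner_mul_sign (hε : 0 < ε) (i : Fin n) (v : EuclideanSpace ℝ (Fin n)) :
    ∫ x in cube T c ε, ⟪v, x - c⟫ * Real.sign ⟪T (EuclideanSpace.single i 1), x - c⟫ =
      ε ^ n * (ε / 4) * ⟪v, T (EuclideanSpace.single i 1)⟫ := by
  rw [setIntegral_cube]
  simp only [inner_cubeParam, T.symm_apply_apply]
  have h1 : ∀ y : Fin n → ℝ, (∑ j, T.symm v j * y j) *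
      Real.sign (∑ j, (EuclideanSpace.single i (1 : ℝ) : EuclideanSpace ℝ (Fin n)) j * y j) =
      ∑ j, T.symm v j * (y j * Real.sign (y i)) := by
    intro y
    rw [Finset.sum_mul]
    simp [mul_assoc]
  simp_rw [h1]
  rw [integral_finsetSum]
  · simp_rw [integral_const_mul, integral_boxMeasure_coord_mul_sign (by positivity : 0 ≤ ε / 2)]
    simp only [mul_ite, mul_zero, Finset.sum_ite_eq', Finset.mem_univ, if_true]
    rw [← T.symm.inner_map_map, T.symm_apply_apply]
    rw [EuclideanSpace.inner_single_right]
    simp only [conj_trivial, one_mul]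
    ring
  · intro j _
    refine Integrable.const_mul ?_ _
    refine (integrable_boxMeasure (by fun_prop : Continuous fun y : Fin n → ℝ => y j)).mul_bdd
      (c := 1) ?_ ?_
    · exact (measurable_real_sign.comp (measurable_pi_apply i)).aestronglyMeasurable
    · exact Eventually.of_forall fun y => abs_real_sign_le _

end Cube

section Variation

variable {n : ℕ} {U V Ω : Set (EuclideanSpace ℝ (Fin n))}
  {Φ Ψ : EuclideanSpace ℝ (Fin n) → EuclideanSpace ℝ (Fin n)}
  {f g : EuclideanSpace ℝ (Fin n) → ℝ}

lemma vdiv_eq_zero {x : EuclideanSpace ℝ (Fin n)} (hx : x ∉ tsupport Φ) : vdiv n Φ x = 0 := by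
  have h : fderiv ℝ Φ x = 0 := by
    by_contra h
    exact hx (support_fderiv_subset ℝ h)
  simp [vdiv, h]

lemma continuous_vdiv (h : ContDiff ℝ 1 Φ) : Continuous (vdiv n Φ) := by
  have h1 := h.continuous_fderiv one_ne_zero
  unfold vdiv
  refine continuous_finsetSum _ fun i _ => ?_
  exact (EuclideanSpace.proj (𝕜 := ℝ) i).continuous.comp (h1.clm_apply continuous_const)

lemma hasCompactSupport_vdiv (h : HasCompactSupport Φ) : HasCompactSupport (vdiv n Φ) :=
  HasCompactSupport.intro h fun _ hx => vdiv_eq_zero hx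

lemma vdiv_add {x : EuclideanSpace ℝ (Fin n)} (h : DifferentiableAt ℝ Φ x)
    (h' : DifferentiableAt ℝ Ψ x) :
    vdiv n (fun x => Φ x + Ψ x) x = vdiv n Φ x + vdiv n Ψ x := by
  unfold vdiv
  rw [fderiv_fun_add h h', ← Finset.sum_add_distrib]
  rfl

lemma vdiv_smul {x : EuclideanSpace ℝ (Fin n)} {ζ : EuclideanSpace ℝ (Fin n) → ℝ}
    (hζ : DifferentiableAt ℝ ζ x) (h : DifferentiableAt ℝ Φ x) :
    vdiv n (fun x => ζ x • Φ x) x = ζ x * vdiv n Φ x + fderiv ℝ ζ x (Φ x) := by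
  unfold vdiv
  have h1 : fderiv ℝ ζ x (Φ x) = ∑ i, fderiv ℝ ζ x (EuclideanSpace.single i 1) * Φ x i := by
    conv_lhs => rw [← (EuclideanSpace.basisFun (Fin n) ℝ).sum_repr (Φ x)]
    simp [mul_comm]
  rw [fderiv_fun_smul hζ h, h1, Finset.mul_sum, ← Finset.sum_add_distrib]
  exact Finset.sum_congr rfl fun i _ => by simp

/-- Admissible vector fields in the definition of the variation on `U`. -/
structure IsTestField (U : Set (EuclideanSpace ℝ (Fin n)))
    (Φ : EuclideanSpace ℝ (Fin n) → EuclideanSpace ℝ (Fin n)) : Prop where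
  contDiff : ContDiff ℝ 1 Φ
  compact : HasCompactSupport Φ
  subset : tsupport Φ ⊆ U
  norm_le : ∀ x, ‖Φ x‖ ≤ 1

lemma IsTestField.mono (h : IsTestField U Φ) (hUV : U ⊆ V) : IsTestField V Φ :=
  ⟨h.contDiff, h.compact, h.subset.trans hUV, h.norm_le⟩

lemma setIntegral_mul_vdiv (h : tsupport Φ ⊆ U) :
    ∫ x in U, f x * vdiv n Φ x = ∫ x, f x * vdiv n Φ x :=
  setIntegral_eq_integral_of_forall_compl_eq_zero fun x hx => by
    rw [vdiv_eq_zero fun hx' => hx (h hx'), mul_zero]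

lemma IsTestField.le_variation (h : IsTestField U Φ) (f : EuclideanSpace ℝ (Fin n) → ℝ) :
    ENNReal.ofReal (∫ x, f x * vdiv n Φ x) ≤ variation n f U := by
  rw [← setIntegral_mul_vdiv h.subset]
  exact le_iSup_of_le Φ (le_iSup_of_le h.contDiff (le_iSup_of_le h.compact
    (le_iSup_of_le h.subset (le_iSup_of_le h.norm_le le_rfl))))

lemma variation_le {B : ℝ≥0∞}
    (h : ∀ Φ, IsTestField U Φ → ENNReal.ofReal (∫ x, f x * vdiv n Φ x) ≤ B) :
    variation n f U ≤ B := by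
  refine iSup_le fun Φ => iSup_le fun h1 => iSup_le fun h2 => iSup_le fun h3 => iSup_le fun h4 => ?_
  rw [setIntegral_mul_vdiv h3]
  exact h Φ ⟨h1, h2, h3, h4⟩

lemma exists_testField_lt {B : ℝ≥0∞} (h : B < variation n f U) :
    ∃ Φ, IsTestField U Φ ∧ B < ENNReal.ofReal (∫ x, f x * vdiv n Φ x) := by
  by_contra hc
  push Not at hc
  exact absurd (variation_le hc) (not_le.2 h)

lemma IsTestField.zero : IsTestField U (fun _ => 0) := by
  refine ⟨contDiff_const, HasCompactSupport.zero, ?_, by simp⟩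
  have : tsupport (0 : EuclideanSpace ℝ (Fin n) → EuclideanSpace ℝ (Fin n)) = ∅ :=
    tsupport_eq_empty_iff.2 rfl
  exact this.subset.trans (Set.empty_subset _)

lemma variation_mono (hUV : U ⊆ V) : variation n f U ≤ variation n f V :=
  variation_le fun _ h => (h.mono hUV).le_variation f

lemma integral_mul_vdiv_congr (hfg : ∀ᵐ x, x ∈ U → f x = g x) (h : tsupport Φ ⊆ U) :
    ∫ x, f x * vdiv n Φ x = ∫ x, g x * vdiv n Φ x := by
  refine integral_congr_ae (hfg.mono fun x hx => ?_)
  by_cases hxU : x ∈ tsupport Φ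
  · simp only [hx (h hxU)]
  · simp only [vdiv_eq_zero hxU, mul_zero]

lemma variation_congr (hfg : ∀ᵐ x, x ∈ U → f x = g x) : variation n f U = variation n g U := by
  apply le_antisymm
  · exact variation_le fun Φ h => by
      rw [integral_mul_vdiv_congr hfg h.subset]; exact h.le_variation g
  · exact variation_le fun Φ h => by
      rw [← integral_mul_vdiv_congr hfg h.subset]; exact h.le_variation f

lemma integrable_mul_of_locallyIntegrableOn {d : EuclideanSpace ℝ (Fin n) → ℝ}
    (hf : LocallyIntegrableOn f U) (hd : Continuous d) (hc : HasCompactSupport d)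
    (hU : tsupport d ⊆ U) : Integrable fun x => f x * d x := by
  have h1 : IntegrableOn (fun x => f x * d x) (tsupport d) :=
    (hf.integrableOn_compact_subset hU hc).mul_continuousOn hd.continuousOn hc
  refine h1.integrable_of_forall_notMem_eq_zero fun x hx => ?_
  rw [image_eq_zero_of_notMem_tsupport hx, mul_zero]

lemma tsupport_vdiv_subset : tsupport (vdiv n Φ) ⊆ tsupport Φ :=
  closure_minimal (fun x hx => by
    by_contra h
    exact hx (vdiv_eq_zero h)) (isClosed_tsupport _)

lemma integrable_mul_vdiv (hf : LocallyIntegrableOn f U) (h : ContDiff ℝ 1 Φ)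
    (hc : HasCompactSupport Φ) (hU : tsupport Φ ⊆ U) : Integrable fun x => f x * vdiv n Φ x :=
  integrable_mul_of_locallyIntegrableOn hf (continuous_vdiv h) (hasCompactSupport_vdiv hc)
    (tsupport_vdiv_subset.trans hU)

lemma ofReal_add_le_of_le {a b : ℝ} {B : ℝ≥0∞}
    (h : ENNReal.ofReal (a + b) ≤ B) (ha : ENNReal.ofReal a ≤ B) (hb : ENNReal.ofReal b ≤ B) :
    ENNReal.ofReal a + ENNReal.ofReal b ≤ B := by
  rcases le_total a 0 with h1 | h1
  · rwa [ENNReal.ofReal_of_nonpos h1, zero_add]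
  rcases le_total b 0 with h2 | h2
  · rwa [ENNReal.ofReal_of_nonpos h2, add_zero]
  rwa [← ENNReal.ofReal_add h1 h2]

lemma IsTestField.add (h : IsTestField U Φ) (h' : IsTestField V Ψ) (hd : Disjoint U V) :
    IsTestField (U ∪ V) (fun x => Φ x + Ψ x) := by
  refine ⟨h.contDiff.add h'.contDiff, h.compact.add h'.compact, ?_, fun x => ?_⟩
  · exact (tsupport_add Φ Ψ).trans (Set.union_subset_union h.subset h'.subset)
  · by_cases hx : x ∈ U
    · have : Ψ x = 0 := image_eq_zero_of_notMem_tsupport fun hx' =>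
        hd.ne_of_mem hx (h'.subset hx') rfl
      rw [this, add_zero]; exact h.norm_le x
    · have : Φ x = 0 := image_eq_zero_of_notMem_tsupport fun hx' => hx (h.subset hx')
      rw [this, zero_add]; exact h'.norm_le x

lemma integral_mul_vdiv_add (hf : LocallyIntegrableOn f U)
    (hΦ : ContDiff ℝ 1 Φ) (hΦc : HasCompactSupport Φ) (hΦU : tsupport Φ ⊆ U)
    (hΨ : ContDiff ℝ 1 Ψ) (hΨc : HasCompactSupport Ψ) (hΨU : tsupport Ψ ⊆ U) :
    ∫ x, f x * vdiv n (fun x => Φ x + Ψ x) x =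
      (∫ x, f x * vdiv n Φ x) + ∫ x, f x * vdiv n Ψ x := by
  rw [← integral_add (integrable_mul_vdiv hf hΦ hΦc hΦU) (integrable_mul_vdiv hf hΨ hΨc hΨU)]
  refine integral_congr_ae (Eventually.of_forall fun x => ?_)
  simp only
  rw [vdiv_add (hΦ.differentiable one_ne_zero x) (hΨ.differentiable one_ne_zero x), mul_add]

lemma variation_add_le (hf : LocallyIntegrableOn f Ω) (hU : U ⊆ Ω) (hV : V ⊆ Ω)
    (hd : Disjoint U V) :
    variation n f U + variation n f V ≤ variation n f (U ∪ V) := by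
  refine ENNReal.le_of_forall_pos_le_add fun η hη _ => ?_
  by_cases hfin : variation n f (U ∪ V) = ⊤
  · simp [hfin]
  have key : ∀ Φ Ψ, IsTestField U Φ → IsTestField V Ψ →
      ENNReal.ofReal (∫ x, f x * vdiv n Φ x) + ENNReal.ofReal (∫ x, f x * vdiv n Ψ x) ≤
        variation n f (U ∪ V) := by
    intro Φ Ψ hΦ hΨ
    refine ofReal_add_le_of_le ?_ ((hΦ.mono Set.subset_union_left).le_variation f)
      ((hΨ.mono Set.subset_union_right).le_variation f)
    rw [← integral_mul_vdiv_add hf hΦ.contDiff hΦ.compact (hΦ.subset.trans hU) hΨ.contDiff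
      hΨ.compact (hΨ.subset.trans hV)]
    exact (hΦ.add hΨ hd).le_variation f
  have h1 : ∀ Ψ, IsTestField V Ψ → variation n f U + ENNReal.ofReal (∫ x, f x * vdiv n Ψ x) ≤
      variation n f (U ∪ V) := by
    intro Ψ hΨ
    have hb : ENNReal.ofReal (∫ x, f x * vdiv n Ψ x) ≤ variation n f (U ∪ V) :=
      (hΨ.mono Set.subset_union_right).le_variation f
    rw [← ENNReal.le_sub_iff_add_le_right ENNReal.ofReal_ne_top hb]
    refine variation_le fun Φ hΦ => ?_
    rw [ENNReal.le_sub_iff_add_le_right ENNReal.ofReal_ne_top hb]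
    exact key Φ Ψ hΦ hΨ
  have hU' : variation n f U ≤ variation n f (U ∪ V) := variation_mono Set.subset_union_left
  have hUt : variation n f U ≠ ⊤ := ne_top_of_le_ne_top hfin hU'
  refine le_add_right ?_
  rw [← ENNReal.le_sub_iff_add_le_left hUt hU']
  refine variation_le fun Ψ hΨ => ?_
  rw [ENNReal.le_sub_iff_add_le_left hUt hU']
  exact h1 Ψ hΨ

lemma sum_variation_le {ι : Type*} (hf : LocallyIntegrableOn f Ω) (Q : ι → Set (EuclideanSpace ℝ (Fin n)))
    (hQ : ∀ i, Q i ⊆ Ω) (hd : Pairwise fun i j => Disjoint (Q i) (Q j)) (t : Finset ι) :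
    ∑ i ∈ t, variation n f (Q i) ≤ variation n f (⋃ i ∈ t, Q i) := by
  induction t using Finset.induction_on with
  | empty => simp
  | insert i t hi ih =>
    rw [Finset.sum_insert hi]
    refine (add_le_add le_rfl ih).trans ?_
    refine (variation_add_le hf (hQ i) (Set.iUnion₂_subset fun j _ => hQ j) ?_).trans ?_
    · rw [Set.disjoint_iUnion₂_right]
      intro j hj
      exact hd fun h => hi (h ▸ hj)
    · exact variation_mono (by simp)

lemma tsum_variation_le {ι : Type*} (hf : LocallyIntegrableOn f Ω) (Q : ι → Set (EuclideanSpace ℝ (Fin n)))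
    (hQ : ∀ i, Q i ⊆ Ω) (hd : Pairwise fun i j => Disjoint (Q i) (Q j)) :
    ∑' i, variation n f (Q i) ≤ variation n f Ω := by
  rw [ENNReal.tsum_eq_iSup_sum]
  exact iSup_le fun t => (sum_variation_le hf Q hQ hd t).trans
    (variation_mono (Set.iUnion₂_subset fun j _ => hQ j))

lemma fderiv_apply_coord {x : EuclideanSpace ℝ (Fin n)} (h : DifferentiableAt ℝ Φ x)
    (v : EuclideanSpace ℝ (Fin n)) (i : Fin n) :
    fderiv ℝ (fun x => Φ x i) x v = fderiv ℝ Φ x v i := by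
  have := ((EuclideanSpace.proj (𝕜 := ℝ) i).hasFDerivAt.comp x h.hasFDerivAt).fderiv
  change fderiv ℝ ((EuclideanSpace.proj (𝕜 := ℝ) i : EuclideanSpace ℝ (Fin n) → ℝ) ∘ Φ) x v = _
  rw [this]
  rfl

lemma integral_fderiv_apply_eq_zero {u : EuclideanSpace ℝ (Fin n) → ℝ} (hu : ContDiff ℝ 1 u)
    (hc : HasCompactSupport u) (v : EuclideanSpace ℝ (Fin n)) :
    Integrable (fun x => fderiv ℝ u x v) ∧ ∫ x, fderiv ℝ u x v = 0 := by
  have hInt : Integrable fun x => fderiv ℝ u x v :=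
    ((hu.continuous_fderiv one_ne_zero).clm_apply
      continuous_const).integrable_of_hasCompactSupport (hc.fderiv_apply ℝ _)
  have h := integral_mul_fderiv_eq_neg_fderiv_mul_of_integrable (μ := volume) (𝕜 := ℝ)
    (f := fun _ : EuclideanSpace ℝ (Fin n) => (1 : ℝ)) (g := u)
    (v := v) (by simp) (by simpa using hInt)
    (by simpa using hu.continuous.integrable_of_hasCompactSupport hc)
    (fun x _ => differentiableAt_const _) (fun x _ => hu.differentiable one_ne_zero x)
  exact ⟨hInt, by simpa using h⟩

lemma integral_vdiv_eq_zero (hΦ : ContDiff ℝ 1 Φ) (hc : HasCompactSupport Φ) :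
    ∫ x, vdiv n Φ x = 0 := by
  have h : ∀ i : Fin n, _ := fun i => integral_fderiv_apply_eq_zero (u := fun x => Φ x i)
    ((EuclideanSpace.proj (𝕜 := ℝ) i).contDiff.comp hΦ)
    (hc.comp_left (g := fun v : EuclideanSpace ℝ (Fin n) => v i) rfl) (EuclideanSpace.single i 1)
  simp_rw [fun i : Fin n => fun x => fderiv_apply_coord (hΦ.differentiable one_ne_zero x)
    (EuclideanSpace.single i 1) i] at h
  unfold vdiv
  rw [integral_finsetSum _ fun i _ => (h i).1]
  exact Finset.sum_eq_zero fun i _ => (h i).2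

lemma integrable_fderiv_apply_field {u : EuclideanSpace ℝ (Fin n) → ℝ} (hu : ContDiff ℝ 1 u)
    (hΦ : Continuous Φ) (hc : HasCompactSupport Φ) : Integrable fun x => fderiv ℝ u x (Φ x) := by
  have h1 : Continuous fun x => fderiv ℝ u x (Φ x) :=
    (hu.continuous_fderiv one_ne_zero).clm_apply hΦ
  refine h1.integrable_of_hasCompactSupport (HasCompactSupport.intro hc fun x hx => ?_)
  rw [image_eq_zero_of_notMem_tsupport hx, map_zero]

/-- Integration by parts against a compactly supported vector field. -/
lemma integral_mul_vdiv_eq_neg {u : EuclideanSpace ℝ (Fin n) → ℝ} (hu : ContDiff ℝ 1 u)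
    (hΦ : ContDiff ℝ 1 Φ) (hc : HasCompactSupport Φ) :
    ∫ x, u x * vdiv n Φ x = -∫ x, fderiv ℝ u x (Φ x) := by
  have hc' : HasCompactSupport fun x => u x • Φ x := HasCompactSupport.intro hc fun x hx => by
    rw [image_eq_zero_of_notMem_tsupport hx, smul_zero]
  have hz : ∫ x, vdiv n (fun x => u x • Φ x) x = 0 := integral_vdiv_eq_zero (hu.smul hΦ) hc'
  have h1 : ∀ x, vdiv n (fun x => u x • Φ x) x = u x * vdiv n Φ x + fderiv ℝ u x (Φ x) := fun x =>
    vdiv_smul (hu.differentiable one_ne_zero x) (hΦ.differentiable one_ne_zero x)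
  simp_rw [h1] at hz
  rw [integral_add ?_ (integrable_fderiv_apply_field hu hΦ.continuous hc)] at hz
  · linarith
  · exact (hu.continuous.mul (continuous_vdiv hΦ)).integrable_of_hasCompactSupport
      (hasCompactSupport_vdiv hc).mul_left

end Variation

section Mollifier

open scoped Convolution

variable {n : ℕ} {F : Type*} [NormedAddCommGroup F] [NormedSpace ℝ F]
  {φ : ContDiffBump (0 : EuclideanSpace ℝ (Fin n))}
  {U V : Set (EuclideanSpace ℝ (Fin n))}
  {Φ : EuclideanSpace ℝ (Fin n) → EuclideanSpace ℝ (Fin n)}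
  {w d : EuclideanSpace ℝ (Fin n) → ℝ} {g : EuclideanSpace ℝ (Fin n) → F}

/-- Mollification by a normalised bump function. -/
def moll (φ : ContDiffBump (0 : EuclideanSpace ℝ (Fin n))) (g : EuclideanSpace ℝ (Fin n) → F) :
    EuclideanSpace ℝ (Fin n) → F :=
  φ.normed volume ⋆[ContinuousLinearMap.lsmul ℝ ℝ, volume] g

lemma moll_apply (x : EuclideanSpace ℝ (Fin n)) :
    moll φ g x = ∫ t, φ.normed volume t • g (x - t) := rfl

lemma normed_eq_zero {t : EuclideanSpace ℝ (Fin n)} (ht : φ.rOut ≤ ‖t‖) :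
    φ.normed volume t = 0 := by
  by_contra h
  have h1 : t ∈ Function.support (φ.normed volume) := h
  rw [φ.support_normed_eq, mem_ball_zero_iff] at h1
  exact absurd h1 (not_lt.2 ht)

lemma moll_congr {g' : EuclideanSpace ℝ (Fin n) → F} {x : EuclideanSpace ℝ (Fin n)}
    (h : ∀ y ∈ ball x φ.rOut, g y = g' y) : moll φ g x = moll φ g' x := by
  rw [moll_apply, moll_apply]
  refine integral_congr_ae (Eventually.of_forall fun t => ?_)
  rcases lt_or_ge ‖t‖ φ.rOut with ht | ht
  · simp only
    rw [h _ (by simpa [mem_ball, dist_eq_norm] using ht)]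
  · simp only [normed_eq_zero ht, zero_smul]

lemma moll_eq_zero {x : EuclideanSpace ℝ (Fin n)} (hx : x ∉ cthickening φ.rOut (tsupport g)) :
    moll φ g x = 0 := by
  rw [moll_congr (g' := fun _ => 0)]
  · simp [moll_apply]
  · intro y hy
    by_contra hy'
    exact hx (mem_cthickening_of_dist_le x y _ _ (subset_tsupport _ hy') (by
      rw [dist_comm]; exact (mem_ball.1 hy).le))

lemma tsupport_moll_subset : tsupport (moll φ g) ⊆ cthickening φ.rOut (tsupport g) :=
  closure_minimal (fun x hx => by
    by_contra h
    exact hx (moll_eq_zero h)) isClosed_cthickening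

lemma hasCompactSupport_moll (hg : HasCompactSupport g) : HasCompactSupport (moll φ g) :=
  HasCompactSupport.of_support_subset_isCompact (K := cthickening φ.rOut (tsupport g))
    (IsCompact.cthickening hg) ((subset_tsupport _).trans tsupport_moll_subset)

lemma norm_moll_le {M : ℝ} (h : ∀ x, ‖g x‖ ≤ M) (x : EuclideanSpace ℝ (Fin n)) :
    ‖moll φ g x‖ ≤ M := by
  have h1 := norm_integral_le_of_norm_le (μ := volume) (φ.integrable_normed.mul_const M)
    (f := fun t => φ.normed volume t • g (x - t)) (Eventually.of_forall fun t => by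
      rw [norm_smul, Real.norm_of_nonneg (φ.nonneg_normed t)]
      exact mul_le_mul_of_nonneg_left (h _) (φ.nonneg_normed t))
  rwa [integral_mul_const, φ.integral_normed, one_mul] at h1

lemma contDiff_moll [CompleteSpace F] (hg : LocallyIntegrable g) {m : ℕ∞} :
    ContDiff ℝ m (moll φ g) :=
  φ.hasCompactSupport_normed.contDiff_convolution_left _ φ.contDiff_normed hg

lemma integrable_moll [CompleteSpace F] (hg : Integrable g) : Integrable (moll φ g) :=
  φ.integrable_normed.integrable_convolution _ hg

lemma integral_moll_mul (hw : Integrable w) (hd : Continuous d) {M : ℝ} (hM : ∀ x, ‖d x‖ ≤ M) :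
    ∫ x, moll φ w x * d x = ∫ x, w x * moll φ d x := by
  have hρ : Integrable (φ.normed volume) volume := φ.integrable_normed
  have i1 : Integrable (fun p : EuclideanSpace ℝ (Fin n) × EuclideanSpace ℝ (Fin n) =>
      (φ.normed volume p.2 * w (p.1 - p.2)) * d p.1) (volume.prod volume) :=
    (hρ.convolution_integrand (ContinuousLinearMap.lsmul ℝ ℝ) hw).mul_bdd (c := M)
      (hd.comp continuous_fst).aestronglyMeasurable (Eventually.of_forall fun p => hM _)
  have i2 : Integrable (fun p : EuclideanSpace ℝ (Fin n) × EuclideanSpace ℝ (Fin n) =>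
      (w p.1 * φ.normed volume p.2) * d (p.1 + p.2)) (volume.prod volume) :=
    (hw.mul_prod hρ).mul_bdd (c := M)
      (hd.comp (continuous_fst.add continuous_snd)).aestronglyMeasurable
      (Eventually.of_forall fun p => hM _)
  calc ∫ x, moll φ w x * d x
      = ∫ x, ∫ t, (φ.normed volume t * w (x - t)) * d x := by
        refine integral_congr_ae (Eventually.of_forall fun x => ?_)
        simp only [moll_apply, smul_eq_mul, integral_mul_const]
    _ = ∫ t, ∫ x, (φ.normed volume t * w (x - t)) * d x := integral_integral_swap i1
    _ = ∫ t, ∫ x, (w x * φ.normed volume t) * d (x + t) := by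
        refine integral_congr_ae (Eventually.of_forall fun t => ?_)
        simp only
        rw [← integral_add_right_eq_self _ t]
        refine integral_congr_ae (Eventually.of_forall fun x => ?_)
        simp only [add_sub_cancel_right]
        ring
    _ = ∫ x, ∫ t, (w x * φ.normed volume t) * d (x + t) := (integral_integral_swap i2).symm
    _ = ∫ x, w x * moll φ d x := by
        refine integral_congr_ae (Eventually.of_forall fun x => ?_)
        simp only [moll_apply, smul_eq_mul]
        rw [← integral_const_mul, ← integral_neg_eq_self]
        refine integral_congr_ae (Eventually.of_forall fun t => ?_)
        simp only [φ.normed_neg, ← sub_eq_add_neg]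
        ring

lemma locallyIntegrable_normed : LocallyIntegrable (φ.normed volume) volume :=
  φ.continuous_normed.locallyIntegrable

lemma contDiff_moll_of_contDiff {Φ : EuclideanSpace ℝ (Fin n) → F} (h : ContDiff ℝ 1 Φ)
    (hc : HasCompactSupport Φ) : ContDiff ℝ 1 (moll φ Φ) :=
  hc.contDiff_convolution_right (n := 1) _ locallyIntegrable_normed h

lemma fderiv_moll [CompleteSpace F] (h : ContDiff ℝ 1 g) (hc : HasCompactSupport g)
    (x v : EuclideanSpace ℝ (Fin n)) :
    fderiv ℝ (moll φ g) x v = moll φ (fun y => fderiv ℝ g y v) x := by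
  have h1 := (hc.hasFDerivAt_convolution_right (ContinuousLinearMap.lsmul ℝ ℝ)
    (locallyIntegrable_normed (φ := φ)) h x).fderiv
  have h2 := convolution_precompR_apply (𝕜 := ℝ) (ContinuousLinearMap.lsmul ℝ ℝ : ℝ →L[ℝ] F →L[ℝ] F)
    (locallyIntegrable_normed (φ := φ)) (hc.fderiv ℝ) (h.continuous_fderiv one_ne_zero) x v
  unfold moll
  rw [← h2, ← h1]

lemma integrable_normed_smul {d : EuclideanSpace ℝ (Fin n) → F} (hd : Continuous d)
    (x : EuclideanSpace ℝ (Fin n)) : Integrable fun t => φ.normed volume t • d (x - t) := by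
  have h1 : Continuous fun t => φ.normed volume t • d (x - t) :=
    φ.continuous_normed.smul (hd.comp (continuous_const.sub continuous_id))
  refine h1.integrable_of_hasCompactSupport
    (HasCompactSupport.intro (φ.hasCompactSupport_normed (μ := volume)) fun t ht => ?_)
  rw [image_eq_zero_of_notMem_tsupport ht, zero_smul]

lemma vdiv_moll (h : ContDiff ℝ 1 Φ) (hc : HasCompactSupport Φ) (x : EuclideanSpace ℝ (Fin n)) :
    vdiv n (moll φ Φ) x = moll φ (vdiv n Φ) x := by
  have hcont : ∀ i : Fin n, Continuous fun y => fderiv ℝ Φ y (EuclideanSpace.single i 1) :=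
    fun i => (h.continuous_fderiv one_ne_zero).clm_apply continuous_const
  unfold vdiv
  simp_rw [fderiv_moll h hc, moll_apply, smul_eq_mul, Finset.mul_sum]
  rw [integral_finsetSum]
  · refine Finset.sum_congr rfl fun i _ => ?_
    have := (EuclideanSpace.proj (𝕜 := ℝ) i : EuclideanSpace ℝ (Fin n) →L[ℝ] ℝ).integral_comp_comm
      (integrable_normed_smul (φ := φ) (hcont i) x)
    exact this.symm
  · intro i _
    exact integrable_normed_smul (φ := φ)
      ((EuclideanSpace.proj (𝕜 := ℝ) i).continuous.comp (hcont i)) x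

lemma IsTestField.moll (h : IsTestField U Φ) (hV : cthickening φ.rOut (tsupport Φ) ⊆ V) :
    IsTestField V (moll φ Φ) :=
  ⟨contDiff_moll_of_contDiff h.contDiff h.compact, hasCompactSupport_moll h.compact,
    tsupport_moll_subset.trans hV, norm_moll_le h.norm_le⟩

lemma integral_moll_mul_vdiv (hw : Integrable w) (h : ContDiff ℝ 1 Φ) (hc : HasCompactSupport Φ) :
    ∫ x, moll φ w x * vdiv n Φ x = ∫ x, w x * vdiv n (moll φ Φ) x := by
  obtain ⟨M, hM⟩ := (hasCompactSupport_vdiv hc).exists_bound_of_continuous (continuous_vdiv h)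
  rw [integral_moll_mul hw (continuous_vdiv h) hM]
  simp_rw [vdiv_moll h hc]

lemma variation_moll_le (hw : Integrable w)
    (hUV : cthickening φ.rOut U ⊆ V) : variation n (moll φ w) U ≤ variation n w V := by
  refine variation_le fun Φ hΦ => ?_
  rw [integral_moll_mul_vdiv hw hΦ.contDiff hΦ.compact]
  exact (hΦ.moll ((cthickening_subset_of_subset _ hΦ.subset).trans hUV)).le_variation w

/-- A bump function of outer radius `r`. -/
def bump (n : ℕ) (r : ℝ) (hr : 0 < r) : ContDiffBump (0 : EuclideanSpace ℝ (Fin n)) :=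
  ⟨r / 2, r, by linarith, by linarith⟩

/-- A sequence of bump functions concentrating at the origin. -/
def bumpSeq (n : ℕ) (k : ℕ) : ContDiffBump (0 : EuclideanSpace ℝ (Fin n)) :=
  bump n (1 / ((k : ℝ) + 1)) Nat.one_div_pos_of_nat

lemma tendsto_bumpSeq_rOut : Tendsto (fun k => (bumpSeq n k).rOut) atTop (𝓝 0) :=
  tendsto_one_div_add_atTop_nhds_zero_nat

lemma ae_tendsto_moll [CompleteSpace F] (hg : LocallyIntegrable g) :
    ∀ᵐ x, Tendsto (fun k => moll (bumpSeq n k) g x) atTop (𝓝 (g x)) :=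
  ContDiffBump.ae_convolution_tendsto_right_of_locallyIntegrable (K := 2) tendsto_bumpSeq_rOut
    (Eventually.of_forall fun k => by
      change 1 / ((k : ℝ) + 1) ≤ 2 * (1 / ((k : ℝ) + 1) / 2)
      linarith) hg

end Mollifier

section Energy

variable {n : ℕ} {C U V : Set (EuclideanSpace ℝ (Fin n))}
  {u w : EuclideanSpace ℝ (Fin n) → ℝ}

lemma cthickening_cthickening_of_le {r s t : ℝ} (hr : 0 ≤ r) (hs : 0 ≤ s) (h : r + s ≤ t)
    (C : Set (EuclideanSpace ℝ (Fin n))) : cthickening r (cthickening s C) ⊆ cthickening t C :=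
  (cthickening_cthickening_subset hr hs C).trans (cthickening_mono h C)

lemma closedBall_subset_cthickening_of_mem {r : ℝ} {x : EuclideanSpace ℝ (Fin n)} (hx : x ∈ C) :
    closedBall x r ⊆ cthickening r C := fun y hy =>
  mem_cthickening_of_dist_le y x _ _ hx hy

/-- Smooth cutoff functions. -/
lemma exists_cutoff (hC : IsCompact C) (hU : IsOpen U) (hCU : C ⊆ U) :
    ∃ χ : EuclideanSpace ℝ (Fin n) → ℝ, ContDiff ℝ 2 χ ∧ HasCompactSupport χ ∧ tsupport χ ⊆ U ∧
      (∀ x, 0 ≤ χ x) ∧ (∀ x, χ x ≤ 1) ∧ ∀ x ∈ C, χ x = 1 := by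
  obtain ⟨r, hr, hrU⟩ := hC.exists_cthickening_subset_open hU hCU
  have hr2 : 0 < r / 2 := by linarith
  set φ := bump n (r / 2) hr2
  have hφ : φ.rOut = r / 2 := rfl
  set D := cthickening (r / 2) C
  have hD : IsCompact D := hC.cthickening
  set g : EuclideanSpace ℝ (Fin n) → ℝ := D.indicator fun _ => 1
  have hg : Integrable g := by
    rw [integrable_indicator_iff hD.measurableSet]
    exact integrableOn_const hD.measure_lt_top.ne
  have hts : tsupport g ⊆ D := closure_minimal Set.support_indicator_subset hD.isClosed
  have hgc : HasCompactSupport g := HasCompactSupport.of_support_subset_isCompact hD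
    Set.support_indicator_subset
  have h01 : ∀ x, 0 ≤ g x ∧ g x ≤ 1 := fun x => by
    simp only [g, Set.indicator]; split_ifs <;> norm_num
  refine ⟨moll φ g, contDiff_moll (m := 2) hg.locallyIntegrable, hasCompactSupport_moll hgc,
    ?_, fun x => ?_, fun x => ?_, fun x hx => ?_⟩
  · refine tsupport_moll_subset.trans (((cthickening_subset_of_subset _ hts).trans ?_).trans hrU)
    exact cthickening_cthickening_of_le hr2.le hr2.le (by linarith) C
  · exact integral_nonneg fun t => mul_nonneg (φ.nonneg_normed t) (h01 _).1
  · refine (Real.le_norm_self _).trans (norm_moll_le (M := 1) (fun y => ?_) x)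
    rw [Real.norm_of_nonneg (h01 y).1]
    exact (h01 y).2
  · rw [moll_congr (g' := fun _ => (1 : ℝ))]
    · simp [moll_apply, φ.integral_normed]
    · intro y hy
      exact Set.indicator_of_mem (closedBall_subset_cthickening_of_mem hx
        (ball_subset_closedBall hy)) _

lemma sub_le_sq_div_sqrt {a s : ℝ} (ha : 0 ≤ a) (hs : 0 < s) :
    a - s ≤ a ^ 2 / √(a ^ 2 + s ^ 2) := by
  have h0 : 0 < √(a ^ 2 + s ^ 2) := Real.sqrt_pos.2 (by positivity)
  rw [le_div_iff₀ h0]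
  have h1 : √(a ^ 2 + s ^ 2) ≤ a + s := by
    rw [Real.sqrt_le_left (by positivity)]; nlinarith
  have h2 : a ≤ √(a ^ 2 + s ^ 2) := Real.le_sqrt_of_sq_le (by nlinarith)
  rcases le_total s a with h | h <;> nlinarith

lemma gradient_inner (x v : EuclideanSpace ℝ (Fin n)) :
    ⟪gradient u x, v⟫ = fderiv ℝ u x v := by
  simp [gradient]

lemma norm_gradient (x : EuclideanSpace ℝ (Fin n)) : ‖gradient u x‖ = ‖fderiv ℝ u x‖ := by
  simp [gradient]

lemma contDiff_gradient (hu : ContDiff ℝ 2 u) : ContDiff ℝ 1 (gradient u) :=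
  (InnerProductSpace.toDual ℝ (EuclideanSpace ℝ (Fin n))).symm.toContinuousLinearEquiv.contDiff.comp
    (hu.fderiv_right (m := 1) (by norm_num))

/-- For smooth functions the variation dominates the integral of the gradient. -/
lemma lintegral_enorm_fderiv_le_variation (hu : ContDiff ℝ 2 u) (hC : IsCompact C)
    (hU : IsOpen U) (hCU : C ⊆ U) :
    ∫⁻ x in C, ‖fderiv ℝ u x‖ₑ ≤ variation n u U := by
  obtain ⟨χ, hχ, hχc, hχU, hχ0, hχ1, hχC⟩ := exists_cutoff hC hU hCU
  have hu1 : ContDiff ℝ 1 u := hu.of_le (by norm_num)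
  have hcf : Continuous fun x => ‖fderiv ℝ u x‖ := (hu1.continuous_fderiv one_ne_zero).norm
  have key : ∀ s : ℝ, 0 < s → ENNReal.ofReal (∫ x in C, (‖fderiv ℝ u x‖ - s)) ≤
      variation n u U := by
    intro s hs
    set q : EuclideanSpace ℝ (Fin n) → ℝ := fun x => √(‖gradient u x‖ ^ 2 + s ^ 2)
    have hq : ∀ x, 0 < q x := fun x => Real.sqrt_pos.2 (by positivity)
    have hqc : ContDiff ℝ 1 q :=
      (((contDiff_gradient hu).norm_sq ℝ).add contDiff_const).sqrt fun x => by positivity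
    set Ψ : EuclideanSpace ℝ (Fin n) → EuclideanSpace ℝ (Fin n) :=
      fun x => (-(χ x / q x)) • gradient u x
    have hΨz : ∀ x, x ∉ tsupport χ → Ψ x = 0 := fun x hx => by
      simp only [Ψ, image_eq_zero_of_notMem_tsupport hx, zero_div, neg_zero, zero_smul]
    have hΨ : IsTestField U Ψ := by
      refine ⟨?_, HasCompactSupport.intro hχc hΨz, ?_, fun x => ?_⟩
      · exact (((hχ.of_le (by norm_num)).div hqc fun x => (hq x).ne').neg).smul
          (contDiff_gradient hu)
      · refine (closure_minimal (fun x hx => ?_) (isClosed_tsupport _)).trans hχU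
        by_contra h
        exact hx (hΨz x h)
      · have h1 : ‖gradient u x‖ ≤ q x := Real.le_sqrt_of_sq_le (by nlinarith)
        simp only [Ψ]
        rw [norm_smul, norm_neg, Real.norm_of_nonneg (div_nonneg (hχ0 x) (hq x).le),
          div_mul_eq_mul_div, div_le_one (hq x)]
        nlinarith [hχ1 x, hχ0 x, norm_nonneg (gradient u x)]
    have hval : ∀ x, -fderiv ℝ u x (Ψ x) =
        χ x * (‖fderiv ℝ u x‖ ^ 2 / √(‖fderiv ℝ u x‖ ^ 2 + s ^ 2)) := by
      intro x
      rw [← gradient_inner, ← norm_gradient]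
      simp only [Ψ, q, inner_smul_right, real_inner_self_eq_norm_sq]
      ring
    refine le_trans (ENNReal.ofReal_le_ofReal ?_) (hΨ.le_variation u)
    rw [integral_mul_vdiv_eq_neg hu1 hΨ.contDiff hΨ.compact, ← integral_neg]
    have hInt := (integrable_fderiv_apply_field hu1 hΨ.contDiff.continuous hΨ.compact).neg
    refine le_trans (setIntegral_mono_on ?_ hInt.integrableOn hC.measurableSet fun x hx => ?_)
      (setIntegral_le_integral hInt (Eventually.of_forall fun x => ?_))
    · exact (hcf.sub continuous_const).continuousOn.integrableOn_compact hC
    · simp only [Pi.neg_apply]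
      rw [hval, hχC x hx, one_mul]
      exact sub_le_sq_div_sqrt (norm_nonneg _) hs
    · simp only [Pi.neg_apply, Pi.zero_apply]
      rw [hval]
      exact mul_nonneg (hχ0 x) (by positivity)
  refine ENNReal.le_of_forall_pos_le_add fun η hη _ => ?_
  have hCv : volume C ≠ ⊤ := hC.measure_lt_top.ne
  have hs : 0 < (η : ℝ) / (volume.real C + 1) := div_pos hη (by positivity)
  have h1 := key _ hs
  have hi : IntegrableOn (fun x => ‖fderiv ℝ u x‖) C := hcf.continuousOn.integrableOn_compact hC
  rw [integral_sub hi (integrableOn_const hCv), setIntegral_const, smul_eq_mul] at h1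
  have h2 : ∫⁻ x in C, ‖fderiv ℝ u x‖ₑ = ENNReal.ofReal (∫ x in C, ‖fderiv ℝ u x‖) := by
    rw [ofReal_integral_norm_eq_lintegral_enorm]
    exact (integrable_norm_iff
      (hu1.continuous_fderiv one_ne_zero).aestronglyMeasurable).1 hi
  rw [h2]
  calc ENNReal.ofReal (∫ x in C, ‖fderiv ℝ u x‖)
      ≤ ENNReal.ofReal ((∫ x in C, ‖fderiv ℝ u x‖) -
          volume.real C * (η / (volume.real C + 1)) + η) := by
        refine ENNReal.ofReal_le_ofReal ?_
        have : volume.real C * (η / (volume.real C + 1)) ≤ η := by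
          rw [mul_div_assoc', div_le_iff₀ (by positivity)]
          nlinarith [η.2, (measureReal_nonneg : 0 ≤ volume.real C), show (0:ℝ) ≤ η from η.2]
        linarith
    _ ≤ _ := by
        refine ENNReal.ofReal_add_le.trans (add_le_add h1 ?_)
        simp

lemma lintegral_enorm_fderiv_moll_le {φ : ContDiffBump (0 : EuclideanSpace ℝ (Fin n))}
    (hw : Integrable w) (hC : IsCompact C) (hV : IsOpen V) (hCV : cthickening φ.rOut C ⊆ V) :
    ∫⁻ x in C, ‖fderiv ℝ (moll φ w) x‖ₑ ≤ variation n w V := by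
  obtain ⟨r, hr, hrU⟩ := (hC.cthickening (r := φ.rOut)).exists_cthickening_subset_open hV hCV
  have h1 : C ⊆ thickening r C := self_subset_thickening hr C
  refine (lintegral_enorm_fderiv_le_variation (contDiff_moll (m := 2) hw.locallyIntegrable) hC
    isOpen_thickening h1).trans (variation_moll_le hw ?_)
  refine ((cthickening_subset_of_subset _ (thickening_subset_cthickening r C)).trans ?_).trans hrU
  rw [cthickening_cthickening φ.rOut_pos.le hr.le, add_comm,
    ← cthickening_cthickening hr.le φ.rOut_pos.le]

end Energy

section Truncation

variable {n : ℕ} {U V Ω K : Set (EuclideanSpace ℝ (Fin n))}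
  {f g w d b : EuclideanSpace ℝ (Fin n) → ℝ} {ψ : ℝ → ℝ} {B : ℝ}

/-- Smooth bounded truncations of the identity. -/
structure IsTrunc (ψ : ℝ → ℝ) (B : ℝ) : Prop where
  contDiff : ContDiff ℝ 1 ψ
  abs_le : ∀ t, |ψ t| ≤ B
  zero : ψ 0 = 0
  deriv_nonneg : ∀ t, 0 ≤ deriv ψ t
  deriv_le : ∀ t, deriv ψ t ≤ 1

lemma IsTrunc.abs_le_abs (h : IsTrunc ψ B) (t : ℝ) : |ψ t| ≤ |t| := by
  have := Convex.norm_image_sub_le_of_norm_deriv_le (f := ψ) (s := Set.univ) (x := 0) (y := t)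
    (C := 1) (fun x _ => h.contDiff.differentiable one_ne_zero x)
    (fun x _ => by
      rw [Real.norm_of_nonneg (h.deriv_nonneg x)]; exact h.deriv_le x) convex_univ
    (Set.mem_univ _) (Set.mem_univ _)
  simpa [h.zero] using this

/-- The arctangent truncation at height of order `k`. -/
def trunc (k : ℕ) (t : ℝ) : ℝ := ((k : ℝ) + 1) * Real.arctan (t / (k + 1))

lemma isTrunc_trunc (k : ℕ) : IsTrunc (trunc k) ((k + 1) * (Real.pi / 2)) := by
  have hk : (0 : ℝ) < k + 1 := by positivity
  have hd : ∀ t, HasDerivAt (trunc k) (1 / (1 + (t / (k + 1)) ^ 2)) t := fun t => by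
    have := (((hasDerivAt_id t).div_const ((k : ℝ) + 1)).arctan).const_mul ((k : ℝ) + 1)
    refine HasDerivAt.congr_deriv this ?_
    simp only [id]
    field_simp
  refine ⟨?_, fun t => ?_, by simp [trunc], fun t => ?_, fun t => ?_⟩
  · exact contDiff_const.mul (Real.contDiff_arctan.comp (contDiff_id.div_const _))
  · rw [trunc, abs_mul, abs_of_pos hk]
    exact mul_le_mul_of_nonneg_left (abs_le.2 ⟨(Real.neg_pi_div_two_lt_arctan _).le,
      (Real.arctan_lt_pi_div_two _).le⟩) hk.le
  · rw [(hd t).deriv]; positivity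
  · rw [(hd t).deriv, div_le_one (by positivity)]
    nlinarith [sq_nonneg (t / ((k : ℝ) + 1))]

lemma tendsto_trunc (t : ℝ) : Tendsto (fun k => trunc k t) atTop (𝓝 t) := by
  have h1 : HasDerivAt (fun s : ℝ => Real.arctan (t * s)) t 0 := by
    have := ((hasDerivAt_id (0 : ℝ)).const_mul t).arctan
    simpa using this
  have h2 := h1.tendsto_slope_zero
  have h3 : Tendsto (fun k : ℕ => 1 / ((k : ℝ) + 1)) atTop (𝓝[≠] 0) :=
    tendsto_nhdsWithin_iff.2 ⟨tendsto_one_div_add_atTop_nhds_zero_nat,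
      Eventually.of_forall fun k => (Nat.one_div_pos_of_nat (α := ℝ)).ne'⟩
  refine (h2.comp h3).congr fun k => ?_
  simp [trunc, div_eq_mul_inv]

lemma integrable_indicator_of_locallyIntegrableOn (hf : LocallyIntegrableOn f Ω)
    (hK : IsCompact K) (hKΩ : K ⊆ Ω) : Integrable (K.indicator f) :=
  (integrable_indicator_iff hK.measurableSet).2 (hf.integrableOn_compact_subset hKΩ hK)

lemma tendsto_integral_moll_mul (hw : Integrable w) (hd : Continuous d)
    (hc : HasCompactSupport d) :
    Tendsto (fun k => ∫ x, moll (bumpSeq n k) w x * d x) atTop (𝓝 (∫ x, w x * d x)) := by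
  obtain ⟨M, hM⟩ := hc.exists_bound_of_continuous hd
  simp_rw [fun k => integral_moll_mul (φ := bumpSeq n k) hw hd hM]
  refine tendsto_integral_of_dominated_convergence (fun x => ‖w x‖ * M) (fun k => ?_)
    (hw.norm.mul_const M) (fun k => Eventually.of_forall fun x => ?_)
    (Eventually.of_forall fun x => ?_)
  · exact hw.aestronglyMeasurable.mul
      (contDiff_moll (m := 0) hd.locallyIntegrable).continuous.aestronglyMeasurable
  · rw [norm_mul]
    exact mul_le_mul_of_nonneg_left (norm_moll_le hM x) (norm_nonneg _)
  · exact tendsto_const_nhds.mul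
      (ContDiffBump.convolution_tendsto_right_of_continuous tendsto_bumpSeq_rOut hd x)

lemma tendsto_integral_comp_moll_mul (hψ : IsTrunc ψ B) (hw : LocallyIntegrable w)
    (hd : Continuous d) (hc : HasCompactSupport d) :
    Tendsto (fun k => ∫ x, ψ (moll (bumpSeq n k) w x) * d x) atTop (𝓝 (∫ x, ψ (w x) * d x)) := by
  have hψc : Continuous ψ := hψ.contDiff.continuous
  refine tendsto_integral_of_dominated_convergence (fun x => B * ‖d x‖) (fun k => ?_)
    ((hd.integrable_of_hasCompactSupport hc).norm.const_mul B)
    (fun k => Eventually.of_forall fun x => ?_) ((ae_tendsto_moll hw).mono fun x hx => ?_)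
  · exact ((hψc.comp (contDiff_moll (m := 0) hw).continuous).mul hd).aestronglyMeasurable
  · rw [norm_mul]
    exact mul_le_mul_of_nonneg_right (hψ.abs_le _) (norm_nonneg _)
  · exact ((hψc.tendsto _).comp hx).mul tendsto_const_nhds

lemma variation_add_le_of_forall {B : ℝ≥0∞}
    (h : ∀ Φ Ψ, IsTestField U Φ → IsTestField V Ψ →
      ENNReal.ofReal ((∫ x, f x * vdiv n Φ x) + ∫ x, g x * vdiv n Ψ x) ≤ B) :
    variation n f U + variation n g V ≤ B := by
  by_cases hfin : B = ⊤
  · simp [hfin]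
  have hz : ∀ e : EuclideanSpace ℝ (Fin n) → ℝ,
      ∫ x, e x * vdiv n (fun _ : EuclideanSpace ℝ (Fin n) => (0 : EuclideanSpace ℝ (Fin n))) x = 0 :=
    fun e => by simp [vdiv]
  have hf : ∀ Φ, IsTestField U Φ → ENNReal.ofReal (∫ x, f x * vdiv n Φ x) ≤ B := fun Φ hΦ => by
    have := h Φ _ hΦ IsTestField.zero
    rwa [hz, add_zero] at this
  have hg : ∀ Φ, IsTestField V Φ → ENNReal.ofReal (∫ x, g x * vdiv n Φ x) ≤ B := fun Φ hΦ => by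
    have := h _ Φ IsTestField.zero hΦ
    rwa [hz, zero_add] at this
  have hU' : variation n f U ≤ B := variation_le hf
  have hUt : variation n f U ≠ ⊤ := ne_top_of_le_ne_top hfin hU'
  rw [← ENNReal.le_sub_iff_add_le_left hUt hU']
  refine variation_le fun Ψ hΨ => ?_
  rw [ENNReal.le_sub_iff_add_le_left hUt hU',
    ← ENNReal.le_sub_iff_add_le_right ENNReal.ofReal_ne_top (hg Ψ hΨ)]
  refine variation_le fun Φ hΦ => ?_
  rw [ENNReal.le_sub_iff_add_le_right ENNReal.ofReal_ne_top (hg Ψ hΨ)]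
  exact ofReal_add_le_of_le (h Φ Ψ hΦ hΨ) (hf Φ hΦ) (hg Ψ hΨ)

lemma neg_integral_add_le {u : EuclideanSpace ℝ (Fin n) → ℝ} {C : Set (EuclideanSpace ℝ (Fin n))}
    {Φ Ψ : EuclideanSpace ℝ (Fin n) → EuclideanSpace ℝ (Fin n)}
    (hψ : IsTrunc ψ B) (hu : ContDiff ℝ 1 u) (hΦ : IsTestField C Φ) (hΨ : IsTestField C Ψ)
    (hC : IsCompact C) :
    ENNReal.ofReal ((∫ x, ψ (u x) * vdiv n Φ x) + ∫ x, (u x - ψ (u x)) * vdiv n Ψ x) ≤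
      ∫⁻ x in C, ‖fderiv ℝ u x‖ₑ := by
  have hψu : ContDiff ℝ 1 fun x => ψ (u x) := hψ.contDiff.comp hu
  have hd : ∀ x, fderiv ℝ (fun x => ψ (u x)) x = deriv ψ (u x) • fderiv ℝ u x := fun x =>
    ((hψ.contDiff.differentiable one_ne_zero (u x)).hasDerivAt.comp_hasFDerivAt x
      (hu.differentiable one_ne_zero x).hasFDerivAt).fderiv
  have hd2 : ∀ x, fderiv ℝ (fun x => u x - ψ (u x)) x = (1 - deriv ψ (u x)) • fderiv ℝ u x :=
    fun x => by
      rw [fderiv_fun_sub (hu.differentiable one_ne_zero x) (hψu.differentiable one_ne_zero x), hd,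
        sub_smul, one_smul]
  have i1 := integrable_fderiv_apply_field hψu hΦ.contDiff.continuous hΦ.compact
  have i2 := integrable_fderiv_apply_field (hu.sub hψu) hΨ.contDiff.continuous hΨ.compact
  rw [integral_mul_vdiv_eq_neg hψu hΦ.contDiff hΦ.compact,
    integral_mul_vdiv_eq_neg (hu.sub hψu) hΨ.contDiff hΨ.compact, ← neg_add,
    ← integral_add i1 i2, ← integral_neg]
  have hcf : Continuous (fderiv ℝ u) := hu.continuous_fderiv one_ne_zero
  have hi : IntegrableOn (fderiv ℝ u) C := hcf.continuousOn.integrableOn_compact hC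
  rw [← ofReal_integral_norm_eq_lintegral_enorm hi]
  refine ENNReal.ofReal_le_ofReal ?_
  rw [← integral_indicator hC.measurableSet]
  refine integral_mono (i1.add i2).neg
    ((integrable_indicator_iff hC.measurableSet).2 hi.norm) fun x => ?_
  simp only
  by_cases hx : x ∈ C
  · rw [Set.indicator_of_mem hx, hd, hd2]
    have a1 : |fderiv ℝ u x (Φ x)| ≤ ‖fderiv ℝ u x‖ := ((fderiv ℝ u x).le_opNorm _).trans
      (mul_le_of_le_one_right (norm_nonneg _) (hΦ.norm_le x))
    have a2 : |fderiv ℝ u x (Ψ x)| ≤ ‖fderiv ℝ u x‖ := ((fderiv ℝ u x).le_opNorm _).trans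
      (mul_le_of_le_one_right (norm_nonneg _) (hΨ.norm_le x))
    simp only [smul_apply, smul_eq_mul]
    nlinarith [hψ.deriv_nonneg (u x), hψ.deriv_le (u x), neg_abs_le (fderiv ℝ u x (Φ x)),
      neg_abs_le (fderiv ℝ u x (Ψ x))]
  · rw [Set.indicator_of_notMem hx, image_eq_zero_of_notMem_tsupport fun h => hx (hΦ.subset h),
      image_eq_zero_of_notMem_tsupport fun h => hx (hΨ.subset h)]
    simp

/-- Truncation splits the variation. -/
lemma variation_trunc_add_le (hψ : IsTrunc ψ B) (hΩ : IsOpen Ω) (hf : LocallyIntegrableOn f Ω) :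
    variation n (fun x => ψ (f x)) Ω + variation n (fun x => f x - ψ (f x)) Ω ≤
      variation n f Ω := by
  refine variation_add_le_of_forall fun Φ Ψ hΦ hΨ => ?_
  set C := tsupport Φ ∪ tsupport Ψ
  have hC : IsCompact C := IsCompact.union hΦ.compact hΨ.compact
  obtain ⟨r, hr, hrΩ⟩ := hC.exists_cthickening_subset_open hΩ
    (Set.union_subset hΦ.subset hΨ.subset)
  set K := cthickening r C
  have hK : IsCompact K := hC.cthickening
  set w := K.indicator f
  have hw : Integrable w := integrable_indicator_of_locallyIntegrableOn hf hK hrΩ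
  have hCK : C ⊆ K := self_subset_cthickening C
  have hfw : ∀ x ∈ K, w x = f x := fun x hx => Set.indicator_of_mem hx f
  have hΦC : IsTestField C Φ := ⟨hΦ.contDiff, hΦ.compact, Set.subset_union_left, hΦ.norm_le⟩
  have hΨC : IsTestField C Ψ := ⟨hΨ.contDiff, hΨ.compact, Set.subset_union_right, hΨ.norm_le⟩
  have e1 : ∫ x, ψ (f x) * vdiv n Φ x = ∫ x, ψ (w x) * vdiv n Φ x :=
    integral_mul_vdiv_congr (U := K) (f := fun x => ψ (f x)) (g := fun x => ψ (w x))
      (Eventually.of_forall fun x hx => by rw [hfw x hx]) (hΦC.subset.trans hCK)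
  have e2 : ∫ x, (f x - ψ (f x)) * vdiv n Ψ x = ∫ x, (w x - ψ (w x)) * vdiv n Ψ x :=
    integral_mul_vdiv_congr (U := K) (f := fun x => f x - ψ (f x)) (g := fun x => w x - ψ (w x))
      (Eventually.of_forall fun x hx => by rw [hfw x hx]) (hΨC.subset.trans hCK)
  have hsub : ∀ v : EuclideanSpace ℝ (Fin n) → ℝ, LocallyIntegrable v →
      ∫ x, (v x - ψ (v x)) * vdiv n Ψ x =
        (∫ x, v x * vdiv n Ψ x) - ∫ x, ψ (v x) * vdiv n Ψ x := fun v hv => by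
    rw [← integral_sub]
    · simp only [sub_mul]
    · exact integrable_mul_vdiv (hv.locallyIntegrableOn Set.univ) hΨ.contDiff hΨ.compact
        (Set.subset_univ _)
    · refine integrable_mul_vdiv (U := Set.univ) (LocallyIntegrable.locallyIntegrableOn ?_ _)
        hΨ.contDiff hΨ.compact (Set.subset_univ _)
      exact hv.mono (hψ.contDiff.continuous.comp_aestronglyMeasurable hv.aestronglyMeasurable)
        (Eventually.of_forall fun x => hψ.abs_le_abs _)
  rw [e1, e2, hsub w hw.locallyIntegrable]
  have hlim := (tendsto_integral_comp_moll_mul hψ hw.locallyIntegrable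
    (continuous_vdiv hΦ.contDiff) (hasCompactSupport_vdiv hΦ.compact)).add
    ((tendsto_integral_moll_mul hw (continuous_vdiv hΨ.contDiff)
      (hasCompactSupport_vdiv hΨ.compact)).sub
    (tendsto_integral_comp_moll_mul hψ hw.locallyIntegrable
      (continuous_vdiv hΨ.contDiff) (hasCompactSupport_vdiv hΨ.compact)))
  refine le_of_tendsto (ENNReal.tendsto_ofReal hlim) ?_
  filter_upwards [tendsto_bumpSeq_rOut.eventually (gt_mem_nhds hr)] with k hk
  have hu : ContDiff ℝ 1 (moll (bumpSeq n k) w) := contDiff_moll (m := 1) hw.locallyIntegrable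
  rw [← hsub _ hu.continuous.locallyIntegrable]
  refine (neg_integral_add_le hψ hu hΦC hΨC hC).trans ?_
  refine (lintegral_enorm_fderiv_moll_le hw hC (isOpen_thickening (δ := r) (E := C))
    (cthickening_subset_thickening' hr hk C)).trans ?_
  rw [variation_congr (f := w) (g := f) (Eventually.of_forall fun x hx =>
    hfw x (thickening_subset_cthickening r C hx))]
  exact variation_mono ((thickening_subset_cthickening r C).trans hrΩ)

lemma IsTrunc.locallyIntegrableOn (hψ : IsTrunc ψ B) (hf : LocallyIntegrableOn f Ω) :
    LocallyIntegrableOn (fun x => ψ (f x)) Ω := by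
  intro x hx
  obtain ⟨t, ht, hi⟩ := hf x hx
  exact ⟨t, ht, Integrable.mono hi (hψ.contDiff.continuous.comp_aestronglyMeasurable hi.aestronglyMeasurable)
    (Eventually.of_forall fun x => hψ.abs_le_abs _)⟩

/-- Truncations approximate a function of bounded variation in variation. -/
lemma exists_trunc_variation_sub_le (hΩ : IsOpen Ω) (hf : LocallyIntegrableOn f Ω)
    (hfin : variation n f Ω ≠ ⊤) {η : ℝ≥0∞} (hη : η ≠ 0) :
    ∃ k, variation n (fun x => f x - trunc k (f x)) Ω ≤ η := by
  have hex : ∃ k, variation n f Ω ≤ variation n (fun x => trunc k (f x)) Ω + η := by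
    rcases eq_or_ne (variation n f Ω) 0 with h0 | h0
    · exact ⟨0, by simp [h0]⟩
    obtain ⟨Φ, hΦ, hlt⟩ := exists_testField_lt (ENNReal.sub_lt_self hfin h0 hη)
    have hlim : Tendsto (fun k => ∫ x, trunc k (f x) * vdiv n Φ x) atTop
        (𝓝 (∫ x, f x * vdiv n Φ x)) := by
      have hi := integrable_mul_vdiv hf hΦ.contDiff hΦ.compact hΦ.subset
      refine tendsto_integral_of_dominated_convergence (fun x => ‖f x * vdiv n Φ x‖) (fun k => ?_)
        hi.norm (fun k => Eventually.of_forall fun x => ?_) (Eventually.of_forall fun x => ?_)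
      · exact (integrable_mul_vdiv ((isTrunc_trunc k).locallyIntegrableOn hf) hΦ.contDiff
          hΦ.compact hΦ.subset).aestronglyMeasurable
      · rw [norm_mul, norm_mul]
        exact mul_le_mul_of_nonneg_right ((isTrunc_trunc k).abs_le_abs _) (norm_nonneg _)
      · exact (tendsto_trunc _).mul tendsto_const_nhds
    obtain ⟨k, hk⟩ := ((ENNReal.tendsto_ofReal hlim).eventually (lt_mem_nhds hlt)).exists
    refine ⟨k, ?_⟩
    rw [← tsub_le_iff_right]
    exact hk.le.trans (hΦ.le_variation fun x => trunc k (f x))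
  obtain ⟨k, hk⟩ := hex
  refine ⟨k, ?_⟩
  have h1 := variation_trunc_add_le (isTrunc_trunc k) hΩ hf
  have hne : variation n (fun x => trunc k (f x)) Ω ≠ ⊤ :=
    ne_top_of_le_ne_top hfin (le_self_add.trans h1)
  exact (ENNReal.add_le_add_iff_left hne).1 (h1.trans hk)

/-- Mollification converges in `Lᵖ` for bounded functions with compact support. -/
lemma tendsto_eLpNorm_moll_sub (hb : AEStronglyMeasurable b volume) (hB : ∀ x, ‖b x‖ ≤ B)
    (hc : HasCompactSupport b) {p : ℝ≥0∞} (hp0 : p ≠ 0) (hp : p ≠ ⊤) :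
    Tendsto (fun k => eLpNorm (fun x => moll (bumpSeq n k) b x - b x) p volume) atTop (𝓝 0) := by
  have hbl : LocallyIntegrable b :=
    (memLp_top_of_bound hb B (Eventually.of_forall hB)).locallyIntegrable le_top
  have hpr : 0 < p.toReal := ENNReal.toReal_pos hp0 hp
  have hB0 : 0 ≤ B := (norm_nonneg _).trans (hB 0)
  set D := cthickening 1 (tsupport b)
  have hD : IsCompact D := IsCompact.cthickening hc
  have h1 : Tendsto (fun k => ∫⁻ x, ‖moll (bumpSeq n k) b x - b x‖ₑ ^ p.toReal) atTop
      (𝓝 (∫⁻ _ : EuclideanSpace ℝ (Fin n), 0)) := by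
    refine tendsto_lintegral_of_dominated_convergence'
      (D.indicator fun _ => ENNReal.ofReal (2 * B) ^ p.toReal) (fun k => ?_)
      (fun k => Eventually.of_forall fun x => ?_) ?_ ((ae_tendsto_moll hbl).mono fun x hx => ?_)
    · exact (((contDiff_moll (m := 0) hbl).continuous.aestronglyMeasurable.sub
        hb).enorm).pow_const _
    · by_cases hx : x ∈ D
      · rw [Set.indicator_of_mem hx]
        refine ENNReal.rpow_le_rpow ?_ hpr.le
        rw [← ofReal_norm]
        refine ENNReal.ofReal_le_ofReal ((norm_sub_le _ _).trans ?_)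
        linarith [norm_moll_le (φ := bumpSeq n k) hB x, hB x]
      · have hr : (bumpSeq n k).rOut ≤ 1 := by
          change 1 / ((k : ℝ) + 1) ≤ 1
          rw [div_le_one (by positivity)]
          linarith [(Nat.cast_nonneg k : (0 : ℝ) ≤ k)]
        simp only
        rw [Set.indicator_of_notMem hx, moll_eq_zero fun h => hx (cthickening_mono hr _ h),
          image_eq_zero_of_notMem_tsupport fun h => hx (self_subset_cthickening _ h)]
        simp [hpr]
    · rw [lintegral_indicator hD.measurableSet, setLIntegral_const]
      exact ENNReal.mul_ne_top (ENNReal.rpow_ne_top_of_nonneg hpr.le ENNReal.ofReal_ne_top)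
        hD.measure_lt_top.ne
    · have h2 : Tendsto (fun k => moll (bumpSeq n k) b x - b x) atTop (𝓝 0) := by
        simpa using hx.sub_const (b x)
      have h3 := (ENNReal.continuous_rpow_const (y := p.toReal)).tendsto _ |>.comp
        ((continuous_enorm.tendsto _).comp h2)
      simpa [hpr, Function.comp_def] using h3
  simp_rw [eLpNorm_eq_lintegral_rpow_enorm_toReal hp0 hp]
  have h4 := (ENNReal.continuous_rpow_const (y := 1 / p.toReal)).tendsto _ |>.comp h1
  simpa [hpr, Function.comp_def] using h4

end Truncation

section Poincare

variable {n : ℕ} {S Q Ω : Set (EuclideanSpace ℝ (Fin n))}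
  {f v w : EuclideanSpace ℝ (Fin n) → ℝ} {D ε : ℝ}
  {T : EuclideanSpace ℝ (Fin n) ≃ₗᵢ[ℝ] EuclideanSpace ℝ (Fin n)}
  {c : EuclideanSpace ℝ (Fin n)}

/-- The double oscillation integral of `f` over `Q`. -/
def dosc (f : EuclideanSpace ℝ (Fin n) → ℝ) (Q : Set (EuclideanSpace ℝ (Fin n))) : ℝ≥0∞ :=
  ∫⁻ x in Q, ∫⁻ y in Q, ‖f x - f y‖ₑ

lemma enorm_sub_le_lintegral_fderiv (hv : ContDiff ℝ 1 v) (x y : EuclideanSpace ℝ (Fin n)) :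
    ‖v x - v y‖ₑ ≤ ‖y - x‖ₑ * ∫⁻ t in Set.Icc (0 : ℝ) 1, ‖fderiv ℝ v (x + t • (y - x))‖ₑ := by
  have hd : ∀ t : ℝ, HasDerivAt (fun t : ℝ => v (x + t • (y - x)))
      (fderiv ℝ v (x + t • (y - x)) (y - x)) t := fun t => by
    have h1 : HasDerivAt (fun t : ℝ => x + t • (y - x)) (y - x) t := by
      simpa using ((hasDerivAt_id t).smul_const (y - x)).const_add x
    exact (hv.differentiable one_ne_zero _).hasFDerivAt.comp_hasDerivAt t h1
  have hc : Continuous fun t : ℝ => fderiv ℝ v (x + t • (y - x)) :=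
    (hv.continuous_fderiv one_ne_zero).comp
      (continuous_const.add (continuous_id.smul continuous_const))
  have hc2 : Continuous fun t : ℝ => fderiv ℝ v (x + t • (y - x)) (y - x) :=
    hc.clm_apply continuous_const
  have h := intervalIntegral.integral_eq_sub_of_hasDerivAt (a := 0) (b := 1) (fun t _ => hd t)
    (hc2.intervalIntegrable _ _)
  simp only [one_smul, zero_smul, add_zero, add_sub_cancel] at h
  rw [← enorm_neg, neg_sub, ← h, intervalIntegral.integral_of_le zero_le_one,
    ← integral_Icc_eq_integral_Ioc]
  refine (enorm_integral_le_lintegral_enorm _).trans ?_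
  rw [← lintegral_const_mul' _ _ enorm_ne_top]
  refine lintegral_mono fun t => ?_
  rw [mul_comm]
  exact ContinuousLinearMap.le_opENorm _ _

lemma dosc_le_of_contDiff (hv : ContDiff ℝ 1 v) (hS : Convex ℝ S) (hSm : MeasurableSet S)
    (hD : ∀ x ∈ S, ∀ y ∈ S, ‖x - y‖ ≤ D) :
    dosc v S ≤ ENNReal.ofReal D * (volume (closedBall (0 : EuclideanSpace ℝ (Fin n)) D) *
      ∫⁻ x in S, ‖fderiv ℝ v x‖ₑ) := by
  set G : EuclideanSpace ℝ (Fin n) → ℝ≥0∞ := S.indicator fun x => ‖fderiv ℝ v x‖ₑ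
  have hG : Measurable G := (hv.continuous_fderiv one_ne_zero).enorm.measurable.indicator hSm
  set J : EuclideanSpace ℝ (Fin n) → EuclideanSpace ℝ (Fin n) → ℝ≥0∞ :=
    fun x h => ∫⁻ t in Set.Icc (0 : ℝ) 1, G (x + t • h)
  have hJ : Measurable (Function.uncurry J) := by
    have h1 : Measurable fun q : (EuclideanSpace ℝ (Fin n) × EuclideanSpace ℝ (Fin n)) × ℝ =>
        G (q.1.1 + q.2 • q.1.2) := hG.comp (by fun_prop)
    exact h1.lintegral_prod_right'
  have hBm : MeasurableSet (closedBall (0 : EuclideanSpace ℝ (Fin n)) D) := measurableSet_closedBall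
  calc dosc v S ≤ ∫⁻ x in S, ∫⁻ y in S, ENNReal.ofReal D * J x (y - x) := by
        refine setLIntegral_mono' hSm fun x hx => setLIntegral_mono' hSm fun y hy => ?_
        refine (enorm_sub_le_lintegral_fderiv hv x y).trans (mul_le_mul' ?_ ?_)
        · rw [← ofReal_norm]
          exact ENNReal.ofReal_le_ofReal (hD y hy x hx)
        · refine setLIntegral_mono' measurableSet_Icc fun t ht => ?_
          have : x + t • (y - x) ∈ S := hS.add_smul_sub_mem hx hy ht
          exact (Set.indicator_of_mem this fun x => ‖fderiv ℝ v x‖ₑ).ge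
    _ = ENNReal.ofReal D * ∫⁻ x in S, ∫⁻ y in S, J x (y - x) := by
        simp_rw [lintegral_const_mul' _ _ ENNReal.ofReal_ne_top]
    _ ≤ ENNReal.ofReal D *
          ∫⁻ x : EuclideanSpace ℝ (Fin n), ∫⁻ h in closedBall (0 : EuclideanSpace ℝ (Fin n)) D, J x h := by
        refine mul_le_mul_right ?_ _
        refine (setLIntegral_mono' hSm fun x hx => ?_).trans (setLIntegral_le_lintegral _ _)
        have h1 := lintegral_sub_right_eq_self (μ := volume)
          ((closedBall (0 : EuclideanSpace ℝ (Fin n)) D).indicator (J x)) x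
        rw [← lintegral_indicator hBm, ← h1, ← lintegral_indicator hSm]
        refine lintegral_mono fun y => ?_
        by_cases hy : y ∈ S
        · rw [Set.indicator_of_mem hy, Set.indicator_of_mem]
          exact mem_closedBall_zero_iff.2 (hD y hy x hx)
        · rw [Set.indicator_of_notMem hy]; exact zero_le
    _ = ENNReal.ofReal D * ∫⁻ h in closedBall (0 : EuclideanSpace ℝ (Fin n)) D,
          ∫⁻ x : EuclideanSpace ℝ (Fin n), J x h := by
        rw [lintegral_lintegral_swap hJ.aemeasurable]
    _ = ENNReal.ofReal D * ∫⁻ h in closedBall (0 : EuclideanSpace ℝ (Fin n)) D, ∫⁻ x, G x := by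
        congr 1
        refine lintegral_congr fun h => ?_
        have h1 : Measurable fun q : EuclideanSpace ℝ (Fin n) × ℝ => G (q.1 + q.2 • h) :=
          hG.comp (by fun_prop)
        rw [lintegral_lintegral_swap h1.aemeasurable]
        rw [lintegral_congr fun t : ℝ => lintegral_add_right_eq_self G (t • h), setLIntegral_const,
          Real.volume_Icc, sub_zero, ENNReal.ofReal_one, mul_one]
    _ = _ := by
        rw [setLIntegral_const, lintegral_indicator hSm, mul_comm (∫⁻ x in S, ‖fderiv ℝ v x‖ₑ)]

lemma convex_cube_subset_compact {s : ℝ} (hs : s < ε) :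
    IsCompact (closure (cube T c s)) ∧ closure (cube T c s) ⊆ cube T c ε := by
  constructor
  · exact (isBounded_closedBall.subset cube_subset_closedBall).isCompact_closure
  · have hcl : IsClosed {x : EuclideanSpace ℝ (Fin n) | ∀ i, |T.symm (x - c) i| ≤ s / 2} := by
      simp only [Set.ofPred_forall]
      refine isClosed_iInter fun i => isClosed_le ?_ continuous_const
      exact ((EuclideanSpace.proj (𝕜 := ℝ) i).continuous.comp
        (T.symm.continuous.comp (continuous_id.sub continuous_const))).abs
    intro x hx
    have h1 : x ∈ {x : EuclideanSpace ℝ (Fin n) | ∀ i, |T.symm (x - c) i| ≤ s / 2} :=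
      closure_minimal (fun y hy i => (mem_cube.1 hy i).le) hcl hx
    exact mem_cube.2 fun i => (h1 i).trans_lt (by linarith)

lemma dosc_le_liminf {g : ℕ → EuclideanSpace ℝ (Fin n) → ℝ} (hg : ∀ k, Continuous (g k))
    (h : ∀ᵐ x, Tendsto (fun k => g k x) atTop (𝓝 (w x))) :
    dosc w S ≤ liminf (fun k => dosc (g k) S) atTop := by
  have hm : ∀ k, Measurable fun q : EuclideanSpace ℝ (Fin n) × EuclideanSpace ℝ (Fin n) =>
      ‖g k q.1 - g k q.2‖ₑ := fun k =>
    (((hg k).comp continuous_fst).sub ((hg k).comp continuous_snd)).enorm.measurable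
  have h' : ∀ᵐ x ∂(volume.restrict S), Tendsto (fun k => g k x) atTop (𝓝 (w x)) :=
    ae_restrict_of_ae h
  calc dosc w S ≤ ∫⁻ x in S, liminf (fun k => ∫⁻ y in S, ‖g k x - g k y‖ₑ) atTop := by
        refine lintegral_mono_ae (h'.mono fun x hx => ?_)
        refine le_trans (le_of_eq ?_) (lintegral_liminf_le fun k =>
          (hm k).comp measurable_prodMk_left)
        refine lintegral_congr_ae (h'.mono fun y hy => ?_)
        exact (((continuous_enorm.tendsto _).comp (hx.sub hy)).liminf_eq).symm
    _ ≤ _ := lintegral_liminf_le fun k => (hm k).lintegral_prod_right'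

lemma dosc_cube_le_of_lt {s : ℝ} (hf : LocallyIntegrableOn f Ω) (hQ : cube T c ε ⊆ Ω)
    (hs : s < ε) :
    dosc f (cube T c s) ≤ ENNReal.ofReal (n * ε) *
      (volume (closedBall (0 : EuclideanSpace ℝ (Fin n)) (n * ε)) *
        variation n f (cube T c ε)) := by
  obtain ⟨hC, hCQ⟩ := convex_cube_subset_compact (T := T) (c := c) hs
  set C := closure (cube T c s)
  set S := cube T c s
  obtain ⟨r, hr, hrQ⟩ := hC.exists_cthickening_subset_open isOpen_cube hCQ
  set K := cthickening r C
  have hK : IsCompact K := hC.cthickening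
  set w := K.indicator f
  have hw : Integrable w := integrable_indicator_of_locallyIntegrableOn hf hK (hrQ.trans hQ)
  have hfw : ∀ x ∈ K, w x = f x := fun x hx => Set.indicator_of_mem hx f
  have hSC : S ⊆ C := subset_closure
  have hSK : S ⊆ K := hSC.trans (self_subset_cthickening C)
  have e1 : dosc f S = dosc w S := by
    refine setLIntegral_congr_fun measurableSet_cube fun x hx => ?_
    refine setLIntegral_congr_fun measurableSet_cube fun y hy => ?_
    simp only [hfw x (hSK hx), hfw y (hSK hy)]
  have hcd : ∀ k, ContDiff ℝ 1 (moll (bumpSeq n k) w) := fun k =>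
    contDiff_moll (m := 1) hw.locallyIntegrable
  rw [e1]
  refine (dosc_le_liminf (fun k => (hcd k).continuous) (ae_tendsto_moll hw.locallyIntegrable)).trans
    (liminf_le_of_frequently_le' (Eventually.frequently ?_))
  filter_upwards [tendsto_bumpSeq_rOut.eventually (gt_mem_nhds hr)] with k hk
  refine (dosc_le_of_contDiff (hcd k) convex_cube measurableSet_cube (D := n * ε)
    fun x hx y hy => norm_sub_le_of_mem_cube (hCQ (hSC hx)) (hCQ (hSC hy))).trans ?_
  gcongr
  refine (lintegral_mono_set hSC).trans ((lintegral_enorm_fderiv_moll_le hw hC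
    (isOpen_thickening (δ := r) (E := C)) (cthickening_subset_thickening' hr hk C)).trans ?_)
  rw [variation_congr (f := w) (g := f) (Eventually.of_forall fun x hx =>
    hfw x (thickening_subset_cthickening r C hx))]
  exact variation_mono ((thickening_subset_cthickening r C).trans hrQ)

lemma dosc_eq_lintegral_prod (hf : AEStronglyMeasurable f (volume.restrict S)) :
    dosc f S = ∫⁻ q in S ×ˢ S, ‖f q.1 - f q.2‖ₑ ∂(volume.prod volume) := by
  rw [← Measure.prod_restrict, lintegral_prod]
  · rfl
  · exact (hf.comp_fst.sub hf.comp_snd).enorm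

lemma cube_eq_iUnion (hε : 0 < ε) :
    cube T c ε = ⋃ k : ℕ, cube T c (ε - ε * (1 / ((k : ℝ) + 1))) := by
  ext x
  simp only [Set.mem_iUnion, mem_cube]
  constructor
  · intro h
    have h1 : Tendsto (fun k : ℕ => (ε - ε * (1 / ((k : ℝ) + 1))) / 2) atTop (𝓝 (ε / 2)) := by
      simpa using ((tendsto_one_div_add_atTop_nhds_zero_nat.const_mul ε).const_sub ε).div_const 2
    exact (eventually_all.2 fun i => h1.eventually (lt_mem_nhds (h i))).exists
  · rintro ⟨k, hk⟩ i
    refine (hk i).trans ?_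
    have : 0 < ε * (1 / ((k : ℝ) + 1)) := by positivity
    linarith

lemma dosc_cube_le (hε : 0 < ε) (hf : LocallyIntegrableOn f Ω) (hQ : cube T c ε ⊆ Ω) :
    dosc f (cube T c ε) ≤ ENNReal.ofReal (n * ε) *
      (volume (closedBall (0 : EuclideanSpace ℝ (Fin n)) (n * ε)) *
        variation n f (cube T c ε)) := by
  have hm : AEStronglyMeasurable f (volume.restrict (cube T c ε)) :=
    (hf.mono_set hQ).aestronglyMeasurable
  set s : ℕ → ℝ := fun k => ε - ε * (1 / ((k : ℝ) + 1))
  have hs : ∀ k, s k < ε := fun k => by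
    have : 0 < ε * (1 / ((k : ℝ) + 1)) := by positivity
    simp only [s]; linarith
  have hmono : Monotone fun k => cube T c (s k) := by
    intro j k hjk x hx
    refine mem_cube.2 fun i => (mem_cube.1 hx i).trans_le ?_
    have : 1 / ((k : ℝ) + 1) ≤ 1 / ((j : ℝ) + 1) := Nat.one_div_le_one_div hjk
    simp only [s]
    nlinarith
  have hU : cube T c ε ×ˢ cube T c ε = ⋃ k, cube T c (s k) ×ˢ cube T c (s k) := by
    conv_lhs => rw [cube_eq_iUnion hε]
    rw [Set.iUnion_prod_of_monotone hmono hmono]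
  have hmono2 : Monotone fun k => cube T c (s k) ×ˢ cube T c (s k) :=
    fun _ _ h => Set.prod_mono (hmono h) (hmono h)
  rw [dosc_eq_lintegral_prod hm, hU, setLIntegral_iUnion_of_directed _ hmono2.directed_le]
  refine iSup_le fun k => ?_
  have hsub : cube T c (s k) ⊆ cube T c ε := by
    rw [cube_eq_iUnion hε]
    exact Set.subset_iUnion (fun k => cube T c (s k)) k
  rw [← dosc_eq_lintegral_prod (hm.mono_measure (Measure.restrict_mono hsub le_rfl))]
  exact dosc_cube_le_of_lt hf hQ (hs k)

/-- The constant in the Poincaré inequality on cubes. -/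
def poincareConst (n : ℕ) : ℝ≥0∞ :=
  ENNReal.ofReal ((n : ℝ) ^ (n + 1)) * volume (ball (0 : EuclideanSpace ℝ (Fin n)) 1)

lemma poincareConst_ne_top : poincareConst n ≠ ⊤ :=
  ENNReal.mul_ne_top ENNReal.ofReal_ne_top measure_ball_lt_top.ne

/-- Scale invariant Poincaré inequality on cubes. -/
lemma dosc_cube_le_variation (hn : 1 ≤ n) (hε : 0 < ε) (hf : LocallyIntegrableOn f Ω)
    (hQ : cube T c ε ⊆ Ω) :
    ENNReal.ofReal (ε ^ (n - 1)) * ((volume (cube T c ε))⁻¹ ^ 2 * dosc f (cube T c ε)) ≤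
      poincareConst n * variation n f (cube T c ε) := by
  refine (mul_le_mul_right (mul_le_mul_right (dosc_cube_le hε hf hQ) _) _).trans (le_of_eq ?_)
  rw [volume_cube hε.le, Measure.addHaar_closedBall _ _ (by positivity), finrank_euclideanSpace,
    Fintype.card_fin, poincareConst, ← ENNReal.ofReal_inv_of_pos (by positivity),
    ← ENNReal.ofReal_pow (by positivity)]
  simp only [← mul_assoc]
  congr 2
  rw [← ENNReal.ofReal_mul (by positivity), ← ENNReal.ofReal_mul (by positivity),
    ← ENNReal.ofReal_mul (by positivity)]
  congr 1
  obtain ⟨m, rfl⟩ : ∃ m, n = m + 1 := ⟨n - 1, by omega⟩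
  simp only [Nat.add_sub_cancel]
  field_simp
  ring

end Poincare

section Oscillation

variable {n : ℕ} {Q Ω : Set (EuclideanSpace ℝ (Fin n))}
  {f a u : EuclideanSpace ℝ (Fin n) → ℝ} {ε η : ℝ}
  {T : EuclideanSpace ℝ (Fin n) ≃ₗᵢ[ℝ] EuclideanSpace ℝ (Fin n)}
  {c : EuclideanSpace ℝ (Fin n)}

/-- The mean oscillation of `f` over `Q`. -/
def osc (f : EuclideanSpace ℝ (Fin n) → ℝ) (Q : Set (EuclideanSpace ℝ (Fin n))) : ℝ :=
  ⨍ x in Q, |f x - ⨍ y in Q, f y|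

lemma kappa_le {b : ℝ≥0∞} (h : ∀ F : Set (Set (EuclideanSpace ℝ (Fin n))),
    (∀ Q ∈ F, IsCube n ε Q ∧ Q ⊆ Ω) → F.Pairwise Disjoint →
    ∑' Q : F, ENNReal.ofReal (ε ^ (n - 1)) *
      ENNReal.ofReal (osc f (Q : Set (EuclideanSpace ℝ (Fin n)))) ≤ b) :
    kappa n ε f Ω ≤ b := by
  rw [kappa, ENNReal.mul_iSup]
  refine iSup_le fun F => ?_
  rw [ENNReal.mul_iSup]
  refine iSup_le fun hF => ?_
  rw [ENNReal.mul_iSup]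
  refine iSup_le fun hd => ?_
  rw [← ENNReal.tsum_mul_left]
  exact h F hF hd

lemma le_kappa {F : Set (Set (EuclideanSpace ℝ (Fin n)))}
    (hF : ∀ Q ∈ F, IsCube n ε Q ∧ Q ⊆ Ω) (hd : F.Pairwise Disjoint) :
    ∑' Q : F, ENNReal.ofReal (ε ^ (n - 1)) *
      ENNReal.ofReal (osc f (Q : Set (EuclideanSpace ℝ (Fin n)))) ≤ kappa n ε f Ω := by
  rw [ENNReal.tsum_mul_left, kappa]
  refine mul_le_mul_right ?_ _
  exact le_iSup_of_le F (le_iSup_of_le hF (le_iSup_of_le hd le_rfl))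

lemma osc_nonneg : 0 ≤ osc f Q := by
  rw [osc, setAverage_eq]
  exact smul_nonneg (by positivity) (integral_nonneg fun _ => abs_nonneg _)

lemma integrableOn_const' (hQ : volume Q < ⊤) (b : ℝ) :
    IntegrableOn (fun _ : EuclideanSpace ℝ (Fin n) => b) Q := integrableOn_const hQ.ne

lemma osc_eq_zero (h : ¬ IntegrableOn f Q)
    (hm : AEStronglyMeasurable f (volume.restrict Q)) : osc f Q = 0 := by
  have h0 : ⨍ y in Q, f y = 0 := by rw [setAverage_eq, integral_undef h, smul_zero]
  rw [osc, setAverage_eq, integral_undef, smul_zero]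
  rw [h0]
  intro h1
  refine h ⟨hm, ?_⟩
  simpa [HasFiniteIntegral, Real.enorm_abs] using h1.2

lemma ofReal_setAverage_abs_le (g : EuclideanSpace ℝ (Fin n) → ℝ) :
    ENNReal.ofReal (⨍ x in Q, |g x|) ≤ (volume Q)⁻¹ * ∫⁻ x in Q, ‖g x‖ₑ := by
  rw [setAverage_eq, smul_eq_mul, ENNReal.ofReal_mul (by positivity)]
  refine mul_le_mul' ?_ ?_
  · rw [measureReal_def, ← ENNReal.toReal_inv]
    exact ENNReal.ofReal_toReal_le
  · rw [← Real.enorm_eq_ofReal (integral_nonneg fun _ => abs_nonneg _)]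
    refine (enorm_integral_le_lintegral_enorm _).trans (le_of_eq ?_)
    simp only [Real.enorm_abs]

lemma ofReal_osc_le_dosc (h0 : volume Q ≠ 0) (hQ : volume Q < ⊤)
    (hm : AEStronglyMeasurable f (volume.restrict Q)) :
    ENNReal.ofReal (osc f Q) ≤ (volume Q)⁻¹ ^ 2 * dosc f Q := by
  by_cases hf : IntegrableOn f Q
  · refine (ofReal_setAverage_abs_le _).trans ?_
    rw [sq, mul_assoc, dosc]
    refine mul_le_mul_right ?_ _
    rw [← lintegral_const_mul' _ _ (ENNReal.inv_ne_top.2 h0)]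
    refine lintegral_mono fun x => ?_
    have h1 : f x - ⨍ y in Q, f y = ⨍ y in Q, (f x - f y) := by
      rw [setAverage_eq, setAverage_eq, integral_sub (integrableOn_const' hQ _) hf,
        setIntegral_const, smul_sub, smul_smul, inv_mul_cancel₀, one_smul]
      exact (ENNReal.toReal_pos h0 hQ.ne).ne'
    rw [h1, setAverage_eq, enorm_smul]
    refine mul_le_mul' ?_ (enorm_integral_le_lintegral_enorm _)
    rw [Real.enorm_eq_ofReal (by positivity), measureReal_def, ← ENNReal.toReal_inv]
    exact ENNReal.ofReal_toReal_le
  · rw [osc_eq_zero hf hm, ENNReal.ofReal_zero]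
    exact zero_le

lemma osc_add_le (hQ : volume Q < ⊤) (hm : AEStronglyMeasurable a (volume.restrict Q))
    (hu : IntegrableOn u Q) :
    osc (fun x => a x + u x) Q ≤ osc a Q + osc u Q := by
  by_cases ha : IntegrableOn a Q
  · have h1 : ∀ b : ℝ, IntegrableOn (fun x => |a x - b|) Q := fun b =>
      (ha.sub (integrableOn_const' hQ b)).abs
    have h2 : ∀ b : ℝ, IntegrableOn (fun x => |u x - b|) Q := fun b =>
      (hu.sub (integrableOn_const' hQ b)).abs
    have hav : ⨍ y in Q, (a y + u y) = (⨍ y in Q, a y) + ⨍ y in Q, u y := by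
      rw [setAverage_eq, setAverage_eq, setAverage_eq, integral_add ha hu, smul_add]
    simp only [osc]
    rw [hav, setAverage_eq, setAverage_eq (f := fun x => |a x - _|),
      setAverage_eq (f := fun x => |u x - _|), ← smul_add, ← integral_add (h1 _) (h2 _)]
    refine smul_le_smul_of_nonneg_left (integral_mono ?_ ((h1 _).add (h2 _)) fun x => ?_)
      (by positivity)
    · exact ((ha.add hu).sub (integrableOn_const' hQ _)).abs
    · simp only
      rw [add_sub_add_comm]
      exact abs_add_le _ _
  · rw [osc_eq_zero (f := fun x => a x + u x) _ (hm.add hu.aestronglyMeasurable)]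
    · exact add_nonneg osc_nonneg osc_nonneg
    · intro h
      exact ha ((h.sub hu).congr (Eventually.of_forall fun x => add_sub_cancel_right _ _))

lemma osc_le_of_forall {b : ℝ} (h0 : volume Q ≠ 0) (hQ : volume Q < ⊤) (hQm : MeasurableSet Q)
    (hu : IntegrableOn u Q) (h : ∀ x ∈ Q, ∀ y ∈ Q, |u x - u y| ≤ b) : osc u Q ≤ b := by
  have hp : 0 < volume.real Q := ENNReal.toReal_pos h0 hQ.ne
  have h1 : ∀ x ∈ Q, |u x - ⨍ y in Q, u y| ≤ b := by
    intro x hx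
    have h2 : u x - ⨍ y in Q, u y = ⨍ y in Q, (u x - u y) := by
      rw [setAverage_eq, setAverage_eq, integral_sub (integrableOn_const' hQ _) hu,
        setIntegral_const, smul_sub, smul_smul, inv_mul_cancel₀ hp.ne', one_smul]
    rw [h2, setAverage_eq, smul_eq_mul, abs_mul, abs_of_pos (inv_pos.2 hp), inv_mul_le_iff₀ hp,
      mul_comm]
    exact norm_setIntegral_le_of_norm_le_const (f := fun y => u x - u y) hQ
      fun y hy => h x hx y hy
  have h3 := setIntegral_mono_on ((hu.sub (integrableOn_const' hQ (⨍ y in Q, u y))).abs)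
    (integrableOn_const' hQ b) hQm h1
  rw [setIntegral_const, smul_eq_mul] at h3
  rw [osc, setAverage_eq, smul_eq_mul, inv_mul_le_iff₀ hp]
  exact h3

lemma volume_cube_ne_zero (hε : 0 < ε) : volume (cube T c ε) ≠ 0 := by
  rw [volume_cube hε.le]
  exact (ENNReal.ofReal_pos.2 (by positivity)).ne'

lemma integrableOn_cube_of_continuous (hu : Continuous u) : IntegrableOn u (cube T c ε) :=
  (hu.continuousOn.integrableOn_compact (isCompact_closedBall c (n * ε / 2))).mono_set
    cube_subset_closedBall

lemma osc_inner_le (hε : 0 < ε) (v : EuclideanSpace ℝ (Fin n)) :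
    osc (fun x => ⟪v, x - c⟫) (cube T c ε) ≤ ‖v‖ * (ε / 4) := by
  rw [osc, setAverage_eq (f := fun y => ⟪v, y - c⟫), setIntegral_cube_inner hε, smul_zero]
  simp only [sub_zero]
  rw [setAverage_eq, smul_eq_mul, volume_real_cube hε.le, inv_mul_le_iff₀ (by positivity),
    mul_comm]
  exact setIntegral_cube_abs_inner_le hε v

/-- The sharp oscillation bound for a function with almost constant gradient. -/
lemma osc_le_of_fderiv (hε : 0 < ε) (hη : 0 ≤ η) (hu : ContDiff ℝ 1 u)
    (h : ∀ x ∈ cube T c ε, ‖fderiv ℝ u x - fderiv ℝ u c‖ ≤ η) :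
    osc u (cube T c ε) ≤ ‖fderiv ℝ u c‖ * (ε / 4) + η * (n * ε) := by
  set v := gradient u c
  set g : EuclideanSpace ℝ (Fin n) → ℝ := fun x => u x - ⟪v, x - c⟫
  have hl : Continuous fun x : EuclideanSpace ℝ (Fin n) => ⟪v, x - c⟫ := by fun_prop
  have hg : Continuous g := hu.continuous.sub hl
  have hug : u = fun x => ⟪v, x - c⟫ + g x := by
    funext x; simp [g]
  have hgd : ∀ x, HasFDerivAt g (fderiv ℝ u x - fderiv ℝ u c) x := by
    intro x
    have h1 : HasFDerivAt (fun x : EuclideanSpace ℝ (Fin n) => ⟪v, x - c⟫) (fderiv ℝ u c) x := by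
      have h2 : (fun x : EuclideanSpace ℝ (Fin n) => ⟪v, x - c⟫) =
          fun x => fderiv ℝ u c (x - c) := by
        funext x
        exact gradient_inner _ _
      rw [h2]
      exact (fderiv ℝ u c).hasFDerivAt.comp x ((hasFDerivAt_id x).sub_const c)
    exact (hu.differentiable one_ne_zero x).hasFDerivAt.sub h1
  have hgo : osc g (cube T c ε) ≤ η * (n * ε) := by
    refine osc_le_of_forall (volume_cube_ne_zero hε) (volume_cube_lt_top hε.le) measurableSet_cube
      (integrableOn_cube_of_continuous hg) fun x hx y hy => ?_
    refine (Convex.norm_image_sub_le_of_norm_hasFDerivWithin_le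
      (fun z _ => (hgd z).hasFDerivWithinAt) h convex_cube hy hx).trans ?_
    exact mul_le_mul_of_nonneg_left (norm_sub_le_of_mem_cube hx hy) hη
  calc osc u (cube T c ε) = osc (fun x => ⟪v, x - c⟫ + g x) (cube T c ε) := by rw [← hug]
    _ ≤ osc (fun x => ⟪v, x - c⟫) (cube T c ε) + osc g (cube T c ε) :=
        osc_add_le (volume_cube_lt_top hε.le) hl.aestronglyMeasurable (integrableOn_cube_of_continuous hg)
    _ ≤ _ := by
        refine add_le_add ?_ hgo
        rw [← norm_gradient]
        exact osc_inner_le hε v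

lemma ofReal_osc_le_lintegral (hn : 1 ≤ n) (hε : 0 < ε) (hη : 0 ≤ η) (hu : ContDiff ℝ 1 u)
    (h : ∀ x ∈ cube T c ε, ‖fderiv ℝ u x - fderiv ℝ u c‖ ≤ η) :
    ENNReal.ofReal (ε ^ (n - 1)) * ENNReal.ofReal (osc u (cube T c ε)) ≤
      ∫⁻ x in cube T c ε, (‖fderiv ℝ u x‖ₑ / 4 + ENNReal.ofReal ((n + 1) * η)) := by
  set b : ℝ := ‖fderiv ℝ u c‖ / 4 + n * η
  calc ENNReal.ofReal (ε ^ (n - 1)) * ENNReal.ofReal (osc u (cube T c ε))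
      ≤ ENNReal.ofReal b * volume (cube T c ε) := by
        rw [volume_cube hε.le, ← ENNReal.ofReal_mul (by positivity),
          ← ENNReal.ofReal_mul (by positivity)]
        refine ENNReal.ofReal_le_ofReal ((mul_le_mul_of_nonneg_left
          (osc_le_of_fderiv hε hη hu h) (by positivity)).trans (le_of_eq ?_))
        obtain ⟨m, rfl⟩ : ∃ m, n = m + 1 := ⟨n - 1, by omega⟩
        simp only [Nat.add_sub_cancel, b]
        ring
    _ = ∫⁻ _ in cube T c ε, ENNReal.ofReal b := (setLIntegral_const _ _).symm
    _ ≤ _ := by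
        refine setLIntegral_mono' measurableSet_cube fun x hx => ?_
        have h4 : (4 : ℝ≥0∞) = ENNReal.ofReal 4 := by simp
        rw [← ofReal_norm, h4, ← ENNReal.ofReal_div_of_pos (by norm_num),
          ← ENNReal.ofReal_add (by positivity) (by positivity)]
        refine ENNReal.ofReal_le_ofReal ?_
        have h1 := norm_sub_norm_le (fderiv ℝ u c) (fderiv ℝ u x)
        rw [norm_sub_rev] at h1
        have h2 := h x hx
        simp only [b]
        linarith

end Oscillation

section Commutator

variable {n : ℕ} {U V Ω : Set (EuclideanSpace ℝ (Fin n))}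
  {w ζ : EuclideanSpace ℝ (Fin n) → ℝ}
  {Φ : EuclideanSpace ℝ (Fin n) → EuclideanSpace ℝ (Fin n)}
  {φ : ContDiffBump (0 : EuclideanSpace ℝ (Fin n))}

/-- The result of mollifying `w` where the cutoff `ζ` equals one. -/
def cutoffMoll (φ : ContDiffBump (0 : EuclideanSpace ℝ (Fin n)))
    (ζ w : EuclideanSpace ℝ (Fin n) → ℝ) (x : EuclideanSpace ℝ (Fin n)) : ℝ :=
  w x + (moll φ (fun y => w y * ζ y) x - w x * ζ x)

lemma moll_coord (hΦ : Continuous Φ) (x : EuclideanSpace ℝ (Fin n)) (i : Fin n) :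
    moll φ Φ x i = moll φ (fun y => Φ y i) x :=
  ((EuclideanSpace.proj (𝕜 := ℝ) i : EuclideanSpace ℝ (Fin n) →L[ℝ] ℝ).integral_comp_comm
    (integrable_normed_smul (φ := φ) hΦ x)).symm

lemma fderiv_eq_sum_coord (x v : EuclideanSpace ℝ (Fin n)) :
    fderiv ℝ ζ x v = ∑ i, fderiv ℝ ζ x (EuclideanSpace.single i 1) * v i := by
  conv_lhs => rw [← (EuclideanSpace.basisFun (Fin n) ℝ).sum_repr v]
  simp [mul_comm]

lemma coord_abs_le (v : EuclideanSpace ℝ (Fin n)) (i : Fin n) : ‖v i‖ ≤ ‖v‖ :=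
  PiLp.norm_apply_le v i

lemma isTestField_cutoff (hζ : ContDiff ℝ 1 ζ) (h0 : ∀ x, 0 ≤ ζ x) (h1 : ∀ x, ζ x ≤ 1)
    (hΦ : IsTestField U Φ) (hUV : U ⊆ V) (hV : cthickening φ.rOut U ∩ tsupport ζ ⊆ V) :
    IsTestField V fun x => (1 - ζ x) • Φ x + ζ x • moll φ Φ x := by
  have hm : ContDiff ℝ 1 (moll φ Φ) := contDiff_moll_of_contDiff hΦ.contDiff hΦ.compact
  have hmc : HasCompactSupport (moll φ Φ) := hasCompactSupport_moll hΦ.compact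
  have hms : tsupport (moll φ Φ) ⊆ cthickening φ.rOut U :=
    tsupport_moll_subset.trans (cthickening_subset_of_subset _ hΦ.subset)
  have hmn : ∀ x, ‖moll φ Φ x‖ ≤ 1 := norm_moll_le hΦ.norm_le
  generalize moll φ Φ = Ψ at hm hmc hms hmn ⊢
  have hs1 : tsupport (fun x => (1 - ζ x) • Φ x) ⊆ tsupport Φ :=
    tsupport_smul_subset_right (fun x => 1 - ζ x) Φ
  have hs2 : tsupport (fun x => ζ x • Ψ x) ⊆ tsupport Ψ := tsupport_smul_subset_right ζ Ψ
  have hs3 : tsupport (fun x => ζ x • Ψ x) ⊆ tsupport ζ := tsupport_smul_subset_left ζ Ψ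
  have hc1 : HasCompactSupport (fun x => (1 - ζ x) • Φ x) :=
    hΦ.compact.of_isClosed_subset (isClosed_tsupport _) hs1
  have hc2 : HasCompactSupport (fun x => ζ x • Ψ x) :=
    hmc.of_isClosed_subset (isClosed_tsupport _) hs2
  refine ⟨((contDiff_const.sub hζ).smul hΦ.contDiff).add (hζ.smul hm), hc1.add hc2, ?_,
    fun x => ?_⟩
  · exact (tsupport_add _ _).trans (Set.union_subset (hs1.trans (hΦ.subset.trans hUV))
      ((Set.subset_inter (hs2.trans hms) hs3).trans hV))
  · have h2 : ‖Ψ x‖ ≤ 1 := hmn x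
    refine (norm_add_le _ _).trans ?_
    rw [norm_smul, norm_smul, Real.norm_of_nonneg (h0 x),
      Real.norm_of_nonneg (sub_nonneg.2 (h1 x))]
    nlinarith [hΦ.norm_le x, h0 x, h1 x, norm_nonneg (Φ x), norm_nonneg (Ψ x)]

lemma integrable_mul_fderiv (hw : LocallyIntegrableOn w Ω) (hζ : ContDiff ℝ 1 ζ)
    (hζc : HasCompactSupport ζ) (hζΩ : tsupport ζ ⊆ Ω) (v : EuclideanSpace ℝ (Fin n)) :
    Integrable fun x => w x * fderiv ℝ ζ x v :=
  integrable_mul_of_locallyIntegrableOn hw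
    ((hζ.continuous_fderiv one_ne_zero).clm_apply continuous_const) (hζc.fderiv_apply ℝ _)
    ((tsupport_fderiv_apply_subset ℝ v).trans hζΩ)

lemma integral_cutoffMoll_mul_vdiv (hw : LocallyIntegrableOn w Ω) (hζ : ContDiff ℝ 1 ζ)
    (hζc : HasCompactSupport ζ) (hζΩ : tsupport ζ ⊆ Ω) (hΦ : IsTestField Ω Φ) :
    ∫ x, cutoffMoll φ ζ w x * vdiv n Φ x =
      (∫ x, w x * vdiv n (fun x => (1 - ζ x) • Φ x + ζ x • moll φ Φ x) x) +
      ∑ i, ∫ x, (w x * fderiv ℝ ζ x (EuclideanSpace.single i 1) -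
        moll φ (fun y => w y * fderiv ℝ ζ y (EuclideanSpace.single i 1)) x) * Φ x i := by
  set Ψ := moll φ Φ
  have hm : ContDiff ℝ 1 Ψ := contDiff_moll_of_contDiff hΦ.contDiff hΦ.compact
  have hmc : HasCompactSupport Ψ := hasCompactSupport_moll hΦ.compact
  set b : EuclideanSpace ℝ (Fin n) → ℝ := fun x => w x * ζ x
  have hb : Integrable b := integrable_mul_of_locallyIntegrableOn hw hζ.continuous hζc hζΩ
  set d : Fin n → EuclideanSpace ℝ (Fin n) → ℝ :=
    fun i x => w x * fderiv ℝ ζ x (EuclideanSpace.single i 1)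
  have hd : ∀ i, Integrable (d i) := fun i => integrable_mul_fderiv hw hζ hζc hζΩ _
  have hΦi : ∀ i, Continuous fun x => Φ x i := fun i =>
    (EuclideanSpace.proj (𝕜 := ℝ) i).continuous.comp hΦ.contDiff.continuous
  have hΨi : ∀ i, Continuous fun x => Ψ x i := fun i =>
    (EuclideanSpace.proj (𝕜 := ℝ) i).continuous.comp hm.continuous
  have hΦn : ∀ i x, ‖Φ x i‖ ≤ 1 := fun i x => (coord_abs_le _ i).trans (hΦ.norm_le x)
  have hΨn : ∀ i x, ‖Ψ x i‖ ≤ 1 := fun i x =>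
    (coord_abs_le _ i).trans (norm_moll_le hΦ.norm_le x)
  have hInt1 : Integrable fun x => w x * vdiv n Φ x :=
    integrable_mul_vdiv hw hΦ.contDiff hΦ.compact hΦ.subset
  have hvb : ∀ {g : EuclideanSpace ℝ (Fin n) → ℝ}, Integrable g →
      ∀ {Θ : EuclideanSpace ℝ (Fin n) → EuclideanSpace ℝ (Fin n)}, ContDiff ℝ 1 Θ →
      HasCompactSupport Θ → Integrable fun x => g x * vdiv n Θ x := fun hg _ h1 h2 =>
    integrable_mul_vdiv (U := Set.univ) (hg.locallyIntegrable.locallyIntegrableOn _) h1 h2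
      (Set.subset_univ _)
  have hdΦ : ∀ i, Integrable fun x => d i x * Φ x i := fun i =>
    (hd i).mul_bdd (hΦi i).aestronglyMeasurable (Eventually.of_forall (hΦn i))
  have hdΨ : ∀ i, Integrable fun x => d i x * Ψ x i := fun i =>
    (hd i).mul_bdd (hΨi i).aestronglyMeasurable (Eventually.of_forall (hΨn i))
  have hmΦ : ∀ i, Integrable fun x => moll φ (d i) x * Φ x i := fun i =>
    (integrable_moll (hd i)).mul_bdd (hΦi i).aestronglyMeasurable (Eventually.of_forall (hΦn i))
  have hcomm : ∀ i, ∫ x, moll φ (d i) x * Φ x i = ∫ x, d i x * Ψ x i := fun i => by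
    rw [integral_moll_mul (hd i) (hΦi i) (hΦn i)]
    simp_rw [Ψ, moll_coord hΦ.contDiff.continuous]
  have hpt : ∀ x, w x * vdiv n (fun x => (1 - ζ x) • Φ x + ζ x • Ψ x) x =
      (w x * vdiv n Φ x - b x * vdiv n Φ x) + b x * vdiv n Ψ x +
        (∑ i, d i x * Ψ x i - ∑ i, d i x * Φ x i) := by
    intro x
    have hζd := hζ.differentiable one_ne_zero x
    have hΦd := hΦ.contDiff.differentiable one_ne_zero x
    have hΨd := hm.differentiable one_ne_zero x
    have hζd' : DifferentiableAt ℝ (fun x => 1 - ζ x) x := hζd.const_sub 1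
    rw [vdiv_add (Φ := fun x => (1 - ζ x) • Φ x) (Ψ := fun x => ζ x • Ψ x)
      (hζd'.smul hΦd) (hζd.smul hΨd), vdiv_smul hζd' hΦd, vdiv_smul hζd hΨd,
      fderiv_const_sub]
    simp only [d, mul_assoc, ← Finset.mul_sum, ← fderiv_eq_sum_coord, b, neg_apply]
    ring
  have hsum : ∀ i, ∫ x, (d i x - moll φ (d i) x) * Φ x i =
      (∫ x, d i x * Φ x i) - ∫ x, d i x * Ψ x i := fun i => by
    rw [← hcomm i, ← integral_sub (hdΦ i) (hmΦ i)]
    simp_rw [sub_mul]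
  rw [Finset.sum_congr rfl fun i _ => hsum i, Finset.sum_sub_distrib,
    ← integral_finsetSum _ fun i _ => hdΦ i, ← integral_finsetSum _ fun i _ => hdΨ i]
  simp_rw [hpt]
  have hs1 := integrable_finsetSum Finset.univ fun i _ => hdΦ i
  have hs2 := integrable_finsetSum Finset.univ fun i _ => hdΨ i
  have hi2 := hvb hb hΦ.contDiff hΦ.compact
  have hi3 := hvb hb hm hmc
  have hi4 := hvb (integrable_moll (φ := φ) hb) hΦ.contDiff hΦ.compact
  have hi12 : Integrable fun x => w x * vdiv n Φ x - b x * vdiv n Φ x := hInt1.sub hi2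
  have hi123 : Integrable fun x => w x * vdiv n Φ x - b x * vdiv n Φ x + b x * vdiv n Ψ x :=
    hi12.add hi3
  have hs12 : Integrable fun x => ∑ i, d i x * Ψ x i - ∑ i, d i x * Φ x i := hs2.sub hs1
  have hi42 : Integrable fun x => moll φ b x * vdiv n Φ x - b x * vdiv n Φ x := hi4.sub hi2
  rw [integral_add hi123 hs12, integral_add hi12 hi3,
    integral_sub hInt1 hi2, integral_sub hs2 hs1]
  have hL : ∫ x, cutoffMoll φ ζ w x * vdiv n Φ x = (∫ x, w x * vdiv n Φ x) +
      ((∫ x, moll φ b x * vdiv n Φ x) - ∫ x, b x * vdiv n Φ x) := by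
    rw [← integral_sub hi4 hi2, ← integral_add hInt1 hi42]
    refine integral_congr_ae (Eventually.of_forall fun x => ?_)
    simp only [cutoffMoll, b]
    ring
  rw [hL, integral_moll_mul_vdiv hb hΦ.contDiff hΦ.compact]
  ring

/-- Local mollification almost does not increase the variation. -/
lemma variation_cutoffMoll_le (hw : LocallyIntegrableOn w Ω) (hζ : ContDiff ℝ 1 ζ)
    (hζc : HasCompactSupport ζ) (hζΩ : tsupport ζ ⊆ Ω) (h0 : ∀ x, 0 ≤ ζ x) (h1 : ∀ x, ζ x ≤ 1)
    (hU : U ⊆ Ω) (hUV : U ⊆ V) (hV : cthickening φ.rOut U ∩ tsupport ζ ⊆ V) :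
    variation n (cutoffMoll φ ζ w) U ≤ variation n w V +
      ∑ i, eLpNorm (fun x => moll φ (fun y => w y * fderiv ℝ ζ y (EuclideanSpace.single i 1)) x -
        w x * fderiv ℝ ζ x (EuclideanSpace.single i 1)) 1 volume := by
  refine variation_le fun Φ hΦ => ?_
  rw [integral_cutoffMoll_mul_vdiv hw hζ hζc hζΩ (hΦ.mono hU)]
  refine ENNReal.ofReal_add_le.trans (add_le_add
    ((isTestField_cutoff hζ h0 h1 hΦ hUV hV).le_variation w) ?_)
  refine (Real.ofReal_le_enorm _).trans ((enorm_sum_le _ _).trans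
    (Finset.sum_le_sum fun i _ => ?_))
  rw [eLpNorm_one_eq_lintegral_enorm]
  refine (enorm_integral_le_lintegral_enorm _).trans (lintegral_mono fun x => ?_)
  rw [enorm_mul, ← enorm_neg, neg_sub]
  refine mul_le_of_le_one_right' ?_
  rw [← ofReal_norm]
  exact ENNReal.ofReal_le_one.2 ((coord_abs_le _ i).trans (hΦ.norm_le x))

end Commutator

section UpperBound

variable {n : ℕ} {K C Ω : Set (EuclideanSpace ℝ (Fin n))}
  {f a u v w : EuclideanSpace ℝ (Fin n) → ℝ} {δ : ℝ}

lemma osc_congr {Q : Set (EuclideanSpace ℝ (Fin n))} (hQ : MeasurableSet Q)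
    (h : ∀ x ∈ Q, u x = v x) : osc u Q = osc v Q := by
  have h1 : ⨍ y in Q, u y = ⨍ y in Q, v y := by
    rw [setAverage_eq, setAverage_eq, setIntegral_congr_fun hQ h]
  rw [osc, osc, h1, setAverage_eq (f := fun x => |u x - _|),
    setAverage_eq (f := fun x => |v x - _|)]
  congr 1
  refine setIntegral_congr_fun hQ fun x hx => ?_
  simp only [h x hx]

lemma variation_fun_add_le (ha : LocallyIntegrableOn a Ω) (hu : LocallyIntegrableOn u Ω)
    {U : Set (EuclideanSpace ℝ (Fin n))} (hU : U ⊆ Ω) :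
    variation n (fun x => a x + u x) U ≤ variation n a U + variation n u U := by
  refine variation_le fun Φ hΦ => ?_
  have h1 := integrable_mul_vdiv ha hΦ.contDiff hΦ.compact (hΦ.subset.trans hU)
  have h2 := integrable_mul_vdiv hu hΦ.contDiff hΦ.compact (hΦ.subset.trans hU)
  simp_rw [add_mul]
  rw [integral_add h1 h2]
  exact ENNReal.ofReal_add_le.trans (add_le_add (hΦ.le_variation a) (hΦ.le_variation u))

lemma ofReal_osc_cube_le (hn : 1 ≤ n) {ε : ℝ} (hε : 0 < ε)
    {T : EuclideanSpace ℝ (Fin n) ≃ₗᵢ[ℝ] EuclideanSpace ℝ (Fin n)}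
    {c : EuclideanSpace ℝ (Fin n)} (hf : LocallyIntegrableOn f Ω) (hQ : cube T c ε ⊆ Ω) :
    ENNReal.ofReal (ε ^ (n - 1)) * ENNReal.ofReal (osc f (cube T c ε)) ≤
      poincareConst n * variation n f (cube T c ε) :=
  (mul_le_mul_right (ofReal_osc_le_dosc (volume_cube_ne_zero hε) (volume_cube_lt_top hε.le)
    (hf.mono_set hQ).aestronglyMeasurable) _).trans (dosc_cube_le_variation hn hε hf hQ)

lemma exists_cube_of_isCube {ε : ℝ} {Q : Set (EuclideanSpace ℝ (Fin n))} (h : IsCube n ε Q) :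
    ∃ (T : EuclideanSpace ℝ (Fin n) ≃ₗᵢ[ℝ] EuclideanSpace ℝ (Fin n))
      (c : EuclideanSpace ℝ (Fin n)), Q = cube T c ε := h

lemma exists_kappa_add_le (hn : 1 ≤ n) (ha : LocallyIntegrableOn a Ω)
    (hu : LocallyIntegrableOn u Ω) (hv : ContDiff ℝ 1 v) (hvc : HasCompactSupport v)
    (hC : IsCompact C) (hδ : 0 < δ) (hKC : cthickening δ K ⊆ C)
    (huv : ∀ x ∈ C, u x = v x) {η : ℝ≥0∞} (hη : η ≠ 0) :
    ∃ ε₀ > 0, ∀ ε, 0 < ε → ε < ε₀ → kappa n ε (fun x => a x + u x) Ω ≤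
      poincareConst n * variation n a Ω + (poincareConst n * variation n u (Ω \ K) +
        ((∫⁻ x in C, ‖fderiv ℝ v x‖ₑ) / 4 + η)) := by
  obtain ⟨t, ht0, ht⟩ := ENNReal.exists_nnreal_pos_mul_lt
    (a := ENNReal.ofReal (n + 1) * volume C)
    (ENNReal.mul_ne_top ENNReal.ofReal_ne_top hC.measure_lt_top.ne) hη
  have htp : (0 : ℝ) < t := ht0
  have hun : UniformContinuous (fderiv ℝ v) :=
    (hvc.fderiv ℝ).uniformContinuous_of_continuous (hv.continuous_fderiv one_ne_zero)
  obtain ⟨s, hs, hsv⟩ := Metric.uniformContinuous_iff.1 hun t htp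
  have hn0 : (0 : ℝ) < n := by exact_mod_cast hn
  refine ⟨min s δ / n, div_pos (lt_min hs hδ) hn0, fun ε hε hε0 => kappa_le fun F hF hd => ?_⟩
  rw [lt_div_iff₀ hn0, mul_comm] at hε0
  have hεs : n * ε < s := hε0.trans_le (min_le_left _ _)
  have hεδ : n * ε ≤ δ := (hε0.trans_le (min_le_right _ _)).le
  set g : EuclideanSpace ℝ (Fin n) → ℝ≥0∞ :=
    fun x => ‖fderiv ℝ v x‖ₑ / 4 + ENNReal.ofReal ((n + 1) * t)
  set μ := (volume.restrict C).withDensity g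
  have hgm : Measurable g :=
    ((hv.continuous_fderiv one_ne_zero).enorm.measurable.div_const _).add_const _
  have hdp : Pairwise fun i j : F => Disjoint (i : Set (EuclideanSpace ℝ (Fin n))) j :=
    fun i j hij => hd i.2 j.2 fun h => hij (Subtype.ext h)
  have hQm : ∀ Q : F, MeasurableSet (Q : Set (EuclideanSpace ℝ (Fin n))) := by
    rintro ⟨Q, hQ⟩
    obtain ⟨T, c, rfl⟩ := exists_cube_of_isCube (hF Q hQ).1
    exact measurableSet_cube
  have hterm : ∀ Q : F, ENNReal.ofReal (ε ^ (n - 1)) *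
      ENNReal.ofReal (osc (fun x => a x + u x) (Q : Set (EuclideanSpace ℝ (Fin n)))) ≤
      poincareConst n * variation n a Q + (poincareConst n * variation n u (Q \ K) + μ Q) := by
    rintro ⟨Q, hQ⟩
    obtain ⟨⟨T, c, rfl⟩, hQΩ⟩ : (∃ T c, Q = cube T c ε) ∧ Q ⊆ Ω :=
      ⟨exists_cube_of_isCube (hF Q hQ).1, (hF Q hQ).2⟩
    simp only
    by_cases hQK : Disjoint (cube T c ε) K
    · rw [hQK.sdiff_eq_left, ← add_assoc, ← mul_add]
      refine le_trans ?_ le_self_add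
      exact (ofReal_osc_cube_le hn hε (ha.add hu) hQΩ).trans
        (mul_le_mul_right (variation_fun_add_le ha hu hQΩ) _)
    · obtain ⟨y, hy, hyK⟩ := Set.not_disjoint_iff.1 hQK
      have hQC : cube T c ε ⊆ C := fun x hx => hKC (mem_cthickening_of_dist_le x y _ _ hyK (by
        rw [dist_eq_norm]; exact (norm_sub_le_of_mem_cube hx hy).trans hεδ))
      have hui : IntegrableOn u (cube T c ε) :=
        (integrableOn_cube_of_continuous hv.continuous).congr_fun
          (fun x hx => (huv x (hQC hx)).symm) measurableSet_cube
      have h1 : ENNReal.ofReal (osc (fun x => a x + u x) (cube T c ε)) ≤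
          ENNReal.ofReal (osc a (cube T c ε)) + ENNReal.ofReal (osc u (cube T c ε)) := by
        rw [← ENNReal.ofReal_add osc_nonneg osc_nonneg]
        exact ENNReal.ofReal_le_ofReal (osc_add_le (volume_cube_lt_top hε.le)
          (ha.mono_set hQΩ).aestronglyMeasurable hui)
      refine (mul_le_mul_right h1 _).trans ?_
      rw [mul_add]
      refine add_le_add (ofReal_osc_cube_le hn hε ha hQΩ) ?_
      refine le_trans ?_ le_add_self
      rw [osc_congr measurableSet_cube fun x hx => huv x (hQC hx)]
      refine (ofReal_osc_le_lintegral hn hε htp.le hv fun x hx => ?_).trans ?_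
      · rw [← dist_eq_norm]
        refine (hsv ?_).le
        rw [dist_eq_norm]
        exact (norm_sub_le_of_mem_cube hx (center_mem_cube hε)).trans_lt hεs
      · rw [withDensity_apply _ measurableSet_cube, Measure.restrict_restrict measurableSet_cube,
          Set.inter_eq_left.2 hQC]
  refine (ENNReal.tsum_le_tsum hterm).trans ?_
  rw [ENNReal.tsum_add, ENNReal.tsum_add, ENNReal.tsum_mul_left, ENNReal.tsum_mul_left]
  refine add_le_add (mul_le_mul_right ?_ _) (add_le_add (mul_le_mul_right ?_ _) ?_)
  · exact tsum_variation_le ha _ (fun Q => (hF Q Q.2).2) hdp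
  · exact tsum_variation_le (hu.mono_set Set.sdiff_subset) _
      (fun Q => Set.sdiff_subset_sdiff_left (hF Q Q.2).2)
      fun i j hij => (hdp hij).mono Set.sdiff_subset Set.sdiff_subset
  · refine (tsum_meas_le_meas_iUnion_of_disjoint μ hQm hdp).trans
      ((measure_mono (Set.subset_univ _)).trans ?_)
    rw [withDensity_apply _ MeasurableSet.univ, Measure.restrict_univ,
      lintegral_add_right _ measurable_const, setLIntegral_const]
    refine add_le_add (le_of_eq ?_) ?_
    · simp_rw [div_eq_mul_inv]
      rw [lintegral_mul_const' _ _ (by simp)]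
    · refine le_trans (le_of_eq ?_) ht.le
      rw [ENNReal.ofReal_mul (by positivity), ENNReal.ofReal_coe_nnreal]
      ring

end UpperBound

section Recovery

variable {n : ℕ} {K Ω : Set (EuclideanSpace ℝ (Fin n))}
  {f w ζ : EuclideanSpace ℝ (Fin n) → ℝ} {B : ℝ}

lemma exists_testField_variation_sub_le (hw : LocallyIntegrableOn w Ω)
    (hfin : variation n w Ω ≠ ⊤) {η : ℝ≥0∞} (hη : η ≠ 0) :
    ∃ K, IsCompact K ∧ K ⊆ Ω ∧ variation n w (Ω \ K) ≤ η := by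
  obtain ⟨Φ, hΦ, hΦv⟩ : ∃ Φ, IsTestField Ω Φ ∧
      variation n w Ω ≤ ENNReal.ofReal (∫ x, w x * vdiv n Φ x) + η := by
    rcases eq_or_ne (variation n w Ω) 0 with h0 | h0
    · exact ⟨fun _ => 0, IsTestField.zero, by simp [h0]⟩
    · obtain ⟨Φ, h1, h2⟩ := exists_testField_lt (ENNReal.sub_lt_self hfin h0 hη)
      exact ⟨Φ, h1, tsub_le_iff_right.1 h2.le⟩
  refine ⟨tsupport Φ, hΦ.compact, hΦ.subset, variation_le fun Ψ hΨ => ?_⟩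
  have hΦK : IsTestField (tsupport Φ) Φ := ⟨hΦ.contDiff, hΦ.compact, le_rfl, hΦ.norm_le⟩
  have hΨΩ : IsTestField Ω Ψ := hΨ.mono Set.sdiff_subset
  have hadd : IsTestField Ω fun x => Φ x + Ψ x :=
    (hΦK.add hΨ Set.disjoint_sdiff_right).mono (Set.union_subset hΦ.subset Set.sdiff_subset)
  have h1 := hadd.le_variation w
  rw [integral_mul_vdiv_add hw hΦ.contDiff hΦ.compact hΦ.subset hΨΩ.contDiff hΨΩ.compact
    hΨΩ.subset] at h1
  have h2 := (ofReal_add_le_of_le h1 (hΦ.le_variation w) (hΨΩ.le_variation w)).trans hΦv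
  exact (ENNReal.add_le_add_iff_left ENNReal.ofReal_ne_top).1 h2

/-- A compactly supported bounded function is approximated by its mollifications. -/
lemma tendsto_eLpNorm_moll_mul_sub (hw : LocallyIntegrableOn w Ω) (hB : ∀ x, |w x| ≤ B)
    {d : EuclideanSpace ℝ (Fin n) → ℝ} (hd : Continuous d) (hdc : HasCompactSupport d)
    (hdΩ : tsupport d ⊆ Ω) {p : ℝ≥0∞} (hp0 : p ≠ 0) (hp : p ≠ ⊤) :
    Tendsto (fun k => eLpNorm (fun x => moll (bumpSeq n k) (fun y => w y * d y) x - w x * d x)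
      p volume) atTop (𝓝 0) := by
  obtain ⟨M, hM⟩ := hdc.exists_bound_of_continuous hd
  have hB0 : 0 ≤ B := (abs_nonneg _).trans (hB 0)
  refine tendsto_eLpNorm_moll_sub (B := B * M)
    (integrable_mul_of_locallyIntegrableOn hw hd hdc hdΩ).aestronglyMeasurable (fun x => ?_)
    hdc.mul_left hp0 hp
  rw [norm_mul]
  exact mul_le_mul (hB x) (hM x) (norm_nonneg _) hB0

lemma exists_recovery (hn : 1 ≤ n) (hΩ : IsOpen Ω) (hf : LocallyIntegrableOn f Ω)
    (hfin : variation n f Ω ≠ ⊤) {p : ℝ≥0∞} (hp0 : p ≠ 0) (hp : p ≠ ⊤) {η : ℝ≥0∞}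
    (hη : η ≠ 0) :
    ∃ h : EuclideanSpace ℝ (Fin n) → ℝ, LocallyIntegrableOn h Ω ∧
      eLpNorm (fun x => h x - f x) p volume ≤ η ∧
      ∃ ε₀ > 0, ∀ ε, 0 < ε → ε < ε₀ → kappa n ε h Ω ≤ variation n f Ω / 4 + η := by
  obtain ⟨t, ht0, ht⟩ := ENNReal.exists_nnreal_pos_mul_lt (a := poincareConst n * 3)
    (ENNReal.mul_ne_top poincareConst_ne_top (by simp)) (ENNReal.half_pos hη).ne'
  have ht0' : (t : ℝ≥0∞) ≠ 0 := by exact_mod_cast ht0.ne'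
  obtain ⟨m, hm⟩ := exists_trunc_variation_sub_le hΩ hf hfin ht0'
  have htr := isTrunc_trunc m
  have hsum := variation_trunc_add_le htr hΩ hf
  set w : EuclideanSpace ℝ (Fin n) → ℝ := fun x => trunc m (f x)
  set a : EuclideanSpace ℝ (Fin n) → ℝ := fun x => f x - trunc m (f x)
  have hw : LocallyIntegrableOn w Ω := htr.locallyIntegrableOn hf
  have ha : LocallyIntegrableOn a Ω := hf.sub hw
  have hwB : ∀ x, |w x| ≤ (m + 1) * (Real.pi / 2) := fun x => htr.abs_le _
  have hwf : variation n w Ω ≤ variation n f Ω := le_self_add.trans hsum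
  obtain ⟨K, hK, hKΩ, hKv⟩ := exists_testField_variation_sub_le hw
    (ne_top_of_le_ne_top hfin hwf) ht0'
  obtain ⟨r, hr, hrΩ⟩ := hK.exists_cthickening_subset_open hΩ hKΩ
  obtain ⟨ζ, hζ, hζc, hζΩ, hζ0, hζ1, hζe⟩ := exists_cutoff hK.cthickening hΩ hrΩ
  have hζ' : ContDiff ℝ 1 ζ := hζ.of_le (by norm_num)
  have hlim1 := tendsto_eLpNorm_moll_mul_sub hw hwB hζ.continuous hζc hζΩ hp0 hp
  have hlim2 : Tendsto (fun k => ∑ i : Fin n, eLpNorm (fun x =>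
      moll (bumpSeq n k) (fun y => w y * fderiv ℝ ζ y (EuclideanSpace.single i 1)) x -
        w x * fderiv ℝ ζ x (EuclideanSpace.single i 1)) 1 volume) atTop (𝓝 0) := by
    rw [← Finset.sum_const_zero (s := (Finset.univ : Finset (Fin n)))]
    refine tendsto_finsetSum _ fun i _ => ?_
    exact tendsto_eLpNorm_moll_mul_sub hw hwB
      ((hζ'.continuous_fderiv one_ne_zero).clm_apply continuous_const) (hζc.fderiv_apply ℝ _)
      ((tsupport_fderiv_apply_subset ℝ _).trans hζΩ) one_ne_zero ENNReal.one_ne_top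
  have hr3 : 0 < r / 3 := by positivity
  obtain ⟨k, hk1, hk2, hk3⟩ := ((hlim1.eventually (ge_mem_nhds (pos_iff_ne_zero.2 hη))).and
    ((hlim2.eventually (ge_mem_nhds (pos_iff_ne_zero.2 ht0'))).and
      (tendsto_bumpSeq_rOut.eventually (gt_mem_nhds hr3)))).exists
  set φ := bumpSeq n k
  set u := cutoffMoll φ ζ w
  set b : EuclideanSpace ℝ (Fin n) → ℝ := fun y => w y * ζ y
  have hb : Integrable b := integrable_mul_of_locallyIntegrableOn hw hζ.continuous hζc hζΩ
  have hv : ContDiff ℝ 1 (moll φ b) := contDiff_moll (m := 1) hb.locallyIntegrable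
  have hvc : HasCompactSupport (moll φ b) := hasCompactSupport_moll hζc.mul_left
  have hu : LocallyIntegrableOn u Ω :=
    hw.add (((integrable_moll hb).sub hb).locallyIntegrable.locallyIntegrableOn _)
  have hC : IsCompact (cthickening (2 * (r / 3)) K) := hK.cthickening
  have hsub : ∀ s ≤ r, cthickening s K ⊆ cthickening r K := fun s hs => cthickening_mono hs K
  have huv : ∀ x ∈ cthickening (2 * (r / 3)) K, u x = moll φ b x := by
    intro x hx
    have : ζ x = 1 := hζe x (hsub _ (by linarith) hx)
    simp [u, cutoffMoll, this, b]
  have hh : ∀ x, a x + u x - f x = moll φ b x - b x := fun x => by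
    simp only [a, u, cutoffMoll, w, b]; ring
  have hUu : variation n u (Ω \ cthickening (r / 3) K) ≤ t + t := by
    refine (variation_cutoffMoll_le (V := Ω \ K) hw hζ' hζc hζΩ hζ0 hζ1 Set.sdiff_subset
      (Set.sdiff_subset_sdiff_right (self_subset_cthickening K)) ?_).trans (add_le_add hKv hk2)
    rintro x ⟨hx1, hx2⟩
    refine ⟨hζΩ hx2, fun hxK => ?_⟩
    have h1 := cthickening_subset_thickening' hr3 hk3 _ hx1
    obtain ⟨y, hy, hxy⟩ := mem_thickening_iff.1 h1
    exact hy.2 (mem_cthickening_of_dist_le y x _ _ hxK (by rw [dist_comm]; exact hxy.le))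
  have hEn : ∫⁻ x in cthickening (2 * (r / 3)) K, ‖fderiv ℝ (moll φ b) x‖ₑ ≤
      variation n f Ω := by
    have hsubV : thickening r K ⊆ Ω := (thickening_subset_cthickening r K).trans hrΩ
    refine (lintegral_enorm_fderiv_moll_le hb hC (isOpen_thickening (δ := r) (E := K)) ?_).trans ?_
    · refine (cthickening_cthickening_of_le φ.rOut_pos.le (by positivity) le_rfl K).trans
        (cthickening_subset_thickening' hr ?_ K)
      linarith
    · rw [variation_congr (f := b) (g := w) (Eventually.of_forall fun x hx => ?_)]
      · exact (variation_mono hsubV).trans hwf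
      · simp [b, hζe x (thickening_subset_cthickening r K hx)]
  obtain ⟨ε₀, hε₀, hκ⟩ := exists_kappa_add_le hn ha hu hv hvc hC hr3
    (cthickening_cthickening_of_le hr3.le hr3.le (by linarith) K) huv (ENNReal.half_pos hη).ne'
  refine ⟨fun x => a x + u x, ha.add hu, ?_, ε₀, hε₀, fun ε h1 h2 => (hκ ε h1 h2).trans ?_⟩
  · simp_rw [hh]
    exact hk1
  · calc poincareConst n * variation n a Ω + (poincareConst n * variation n u
          (Ω \ cthickening (r / 3) K) +
          ((∫⁻ x in cthickening (2 * (r / 3)) K, ‖fderiv ℝ (moll φ b) x‖ₑ) / 4 + η / 2))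
        ≤ poincareConst n * t + (poincareConst n * (t + t) + (variation n f Ω / 4 + η / 2)) := by
          gcongr
      _ = t * (poincareConst n * 3) + (variation n f Ω / 4 + η / 2) := by ring
      _ ≤ η / 2 + (variation n f Ω / 4 + η / 2) := by gcongr
      _ = variation n f Ω / 4 + (η / 2 + η / 2) := by ring
      _ = _ := by rw [ENNReal.add_halves]

end Recovery

section Diagonal

lemma exists_tendsto_eventually_lt {e : ℕ → ℝ} (he : ∀ k, 0 < e k) :
    ∃ m : ℝ → ℕ, Tendsto m (𝓝[>] 0) atTop ∧ ∀ᶠ ε in 𝓝[>] (0 : ℝ), ε < e (m ε) := by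
  have key : ∀ N : ℕ, ∀ᶠ ε in 𝓝[>] (0 : ℝ), N ≤ ⌊ε⁻¹⌋₊ ∧ ε < e N := fun N => by
    have h1 : Tendsto (fun ε : ℝ => ⌊ε⁻¹⌋₊) (𝓝[>] 0) atTop :=
      tendsto_nat_floor_atTop.comp tendsto_inv_nhdsGT_zero
    exact (h1.eventually_ge_atTop N).and
      (eventually_nhdsWithin_of_eventually_nhds (gt_mem_nhds (he N)))
  refine ⟨fun ε => Nat.findGreatest (fun k => ε < e k) ⌊ε⁻¹⌋₊, ?_, ?_⟩
  · refine tendsto_atTop.2 fun N => (key N).mono fun ε h => ?_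
    exact Nat.le_findGreatest h.1 h.2
  · exact (key 0).mono fun ε h => Nat.findGreatest_spec (P := fun k => ε < e k) h.1 h.2

variable {n : ℕ} {Ω : Set (EuclideanSpace ℝ (Fin n))} {f : EuclideanSpace ℝ (Fin n) → ℝ}

lemma exists_recovery_family (hn : 1 ≤ n) (hΩ : IsOpen Ω) (hf : LocallyIntegrableOn f Ω)
    {p : ℝ≥0∞} (hp0 : p ≠ 0) (hp : p ≠ ⊤) :
    ∃ F : ℝ → EuclideanSpace ℝ (Fin n) → ℝ,
      (∀ ε, LocallyIntegrableOn (F ε) Ω) ∧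
      (∀ ε, eLpNorm (fun x => F ε x - f x) p volume < ⊤) ∧
      Tendsto (fun ε => eLpNorm (fun x => F ε x - f x) p volume) (𝓝[>] (0 : ℝ)) (𝓝 0) ∧
      limsup (fun ε => kappa n ε (F ε) Ω) (𝓝[>] (0 : ℝ)) ≤ variation n f Ω / 4 := by
  by_cases hfin : variation n f Ω = ⊤
  · refine ⟨fun _ => f, fun _ => hf, fun _ => by simp, by simp, ?_⟩
    rw [hfin, ENNReal.top_div_of_ne_top (by simp)]
    exact le_top
  have hη : ∀ k : ℕ, ((k : ℝ≥0∞) + 1)⁻¹ ≠ 0 := fun k =>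
    ENNReal.inv_ne_zero.2 (ENNReal.add_ne_top.2 ⟨ENNReal.natCast_ne_top k, ENNReal.one_ne_top⟩)
  choose h h1 h2 e h3 h4 using fun k : ℕ => exists_recovery hn hΩ hf hfin hp0 hp (hη k)
  obtain ⟨m, hm, hme⟩ := exists_tendsto_eventually_lt h3
  have h0 : Tendsto (fun k : ℕ => ((k : ℝ≥0∞) + 1)⁻¹) atTop (𝓝 0) := by
    have := (tendsto_add_atTop_iff_nat 1).2 ENNReal.tendsto_inv_nat_nhds_zero
    simpa using this
  refine ⟨fun ε => h (m ε), fun ε => h1 _, fun ε => (h2 _).trans_lt ?_, ?_, ?_⟩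
  · rw [ENNReal.inv_lt_top]; positivity
  · exact tendsto_of_tendsto_of_tendsto_of_le_of_le tendsto_const_nhds (h0.comp hm)
      (fun _ => zero_le) fun ε => h2 _
  · have hlim : Tendsto (fun ε => variation n f Ω / 4 + ((m ε : ℝ≥0∞) + 1)⁻¹) (𝓝[>] 0)
        (𝓝 (variation n f Ω / 4)) := by
      simpa using tendsto_const_nhds.add (h0.comp hm)
    rw [← hlim.limsup_eq]
    refine limsup_le_limsup ?_
    filter_upwards [hme, self_mem_nhdsWithin] with ε hε hε0
    exact h4 _ ε hε0 hε

end Diagonal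

section Lattice

variable {n : ℕ}

/-- The point with coordinates `ε k` in the orthonormal frame given by `T`. -/
def latticePoint (T : EuclideanSpace ℝ (Fin n) ≃ₗᵢ[ℝ] EuclideanSpace ℝ (Fin n)) (ε : ℝ)
    (k : Fin n → ℤ) : EuclideanSpace ℝ (Fin n) :=
  T (WithLp.toLp 2 fun i => ε * k i)

variable {T : EuclideanSpace ℝ (Fin n) ≃ₗᵢ[ℝ] EuclideanSpace ℝ (Fin n)} {ε : ℝ}

lemma mem_cube_latticePoint {k : Fin n → ℤ} {x : EuclideanSpace ℝ (Fin n)} :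
    x ∈ cube T (latticePoint T ε k) ε ↔ ∀ i, |T.symm x i - ε * k i| < ε / 2 := by
  simp [mem_cube, latticePoint]

lemma disjoint_cube_latticePoint {k l : Fin n → ℤ} (h : k ≠ l) :
    Disjoint (cube T (latticePoint T ε k) ε) (cube T (latticePoint T ε l) ε) := by
  rw [Set.disjoint_left]
  intro x hk hl
  obtain ⟨i, hi⟩ := Function.ne_iff.1 h
  rw [mem_cube_latticePoint] at hk hl
  have h1 := abs_lt.1 (hk i)
  have h2 := abs_lt.1 (hl i)
  have hε : 0 < ε := by linarith
  rcases lt_or_gt_of_ne hi with h | h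
  · have : (k i : ℝ) + 1 ≤ l i := by exact_mod_cast h
    nlinarith
  · have : (l i : ℝ) + 1 ≤ k i := by exact_mod_cast h
    nlinarith

lemma ae_coord_ne (T : EuclideanSpace ℝ (Fin n) ≃ₗᵢ[ℝ] EuclideanSpace ℝ (Fin n)) (i : Fin n)
    (a : ℝ) : ∀ᵐ x : EuclideanSpace ℝ (Fin n), T.symm x i ≠ a := by
  have h1 : ∀ᵐ y : Fin n → ℝ, y i ≠ a := by
    rw [ae_iff]
    simp only [ne_eq, not_not]
    exact Measure.pi_hyperplane (fun _ : Fin n => (volume : Measure ℝ)) i a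
  exact (((PiLp.volume_preserving_ofLp (Fin n)).comp
    T.symm.measurePreserving).quasiMeasurePreserving).ae h1

lemma ae_exists_mem_cube_latticePoint
    (T : EuclideanSpace ℝ (Fin n) ≃ₗᵢ[ℝ] EuclideanSpace ℝ (Fin n)) (hε : 0 < ε) :
    ∀ᵐ x, ∃ k, x ∈ cube T (latticePoint T ε k) ε := by
  have h : ∀ᵐ x : EuclideanSpace ℝ (Fin n), ∀ i, ∀ z : ℤ, T.symm x i ≠ ε * (z + 1 / 2) :=
    ae_all_iff.2 fun i => ae_all_iff.2 fun z => ae_coord_ne T i _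
  filter_upwards [h] with x hx
  refine ⟨fun i => round (T.symm x i / ε), mem_cube_latticePoint.2 fun i => ?_⟩
  set a := T.symm x i
  have h1 : |a / ε - round (a / ε)| < 1 / 2 := by
    refine lt_of_le_of_ne (abs_sub_round _) fun h2 => ?_
    have ha : a = ε * (a / ε) := by field_simp
    rcases eq_or_eq_neg_of_abs_eq h2 with h3 | h3
    · refine hx i (round (a / ε)) ?_
      rw [← h3, add_sub_cancel]; exact ha
    · refine hx i (round (a / ε) - 1) ?_
      push_cast
      rw [show ((round (a / ε) : ℤ) : ℝ) - 1 + 1 / 2 = a / ε by linarith]; exact ha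
  calc |a - ε * round (a / ε)| = ε * |a / ε - round (a / ε)| := by
        rw [← abs_of_pos hε, ← abs_mul, abs_of_pos hε]; congr 1; field_simp
    _ < ε * (1 / 2) := by gcongr
    _ = ε / 2 := by ring

lemma exists_isometry_map_single (i : Fin n) (v : EuclideanSpace ℝ (Fin n)) :
    ∃ T : EuclideanSpace ℝ (Fin n) ≃ₗᵢ[ℝ] EuclideanSpace ℝ (Fin n),
      ‖v‖ • T (EuclideanSpace.single i 1) = v := by
  by_cases hv : v = 0
  · exact ⟨.refl ℝ _, by simp [hv]⟩
  have hv' : ‖v‖ ≠ 0 := norm_ne_zero_iff.2 hv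
  refine ⟨(ℝ ∙ (EuclideanSpace.single i 1 - ‖v‖⁻¹ • v))ᗮ.reflection, ?_⟩
  rw [Submodule.reflection_sub]
  · rw [smul_smul, mul_inv_cancel₀ hv', one_smul]
  · simp [norm_smul, hv']

end Lattice

section SignSum

variable {n : ℕ} {ι : Type*}

/-- The sum over the cubes `cube (T j) (c j) ε`, `j ∈ s`, of `a j / ε` times the sign of the
`i`-th coordinate with respect to the centre of the cube. -/
def signSum (i : Fin n) (s : Finset ι)
    (T : ι → EuclideanSpace ℝ (Fin n) ≃ₗᵢ[ℝ] EuclideanSpace ℝ (Fin n))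
    (c : ι → EuclideanSpace ℝ (Fin n)) (a : ι → ℝ) (ε : ℝ) (x : EuclideanSpace ℝ (Fin n)) : ℝ :=
  ∑ j ∈ s, a j / ε * (cube (T j) (c j) ε).indicator
    (fun x => Real.sign ⟪T j (EuclideanSpace.single i 1), x - c j⟫) x

variable {i : Fin n} {s : Finset ι}
  {T : ι → EuclideanSpace ℝ (Fin n) ≃ₗᵢ[ℝ] EuclideanSpace ℝ (Fin n)}
  {c : ι → EuclideanSpace ℝ (Fin n)} {a : ι → ℝ} {ε : ℝ}
  {Ω : Set (EuclideanSpace ℝ (Fin n))} {g : EuclideanSpace ℝ (Fin n) → ℝ}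

lemma signSum_sub (t x : EuclideanSpace ℝ (Fin n)) :
    signSum i s T c a ε (x - t) = signSum i s T (fun j => c j + t) a ε x := by
  refine Finset.sum_congr rfl fun j _ => ?_
  congr 1
  have h : x - t ∈ cube (T j) (c j) ε ↔ x ∈ cube (T j) (c j + t) ε := by
    simpa using sub_mem_cube (T := T j) (c := c j + t) (x := x) (z := t) (ε := ε)
  simp only [Set.indicator_apply, h]
  rw [show x - t - c j = x - (c j + t) by abel]

lemma measurable_cubeSign {T : EuclideanSpace ℝ (Fin n) ≃ₗᵢ[ℝ] EuclideanSpace ℝ (Fin n)}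
    {c : EuclideanSpace ℝ (Fin n)} :
    Measurable fun x => Real.sign ⟪T (EuclideanSpace.single i 1), x - c⟫ :=
  measurable_real_sign.comp (by fun_prop : Continuous fun x =>
    ⟪T (EuclideanSpace.single i 1), x - c⟫).measurable

lemma measurable_signSum : Measurable (signSum i s T c a ε) :=
  Finset.measurable_fun_sum _ fun _ _ =>
    (measurable_cubeSign.indicator measurableSet_cube).const_mul _

lemma abs_signSum_le (x : EuclideanSpace ℝ (Fin n)) :
    |signSum i s T c a ε x| ≤ ∑ j ∈ s, |a j / ε| := by
  refine (Finset.abs_sum_le_sum_abs _ _).trans (Finset.sum_le_sum fun j _ => ?_)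
  rw [abs_mul]
  refine mul_le_of_le_one_right (abs_nonneg _) ?_
  rw [Set.indicator_apply]
  split_ifs
  · exact abs_real_sign_le _
  · simp

lemma integrableOn_mul_cubeSign {T : EuclideanSpace ℝ (Fin n) ≃ₗᵢ[ℝ] EuclideanSpace ℝ (Fin n)}
    {c : EuclideanSpace ℝ (Fin n)} {Q : Set (EuclideanSpace ℝ (Fin n))} (hg : IntegrableOn g Q) :
    IntegrableOn (fun x => g x * Real.sign ⟪T (EuclideanSpace.single i 1), x - c⟫) Q :=
  Integrable.mul_bdd (c := 1) hg measurable_cubeSign.aestronglyMeasurable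
    (Eventually.of_forall fun _ => abs_real_sign_le _)

lemma integral_mul_signSum (hg : ∀ j ∈ s, IntegrableOn g (cube (T j) (c j) ε)) :
    ∫ x, g x * signSum i s T c a ε x = ∑ j ∈ s, a j / ε *
      ∫ x in cube (T j) (c j) ε, g x * Real.sign ⟪T j (EuclideanSpace.single i 1), x - c j⟫ := by
  have h : ∀ x, g x * signSum i s T c a ε x = ∑ j ∈ s, a j / ε *
      (cube (T j) (c j) ε).indicator
        (fun x => g x * Real.sign ⟪T j (EuclideanSpace.single i 1), x - c j⟫) x := fun x => by
    rw [signSum, Finset.mul_sum]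
    refine Finset.sum_congr rfl fun j _ => ?_
    rw [Set.indicator_mul_right]; ring
  simp_rw [h]
  rw [integral_finsetSum]
  · refine Finset.sum_congr rfl fun j _ => ?_
    rw [integral_const_mul, integral_indicator measurableSet_cube]
  · intro j hj
    exact ((integrable_indicator_iff measurableSet_cube).2
      (integrableOn_mul_cubeSign (hg j hj))).const_mul _

lemma setIntegral_mul_cubeSign_le (hε : 0 < ε)
    {T : EuclideanSpace ℝ (Fin n) ≃ₗᵢ[ℝ] EuclideanSpace ℝ (Fin n)}
    {c : EuclideanSpace ℝ (Fin n)} (hg : IntegrableOn g (cube T c ε)) :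
    ∫ x in cube T c ε, g x * Real.sign ⟪T (EuclideanSpace.single i 1), x - c⟫ ≤
      ε ^ n * osc g (cube T c ε) := by
  set m := ⨍ y in cube T c ε, g y
  have hm : IntegrableOn (fun _ => m) (cube T c ε) :=
    integrableOn_const' (volume_cube_lt_top hε.le) m
  have h0 : ∫ x in cube T c ε, m * Real.sign ⟪T (EuclideanSpace.single i 1), x - c⟫ = 0 := by
    rw [integral_const_mul, setIntegral_cube_sign hε, mul_zero]
  have h1 : ε ^ n * osc g (cube T c ε) = ∫ x in cube T c ε, |g x - m| := by
    rw [osc, setAverage_eq, volume_real_cube hε.le, smul_eq_mul, ← mul_assoc,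
      mul_inv_cancel₀ (by positivity), one_mul]
  rw [h1, ← sub_zero (∫ x in cube T c ε, _), ← h0, ← integral_sub
    (integrableOn_mul_cubeSign hg) (integrableOn_mul_cubeSign hm)]
  refine integral_mono ((integrableOn_mul_cubeSign hg).sub (integrableOn_mul_cubeSign hm))
    (hg.sub hm).abs fun x => ?_
  simp only
  rw [← sub_mul]
  refine (le_abs_self _).trans ?_
  rw [abs_mul]
  exact mul_le_of_le_one_right (abs_nonneg _) (abs_real_sign_le _)

lemma sum_le_kappa {Q : ι → Set (EuclideanSpace ℝ (Fin n))}
    (hQ : ∀ j ∈ s, IsCube n ε (Q j) ∧ Q j ⊆ Ω) (hne : ∀ j ∈ s, (Q j).Nonempty)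
    (hd : (s : Set ι).PairwiseDisjoint Q) :
    ∑ j ∈ s, ENNReal.ofReal (ε ^ (n - 1)) * ENNReal.ofReal (osc g (Q j)) ≤ kappa n ε g Ω := by
  have hinj : Set.InjOn Q s := fun j hj k hk h => by
    by_contra hjk
    obtain ⟨x, hx⟩ := hne j hj
    exact Set.disjoint_left.1 (hd hj hk hjk) hx (h ▸ hx)
  rw [← Finset.tsum_subtype' s
    fun j => ENNReal.ofReal (ε ^ (n - 1)) * ENNReal.ofReal (osc g (Q j))]
  rw [← tsum_image (fun Q => ENNReal.ofReal (ε ^ (n - 1)) * ENNReal.ofReal (osc g Q)) hinj]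
  refine le_kappa ?_ ?_
  · rintro _ ⟨j, hj, rfl⟩
    exact hQ j hj
  · rintro _ ⟨j, hj, rfl⟩ _ ⟨k, hk, rfl⟩ h
    exact hd hj hk fun hjk => h (hjk ▸ rfl)

lemma ofReal_integral_mul_signSum_le (hn : 1 ≤ n) (hε : 0 < ε) (ha0 : ∀ j ∈ s, 0 ≤ a j)
    (ha1 : ∀ j ∈ s, a j ≤ 1) (hd : (s : Set ι).PairwiseDisjoint fun j => cube (T j) (c j) ε)
    (hΩ : ∀ j ∈ s, cube (T j) (c j) ε ⊆ Ω) (hg : ∀ j ∈ s, IntegrableOn g (cube (T j) (c j) ε)) :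
    ENNReal.ofReal (∫ x, g x * signSum i s T c a ε x) ≤ kappa n ε g Ω := by
  refine le_trans ?_ (sum_le_kappa (s := s) (fun j hj => ⟨isCube_cube, hΩ j hj⟩)
    (fun j _ => ⟨c j, center_mem_cube hε⟩) hd)
  rw [integral_mul_signSum hg]
  simp_rw [← ENNReal.ofReal_mul (pow_nonneg hε.le (n - 1))]
  rw [← ENNReal.ofReal_sum_of_nonneg fun j _ => mul_nonneg (by positivity) osc_nonneg]
  refine ENNReal.ofReal_le_ofReal (Finset.sum_le_sum fun j hj => ?_)
  have ho : 0 ≤ osc g (cube (T j) (c j) ε) := osc_nonneg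
  have hp : ε ^ n = ε ^ (n - 1) * ε := by rw [← pow_succ, Nat.sub_add_cancel hn]
  calc a j / ε * ∫ x in cube (T j) (c j) ε,
        g x * Real.sign ⟪T j (EuclideanSpace.single i 1), x - c j⟫
      ≤ a j / ε * (ε ^ n * osc g (cube (T j) (c j) ε)) :=
        mul_le_mul_of_nonneg_left (setIntegral_mul_cubeSign_le hε (hg j hj))
          (div_nonneg (ha0 j hj) hε.le)
    _ = a j * (ε ^ (n - 1) * osc g (cube (T j) (c j) ε)) := by rw [hp]; field_simp
    _ ≤ 1 * (ε ^ (n - 1) * osc g (cube (T j) (c j) ε)) :=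
        mul_le_mul_of_nonneg_right (ha1 j hj) (by positivity)
    _ = _ := one_mul _

end SignSum

section Consistency

variable {n : ℕ} {ι : Type*} {i : Fin n} {ε η ω L : ℝ}
  {u : EuclideanSpace ℝ (Fin n) → ℝ} {Φ : EuclideanSpace ℝ (Fin n) → EuclideanSpace ℝ (Fin n)}

lemma abs_setIntegral_mul_cubeSign_sub_le
    {T : EuclideanSpace ℝ (Fin n) ≃ₗᵢ[ℝ] EuclideanSpace ℝ (Fin n)}
    {c : EuclideanSpace ℝ (Fin n)} (hε : 0 < ε) (hω : 0 ≤ ω) (hu : ContDiff ℝ 1 u)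
    (h : ∀ x ∈ cube T c ε, ‖fderiv ℝ u x - fderiv ℝ u c‖ ≤ ω) :
    |(∫ x in cube T c ε, u x * Real.sign ⟪T (EuclideanSpace.single i 1), x - c⟫) -
      ε ^ n * (ε / 4) * fderiv ℝ u c (T (EuclideanSpace.single i 1))| ≤
      ω * (n * ε / 2) * ε ^ n := by
  have e1 : ε ^ n * (ε / 4) * fderiv ℝ u c (T (EuclideanSpace.single i 1)) =
      ∫ x in cube T c ε, (u c + ⟪gradient u c, x - c⟫) *
        Real.sign ⟪T (EuclideanSpace.single i 1), x - c⟫ := by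
    simp_rw [add_mul]
    rw [integral_add, integral_const_mul, setIntegral_cube_sign hε, mul_zero, zero_add,
      setIntegral_cube_inner_mul_sign hε, gradient_inner]
    · exact integrableOn_mul_cubeSign (integrableOn_const' (volume_cube_lt_top hε.le) _)
    · exact integrableOn_mul_cubeSign (integrableOn_cube_of_continuous (by fun_prop))
  rw [e1, ← integral_sub (integrableOn_mul_cubeSign (integrableOn_cube_of_continuous hu.continuous))
    (integrableOn_mul_cubeSign (integrableOn_cube_of_continuous (by fun_prop))),
    ← volume_real_cube (T := T) (c := c) hε.le, ← Real.norm_eq_abs]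
  refine norm_setIntegral_le_of_norm_le_const (volume_cube_lt_top hε.le) fun x hx => ?_
  rw [← sub_mul, norm_mul]
  have h1 := Convex.norm_image_sub_le_of_norm_fderiv_le' (𝕜 := ℝ)
    (fun y _ => hu.differentiable one_ne_zero y) h convex_cube (center_mem_cube hε) hx
  rw [← gradient_inner, sub_sub] at h1
  refine (mul_le_of_le_one_right (norm_nonneg _) (abs_real_sign_le _)).trans (h1.trans ?_)
  exact mul_le_mul_of_nonneg_left (norm_sub_center_le hx) hω

lemma abs_setIntegral_mul_cubeSign_add_le
    {T : EuclideanSpace ℝ (Fin n) ≃ₗᵢ[ℝ] EuclideanSpace ℝ (Fin n)}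
    {c : EuclideanSpace ℝ (Fin n)} {a : ℝ} (hε : 0 < ε) (hω : 0 ≤ ω)
    (hL : 0 ≤ L) (hu : ContDiff ℝ 1 u) (huL : ∀ x, ‖fderiv ℝ u x‖ ≤ L)
    (h : ∀ x ∈ cube T c ε, ‖fderiv ℝ u x - fderiv ℝ u c‖ ≤ ω) (ha0 : 0 ≤ a) (ha1 : a ≤ 1)
    (hΦ : Continuous Φ) (hη : ∀ x ∈ cube T c ε, ‖a • T (EuclideanSpace.single i 1) + Φ x‖ ≤ η) :
    |a / ε * (∫ x in cube T c ε, u x * Real.sign ⟪T (EuclideanSpace.single i 1), x - c⟫) +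
      (∫ x in cube T c ε, fderiv ℝ u x (Φ x)) / 4| ≤
      (ω * (n / 2) + (ω + L * η) / 4) * ε ^ n := by
  set e := T (EuclideanSpace.single i 1)
  have he : ‖e‖ = 1 := by simp [e]
  have hcont : Continuous fun x => fderiv ℝ u x (Φ x) :=
    (hu.continuous_fderiv one_ne_zero).clm_apply hΦ
  have h1 := abs_setIntegral_mul_cubeSign_sub_le (i := i) hε hω hu h
  have h2 : |ε ^ n * fderiv ℝ u c (a • e) + ∫ x in cube T c ε, fderiv ℝ u x (Φ x)| ≤
      (ω + L * η) * ε ^ n := by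
    have e2 : ε ^ n * fderiv ℝ u c (a • e) = ∫ x in cube T c ε, fderiv ℝ u c (a • e) := by
      rw [setIntegral_const, volume_real_cube hε.le, smul_eq_mul]
    rw [e2, ← integral_add (integrableOn_const' (volume_cube_lt_top hε.le) _)
      (integrableOn_cube_of_continuous hcont), ← volume_real_cube (T := T) (c := c) hε.le,
      ← Real.norm_eq_abs]
    refine norm_setIntegral_le_of_norm_le_const (volume_cube_lt_top hε.le) fun x hx => ?_
    have e3 : fderiv ℝ u c (a • e) + fderiv ℝ u x (Φ x) =
        fderiv ℝ u x (a • e + Φ x) - (fderiv ℝ u x - fderiv ℝ u c) (a • e) := by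
      simp only [map_add, _root_.sub_apply]; ring
    have hae : ‖a • e‖ ≤ 1 := by
      rw [norm_smul, he, mul_one, Real.norm_of_nonneg ha0]; exact ha1
    rw [e3, add_comm ω]
    refine (norm_sub_le _ _).trans (add_le_add ?_ ?_)
    · exact ((fderiv ℝ u x).le_opNorm _).trans
        (mul_le_mul (huL x) (hη x hx) (norm_nonneg _) hL)
    · exact (ContinuousLinearMap.le_opNorm _ _).trans
        ((mul_le_mul (h x hx) hae (norm_nonneg _) hω).trans_eq (mul_one _))
  set I := ∫ x in cube T c ε, u x * Real.sign ⟪e, x - c⟫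
  set J := ∫ x in cube T c ε, fderiv ℝ u x (Φ x)
  have e4 : a / ε * I + J / 4 = a / ε * (I - ε ^ n * (ε / 4) * fderiv ℝ u c e) +
      (ε ^ n * fderiv ℝ u c (a • e) + J) / 4 := by
    rw [map_smul, smul_eq_mul]; field_simp; ring
  rw [e4]
  refine (abs_add_le _ _).trans ?_
  rw [abs_mul, abs_div _ 4, abs_of_pos (show (0 : ℝ) < 4 by norm_num),
    abs_of_nonneg (div_nonneg ha0 hε.le), add_mul]
  refine add_le_add ?_ (by linarith)
  calc a / ε * |I - ε ^ n * (ε / 4) * fderiv ℝ u c e|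
      ≤ 1 / ε * (ω * (n * ε / 2) * ε ^ n) := by gcongr
    _ = ω * (n / 2) * ε ^ n := by field_simp

/-- The data of pairwise disjoint `ε`-cubes in `W`, together with weights, such that the weighted
direction of the `i`-th axis of each cube is uniformly close to `-Φ` on the cube. -/
structure IsAdapted (i : Fin n) (s : Finset ι)
    (T : ι → EuclideanSpace ℝ (Fin n) ≃ₗᵢ[ℝ] EuclideanSpace ℝ (Fin n))
    (c : ι → EuclideanSpace ℝ (Fin n)) (a : ι → ℝ) (ε : ℝ)
    (Φ : EuclideanSpace ℝ (Fin n) → EuclideanSpace ℝ (Fin n))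
    (W : Set (EuclideanSpace ℝ (Fin n))) (η : ℝ) : Prop where
  nonneg : ∀ j ∈ s, 0 ≤ a j
  le_one : ∀ j ∈ s, a j ≤ 1
  pairwiseDisjoint : (s : Set ι).PairwiseDisjoint fun j => cube (T j) (c j) ε
  subset : ∀ j ∈ s, cube (T j) (c j) ε ⊆ W
  norm_add_le : ∀ j ∈ s, ∀ x ∈ cube (T j) (c j) ε,
    ‖a j • T j (EuclideanSpace.single i 1) + Φ x‖ ≤ η

variable {s : Finset ι} {T : ι → EuclideanSpace ℝ (Fin n) ≃ₗᵢ[ℝ] EuclideanSpace ℝ (Fin n)}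
  {c : ι → EuclideanSpace ℝ (Fin n)} {a : ι → ℝ} {W : Set (EuclideanSpace ℝ (Fin n))}

lemma IsAdapted.abs_integral_mul_signSum_sub_le (hA : IsAdapted i s T c a ε Φ W η)
    (hε : 0 < ε) (hω : 0 ≤ ω) (hL : 0 ≤ L) (hη : 0 ≤ η) (hu : ContDiff ℝ 1 u)
    (huL : ∀ x, ‖fderiv ℝ u x‖ ≤ L)
    (h : ∀ x y, ‖x - y‖ ≤ n * ε → ‖fderiv ℝ u x - fderiv ℝ u y‖ ≤ ω)
    (hΦ : IsTestField W Φ) (hW : MeasurableSet W) (hWf : volume W ≠ ⊤) {τ : ℝ}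
    (hτ : volume.real (W \ ⋃ j ∈ s, cube (T j) (c j) ε) ≤ τ) :
    |(∫ x, u x * signSum i s T c a ε x) - (∫ x, u x * vdiv n Φ x) / 4| ≤
      (ω * (n / 2) + (ω + L * η) / 4) * volume.real W + L * τ / 4 := by
  set P := ⋃ j ∈ s, cube (T j) (c j) ε
  have hP : MeasurableSet P := s.measurableSet_biUnion fun _ _ => measurableSet_cube
  have hPW : P ⊆ W := Set.iUnion₂_subset hA.subset
  have hcont : Continuous fun x => fderiv ℝ u x (Φ x) :=
    (hu.continuous_fderiv one_ne_zero).clm_apply hΦ.contDiff.continuous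
  have hInt : Integrable fun x => fderiv ℝ u x (Φ x) :=
    integrable_fderiv_apply_field hu hΦ.contDiff.continuous hΦ.compact
  have e1 : ∫ x, u x * vdiv n Φ x = -((∑ j ∈ s, ∫ x in cube (T j) (c j) ε, fderiv ℝ u x (Φ x)) +
      ∫ x in W \ P, fderiv ℝ u x (Φ x)) := by
    rw [integral_mul_vdiv_eq_neg hu hΦ.contDiff hΦ.compact,
      ← integral_biUnion_finset s (fun _ _ => measurableSet_cube) hA.pairwiseDisjoint
        (fun _ _ => hInt.integrableOn)]
    rw [← setIntegral_union Set.disjoint_sdiff_right (hW.diff hP) hInt.integrableOn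
      hInt.integrableOn, Set.union_sdiff_cancel hPW, setIntegral_eq_integral_of_forall_compl_eq_zero]
    intro x hx
    have : Φ x = 0 := image_eq_zero_of_notMem_tsupport fun h => hx (hΦ.subset h)
    rw [this, map_zero]
  have e2 : |∫ x in W \ P, fderiv ℝ u x (Φ x)| ≤ L * τ := by
    rw [← Real.norm_eq_abs]
    refine (norm_setIntegral_le_of_norm_le_const (C := L)
      ((measure_mono Set.sdiff_subset).trans_lt hWf.lt_top) fun x _ => ?_).trans
      (mul_le_mul_of_nonneg_left hτ hL)
    refine ((fderiv ℝ u x).le_opNorm _).trans ?_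
    exact (mul_le_mul (huL x) (hΦ.norm_le x) (norm_nonneg _) hL).trans_eq (mul_one _)
  have e3 : |∑ j ∈ s, (a j / ε * (∫ x in cube (T j) (c j) ε,
        u x * Real.sign ⟪T j (EuclideanSpace.single i 1), x - c j⟫) +
      (∫ x in cube (T j) (c j) ε, fderiv ℝ u x (Φ x)) / 4)| ≤
      (ω * (n / 2) + (ω + L * η) / 4) * volume.real W := by
    calc _ ≤ ∑ j ∈ s, (ω * (n / 2) + (ω + L * η) / 4) * volume.real (cube (T j) (c j) ε) := by
          refine (Finset.abs_sum_le_sum_abs _ _).trans (Finset.sum_le_sum fun j hj => ?_)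
          rw [volume_real_cube hε.le]
          refine abs_setIntegral_mul_cubeSign_add_le hε hω hL hu huL (fun x hx => h _ _ ?_)
            (hA.nonneg j hj) (hA.le_one j hj) hΦ.contDiff.continuous (hA.norm_add_le j hj)
          exact norm_sub_le_of_mem_cube hx (center_mem_cube hε)
      _ = (ω * (n / 2) + (ω + L * η) / 4) * volume.real P := by
          rw [← Finset.mul_sum, measureReal_biUnion_finset hA.pairwiseDisjoint
            (fun _ _ => measurableSet_cube) fun _ _ => (volume_cube_lt_top hε.le).ne]
      _ ≤ _ := mul_le_mul_of_nonneg_left (measureReal_mono hPW hWf) (by positivity)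
  rw [integral_mul_signSum fun j _ => integrableOn_cube_of_continuous hu.continuous, e1]
  rw [Finset.sum_add_distrib, ← Finset.sum_div] at e3
  rw [abs_le] at e2 e3 ⊢
  constructor <;> linarith

end Consistency

section AdaptedFamily

variable {n : ℕ} {W : Set (EuclideanSpace ℝ (Fin n))}
  {Φ : EuclideanSpace ℝ (Fin n) → EuclideanSpace ℝ (Fin n)}

lemma tendsto_volume_inter_cthickening {κ : Type*} {R : κ → Set (EuclideanSpace ℝ (Fin n))}
    (hR : ∀ m, IsOpen (R m)) (hW : IsOpen W) (hWf : volume W ≠ ⊤)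
    (h : ∀ᵐ x, ∃ m, x ∈ R m) :
    Tendsto (fun δ => volume (W ∩ ⋂ m, cthickening δ (R m ∩ W)ᶜ)) (𝓝[>] 0) (𝓝 0) := by
  have h0 : volume (⋂ δ > (0 : ℝ), W ∩ ⋂ m, cthickening δ (R m ∩ W)ᶜ) = 0 := by
    refine measure_mono_null (fun x hx => ?_) (ae_iff.1 h)
    rintro ⟨m, hm⟩
    simp only [Set.mem_iInter] at hx
    have hxW := (hx 1 one_pos).1
    have hcl : x ∈ closure (R m ∩ W)ᶜ := by
      rw [closure_eq_iInter_cthickening]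
      simp only [Set.mem_iInter]
      exact fun δ hδ => Set.mem_iInter.1 (hx δ hδ).2 m
    rw [((hR m).inter hW).isClosed_compl.closure_eq] at hcl
    exact hcl ⟨hm, hxW⟩
  rw [← h0]
  refine tendsto_measure_biInter_gt (fun δ _ => ?_) (fun δ δ' _ hle => ?_)
    ⟨1, one_pos, ((measure_mono Set.inter_subset_left).trans_lt hWf.lt_top).ne⟩
  · exact (hW.measurableSet.inter
      (isClosed_iInter fun _ => isClosed_cthickening).measurableSet).nullMeasurableSet
  · exact Set.inter_subset_inter_right _ (Set.iInter_mono fun m => cthickening_mono hle _)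

lemma exists_isAdapted (hn : 1 ≤ n) (i : Fin n) (hΦ : UniformContinuous Φ) (hΦ1 : ∀ x, ‖Φ x‖ ≤ 1)
    (hW : IsOpen W) (hWf : volume W ≠ ⊤) {η τ : ℝ} (hη : 0 < η) (hτ : 0 < τ) :
    ∀ᶠ ε in 𝓝[>] (0 : ℝ), ∃ (s : Finset ((Fin n → ℤ) × (Fin n → ℤ)))
      (T : (Fin n → ℤ) × (Fin n → ℤ) →
        EuclideanSpace ℝ (Fin n) ≃ₗᵢ[ℝ] EuclideanSpace ℝ (Fin n))
      (c : (Fin n → ℤ) × (Fin n → ℤ) → EuclideanSpace ℝ (Fin n))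
      (a : (Fin n → ℤ) × (Fin n → ℤ) → ℝ), IsAdapted i s T c a ε Φ W η ∧
        volume.real (W \ ⋃ j ∈ s, cube (T j) (c j) ε) ≤ τ := by
  obtain ⟨δ, hδ, hδΦ⟩ := Metric.uniformContinuous_iff.1 hΦ η hη
  have hn0 : (0 : ℝ) < n := by exact_mod_cast hn
  set r := δ / n
  have hr : 0 < r := by positivity
  set p : (Fin n → ℤ) → EuclideanSpace ℝ (Fin n) := latticePoint (.refl ℝ _) r
  set R : (Fin n → ℤ) → Set (EuclideanSpace ℝ (Fin n)) := fun m => cube (.refl ℝ _) (p m) r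
  choose T hT using fun m => exists_isometry_map_single i (-Φ (p m))
  have hR : ∀ᵐ x, ∃ m, x ∈ R m := ae_exists_mem_cube_latticePoint (.refl ℝ _) hr
  have hlim : Tendsto (fun ε : ℝ => volume (W ∩ ⋂ m, cthickening (n * ε) (R m ∩ W)ᶜ)) (𝓝[>] 0)
      (𝓝 0) := by
    refine (tendsto_volume_inter_cthickening (fun m => isOpen_cube) hW hWf hR).comp
      (f := fun ε : ℝ => n * ε) (tendsto_nhdsWithin_iff.2 ⟨?_, ?_⟩)
    · exact tendsto_nhdsWithin_of_tendsto_nhds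
        ((continuous_const.mul continuous_id).tendsto' 0 0 (by simp))
    · filter_upwards [self_mem_nhdsWithin] with ε hε
      exact mul_pos hn0 hε
  filter_upwards [hlim.eventually (ge_mem_nhds (ENNReal.ofReal_pos.2 hτ)), self_mem_nhdsWithin]
    with ε hετ hε
  replace hε : 0 < ε := hε
  set Q : (Fin n → ℤ) × (Fin n → ℤ) → Set (EuclideanSpace ℝ (Fin n)) :=
    fun j => cube (T j.1) (latticePoint (T j.1) ε j.2) ε
  set A : Set ((Fin n → ℤ) × (Fin n → ℤ)) := {j | Q j ⊆ R j.1 ∩ W}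
  have hdisj : A.PairwiseDisjoint Q := by
    rintro ⟨m, k⟩ hj ⟨m', k'⟩ hj' hne
    by_cases hm : m = m'
    · subst hm
      exact disjoint_cube_latticePoint fun hk => hne (Prod.ext rfl hk)
    · exact (disjoint_cube_latticePoint hm).mono (hj.trans Set.inter_subset_left)
        (hj'.trans Set.inter_subset_left)
  have hfin : A.Finite := by
    have h1 := Measure.finite_const_le_meas_of_disjoint_iUnion volume (ε := ENNReal.ofReal (ε ^ n))
      (ENNReal.ofReal_pos.2 (by positivity)) (As := fun j : A => Q j)
      (fun _ => measurableSet_cube) (fun j k h => hdisj j.2 k.2 fun h' => h (Subtype.ext h'))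
      ((measure_mono (Set.iUnion_subset fun j => j.2.trans Set.inter_subset_right)).trans_lt
        hWf.lt_top).ne
    have h2 : {j : A | ENNReal.ofReal (ε ^ n) ≤ volume (Q j)} = Set.univ :=
      Set.eq_univ_of_forall fun j => (volume_cube hε.le).ge
    rw [h2] at h1
    exact Set.finite_coe_iff.1 (Set.finite_univ_iff.1 h1)
  refine ⟨hfin.toFinset, fun j => T j.1, fun j => latticePoint (T j.1) ε j.2,
    fun j => ‖Φ (p j.1)‖, ⟨fun _ _ => norm_nonneg _, fun _ _ => hΦ1 _, ?_, ?_, ?_⟩, ?_⟩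
  · rw [Set.Finite.coe_toFinset]; exact hdisj
  · exact fun j hj => (hfin.mem_toFinset.1 hj).trans Set.inter_subset_right
  · intro j hj x hx
    have h1 : x ∈ R j.1 := (hfin.mem_toFinset.1 hj hx).1
    have h2 := hT j.1
    rw [norm_neg] at h2
    rw [h2, neg_add_eq_sub, ← dist_eq_norm]
    refine (hδΦ ?_).le
    rw [dist_eq_norm]
    have h3 := norm_sub_center_le h1
    have h4 : n * r = δ := by simp only [r]; field_simp
    linarith
  · refine ENNReal.toReal_le_of_le_ofReal hτ.le (le_trans (measure_mono_ae ?_) hετ)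
    have hcov : ∀ᵐ x, ∀ m, ∃ k, x ∈ Q (m, k) :=
      ae_all_iff.2 fun m => ae_exists_mem_cube_latticePoint (T m) hε
    filter_upwards [hcov] with x hx hxW
    refine ⟨hxW.1, ?_⟩
    by_contra hcon
    simp only [Set.mem_iInter, not_forall] at hcon
    obtain ⟨m, hm⟩ := hcon
    obtain ⟨k, hk⟩ := hx m
    refine hxW.2 (Set.mem_biUnion (x := (m, k)) (hfin.mem_toFinset.2 fun y hy => ?_) hk)
    by_contra hy'
    refine hm (mem_cthickening_of_dist_le x y _ _ hy' ?_)
    rw [dist_eq_norm]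
    exact norm_sub_le_of_mem_cube hk hy

end AdaptedFamily

section UniformApproximation

variable {n : ℕ} {φ : ContDiffBump (0 : EuclideanSpace ℝ (Fin n))}
  {W Ω : Set (EuclideanSpace ℝ (Fin n))} {g : EuclideanSpace ℝ (Fin n) → ℝ}
  {Φ : EuclideanSpace ℝ (Fin n) → EuclideanSpace ℝ (Fin n)}

lemma moll_eq_integral_sub (y : EuclideanSpace ℝ (Fin n)) :
    moll φ g y = ∫ x, φ.normed volume (y - x) * g x := by
  rw [moll_apply, ← integral_sub_left_eq_self (fun x => φ.normed volume (y - x) * g x) volume y]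
  simp

lemma fderiv_fun_const_sub (hg : ContDiff ℝ 1 g) (y x : EuclideanSpace ℝ (Fin n)) :
    fderiv ℝ (fun x => g (y - x)) x = -fderiv ℝ g (y - x) := by
  have h := ((hg.differentiable one_ne_zero (y - x)).hasFDerivAt.comp x
    ((hasFDerivAt_id x).const_sub y)).fderiv
  refine Eq.trans h ?_
  ext v; simp

lemma eventually_exists_isAdapted_moll (hn : 1 ≤ n) (i : Fin n)
    (φ : ContDiffBump (0 : EuclideanSpace ℝ (Fin n))) (hΦ : IsTestField W Φ) (hW : IsOpen W)
    (hWf : volume W ≠ ⊤) {θ : ℝ} (hθ : 0 < θ) :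
    ∀ᶠ ε in 𝓝[>] (0 : ℝ), ∃ (s : Finset ((Fin n → ℤ) × (Fin n → ℤ)))
      (T : (Fin n → ℤ) × (Fin n → ℤ) →
        EuclideanSpace ℝ (Fin n) ≃ₗᵢ[ℝ] EuclideanSpace ℝ (Fin n))
      (c : (Fin n → ℤ) × (Fin n → ℤ) → EuclideanSpace ℝ (Fin n))
      (a : (Fin n → ℤ) × (Fin n → ℤ) → ℝ) (η : ℝ), IsAdapted i s T c a ε Φ W η ∧
        ∀ y, |moll φ (signSum i s T c a ε) y - moll φ (vdiv n Φ) y / 4| ≤ θ := by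
  have hρ : ContDiff ℝ 1 (φ.normed volume) := φ.contDiff_normed
  have hρc : HasCompactSupport (fderiv ℝ (φ.normed volume)) :=
    (φ.hasCompactSupport_normed (μ := volume)).fderiv ℝ
  have hρd : Continuous (fderiv ℝ (φ.normed volume)) := hρ.continuous_fderiv one_ne_zero
  obtain ⟨L, hL⟩ := hρc.exists_bound_of_continuous hρd
  have hL0 : 0 ≤ L := (norm_nonneg _).trans (hL 0)
  set V := volume.real W
  have hV : 0 ≤ V := measureReal_nonneg
  set ω := θ / (3 * (n / 2 + 1 / 4) * (V + 1))
  set η := θ / (3 * (L + 1) * (V + 1))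
  set τ := θ / (L + 1)
  have hω : 0 < ω := by positivity
  have hη : 0 < η := by positivity
  have hτ : 0 < τ := by positivity
  have hbound : (ω * (n / 2) + (ω + L * η) / 4) * V + L * τ / 4 ≤ θ := by
    have h1 : ω * (n / 2 + 1 / 4) * V ≤ θ / 3 := by
      have : ω * (n / 2 + 1 / 4) * (V + 1) = θ / 3 := by simp only [ω]; field_simp
      rw [← this]
      gcongr
      linarith
    have h2 : L * η * V ≤ θ / 3 := by
      have : (L + 1) * η * (V + 1) = θ / 3 := by simp only [η]; field_simp
      rw [← this]
      gcongr <;> linarith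
    have h3 : L * τ ≤ θ := by
      have : (L + 1) * τ = θ := by simp only [τ]; field_simp
      nlinarith
    linarith
  obtain ⟨δ, hδ, hδu⟩ := Metric.uniformContinuous_iff.1
    (hρc.uniformContinuous_of_continuous hρd) ω hω
  have hsmall : ∀ᶠ ε in 𝓝[>] (0 : ℝ), n * ε < δ :=
    eventually_nhdsWithin_of_eventually_nhds
      (((continuous_const.mul continuous_id).tendsto' 0 0 (by simp)).eventually (gt_mem_nhds hδ))
  filter_upwards [exists_isAdapted hn i
    (hΦ.compact.uniformContinuous_of_continuous hΦ.contDiff.continuous) hΦ.norm_le hW hWf hη hτ,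
    hsmall, self_mem_nhdsWithin] with ε ⟨s, T, c, a, hA, hcov⟩ hεδ hε
  refine ⟨s, T, c, a, η, hA, fun y => ?_⟩
  rw [moll_eq_integral_sub, moll_eq_integral_sub]
  have hu : ContDiff ℝ 1 fun x => φ.normed volume (y - x) :=
    hρ.comp (contDiff_const.sub contDiff_id)
  refine (hA.abs_integral_mul_signSum_sub_le hε hω.le hL0 hη.le hu (fun x => ?_)
    (fun x x' hx => ?_) hΦ hW.measurableSet hWf hcov).trans hbound
  · rw [fderiv_fun_const_sub hρ, norm_neg]; exact hL _
  · rw [fderiv_fun_const_sub hρ, fderiv_fun_const_sub hρ, ← dist_eq_norm, dist_neg_neg]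
    refine (hδu ?_).le
    rw [dist_sub_left, dist_eq_norm]
    exact hx.trans_lt hεδ

lemma integral_mul_moll_le {S : EuclideanSpace ℝ (Fin n) → ℝ} (hg : Integrable g)
    (hS : Measurable S) {C B : ℝ} (hC : ∀ x, |S x| ≤ C)
    (h : ∀ t, ‖t‖ < φ.rOut → ∫ y, g y * S (y - t) ≤ B) : ∫ y, g y * moll φ S y ≤ B := by
  have hρ : Integrable (φ.normed volume) volume := φ.integrable_normed
  have hi : Integrable (fun p : EuclideanSpace ℝ (Fin n) × EuclideanSpace ℝ (Fin n) =>
      (g p.1 * φ.normed volume p.2) * S (p.1 - p.2)) (volume.prod volume) :=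
    (hg.mul_prod hρ).mul_bdd (c := C)
      (hS.comp (measurable_fst.sub measurable_snd)).aestronglyMeasurable
      (Eventually.of_forall fun p => hC _)
  calc ∫ y, g y * moll φ S y = ∫ y, ∫ t, (g y * φ.normed volume t) * S (y - t) := by
        refine integral_congr_ae (Eventually.of_forall fun y => ?_)
        simp only [moll_apply, smul_eq_mul, mul_assoc, integral_const_mul]
    _ = ∫ t, ∫ y, (g y * φ.normed volume t) * S (y - t) := integral_integral_swap hi
    _ = ∫ t, φ.normed volume t * ∫ y, g y * S (y - t) := by
        refine integral_congr_ae (Eventually.of_forall fun t => ?_)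
        simp only
        rw [← integral_const_mul]
        refine integral_congr_ae (Eventually.of_forall fun y => ?_)
        simp only
        ring
    _ ≤ ∫ t, φ.normed volume t * B := by
        refine integral_mono (hi.integral_prod_right.congr (Eventually.of_forall fun t => ?_))
          (hρ.mul_const B) fun t => ?_
        · simp only
          rw [← integral_const_mul]
          refine integral_congr_ae (Eventually.of_forall fun y => ?_)
          simp only
          ring
        · by_cases ht : ‖t‖ < φ.rOut
          · exact mul_le_mul_of_nonneg_left (h t ht) (φ.nonneg_normed t)
          · simp [normed_eq_zero (not_lt.1 ht)]
    _ = B := by rw [integral_mul_const, φ.integral_normed, one_mul]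

variable {ι : Type*} {i : Fin n} {s : Finset ι}
  {T : ι → EuclideanSpace ℝ (Fin n) ≃ₗᵢ[ℝ] EuclideanSpace ℝ (Fin n)}
  {c : ι → EuclideanSpace ℝ (Fin n)} {a : ι → ℝ} {ε η : ℝ}

lemma IsAdapted.ofReal_integral_mul_moll_le (hA : IsAdapted i s T c a ε Φ W η) (hn : 1 ≤ n)
    (hε : 0 < ε) {K : Set (EuclideanSpace ℝ (Fin n))} (hK : MeasurableSet K) (hKΩ : K ⊆ Ω)
    (hWK : ∀ x t, x - t ∈ W → ‖t‖ < φ.rOut → x ∈ K) (hg : IntegrableOn g K) :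
    ENNReal.ofReal (∫ y, K.indicator g y * moll φ (signSum i s T c a ε) y) ≤ kappa n ε g Ω := by
  by_cases hκ : kappa n ε g Ω = ⊤
  · rw [hκ]; exact le_top
  rw [ENNReal.ofReal_le_iff_le_toReal hκ]
  refine integral_mul_moll_le ((integrable_indicator_iff hK).2 hg) measurable_signSum
    abs_signSum_le fun t ht => ?_
  rw [← ENNReal.ofReal_le_iff_le_toReal hκ]
  have hsub : ∀ j ∈ s, cube (T j) (c j + t) ε ⊆ K := fun j hj x hx => by
    refine hWK x t (hA.subset j hj ?_) ht
    have h := (sub_mem_cube (z := t)).2 hx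
    rwa [add_sub_cancel_right] at h
  have heq : ∀ y, K.indicator g y * signSum i s T c a ε (y - t) =
      g y * signSum i s T (fun j => c j + t) a ε y := fun y => by
    rw [signSum_sub]
    by_cases hy : y ∈ K
    · rw [Set.indicator_of_mem hy]
    · rw [signSum, Finset.sum_eq_zero fun j hj => ?_, mul_zero, mul_zero]
      rw [Set.indicator_of_notMem fun h => hy (hsub j hj h), mul_zero]
  simp_rw [heq]
  refine ofReal_integral_mul_signSum_le hn hε hA.nonneg hA.le_one (fun j hj k hk hjk => ?_)
    (fun j hj => (hsub j hj).trans hKΩ) fun j hj => hg.mono_set (hsub j hj)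
  refine Set.disjoint_left.2 fun x hx hx' => ?_
  have h1 : x - t ∈ cube (T j) (c j) ε := by simpa using (sub_mem_cube (z := t)).2 hx
  have h2 : x - t ∈ cube (T k) (c k) ε := by simpa using (sub_mem_cube (z := t)).2 hx'
  exact Set.disjoint_left.1 (hA.pairwiseDisjoint hj hk hjk) h1 h2

end UniformApproximation

section LowerBound

variable {n : ℕ} {Ω : Set (EuclideanSpace ℝ (Fin n))} {f : EuclideanSpace ℝ (Fin n) → ℝ}
  {F : ℝ → EuclideanSpace ℝ (Fin n) → ℝ}
  {Φ : EuclideanSpace ℝ (Fin n) → EuclideanSpace ℝ (Fin n)}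

lemma integral_mul_sub_integral_mul_le {w g G D : EuclideanSpace ℝ (Fin n) → ℝ}
    (hw : Integrable w) (hg : Integrable g) (hG : Continuous G) (hD : Continuous D) {M θ : ℝ}
    (hM : ∀ x, |D x| ≤ M) (hGD : ∀ x, |G x - D x| ≤ θ) :
    (∫ x, w x * D x) - ∫ x, g x * G x ≤
      (M + θ) * (∫ x, |g x - w x|) + θ * ∫ x, |w x| := by
  have hGM : ∀ x, |G x| ≤ M + θ := fun x => by
    have h1 := abs_add_le (D x) (G x - D x)
    rw [add_sub_cancel] at h1
    exact h1.trans (add_le_add (hM x) (hGD x))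
  have i1 : Integrable fun x => w x * D x :=
    hw.mul_bdd hD.aestronglyMeasurable (Eventually.of_forall hM)
  have i2 : Integrable fun x => g x * G x :=
    hg.mul_bdd hG.aestronglyMeasurable (Eventually.of_forall hGM)
  have i3 : Integrable fun x => |g x - w x| := (hg.sub hw).abs
  rw [← integral_sub i1 i2, ← integral_const_mul, ← integral_const_mul,
    ← integral_add (i3.const_mul _) (hw.abs.const_mul _)]
  refine integral_mono (i1.sub i2) ((i3.const_mul _).add (hw.abs.const_mul _)) fun x => ?_
  simp only
  have e : w x * D x - g x * G x = -((G x - D x) * w x) - G x * (g x - w x) := by ring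
  have h1 := neg_le_abs ((G x - D x) * w x)
  have h2 := neg_le_abs (G x * (g x - w x))
  rw [abs_mul] at h1 h2
  have h3 := mul_le_mul_of_nonneg_right (hGD x) (abs_nonneg (w x))
  have h4 := mul_le_mul_of_nonneg_right (hGM x) (abs_nonneg (g x - w x))
  linarith

lemma eventually_ofReal_le_kappa (hn : 1 ≤ n) (hΩ : IsOpen Ω) (hf : LocallyIntegrableOn f Ω)
    (hF : ∀ ε, 0 < ε → LocallyIntegrableOn (F ε) Ω)
    (hlim : ∀ K, IsCompact K → K ⊆ Ω →
      Tendsto (fun ε => ∫⁻ x in K, ‖F ε x - f x‖ₑ) (𝓝[>] (0 : ℝ)) (𝓝 0))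
    (hΦ : IsTestField Ω Φ) {η : ℝ} (hη : 0 < η) :
    ∀ᶠ ε in 𝓝[>] (0 : ℝ),
      ENNReal.ofReal ((∫ x, f x * vdiv n Φ x) / 4 - η) ≤ kappa n ε (F ε) Ω := by
  obtain ⟨ρ, hρ, hρΩ⟩ := hΦ.compact.isCompact.exists_cthickening_subset_open hΩ hΦ.subset
  set K := cthickening ρ (tsupport Φ)
  have hK : IsCompact K := hΦ.compact.isCompact.cthickening
  set W := thickening (ρ / 2) (tsupport Φ)
  have hW : IsOpen W := isOpen_thickening
  have hWK' : W ⊆ K := (thickening_subset_cthickening _ _).trans (cthickening_mono (by linarith) _)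
  have hWf : volume W ≠ ⊤ := ((measure_mono hWK').trans_lt hK.measure_lt_top).ne
  have hΦW : IsTestField W Φ :=
    ⟨hΦ.contDiff, hΦ.compact, self_subset_thickening (by positivity) _, hΦ.norm_le⟩
  set w : EuclideanSpace ℝ (Fin n) → ℝ := K.indicator f
  have hw : Integrable w := integrable_indicator_of_locallyIntegrableOn hf hK hρΩ
  have hd : Continuous (vdiv n Φ) := continuous_vdiv hΦ.contDiff
  have hdc : HasCompactSupport (vdiv n Φ) := hasCompactSupport_vdiv hΦ.compact
  obtain ⟨M, hM⟩ := hdc.exists_bound_of_continuous hd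
  have hM0 : 0 ≤ M := (norm_nonneg _).trans (hM 0)
  have hfw : ∫ x, f x * vdiv n Φ x = ∫ x, w x * vdiv n Φ x :=
    integral_mul_vdiv_congr (U := K) (Eventually.of_forall fun x hx =>
      (Set.indicator_of_mem hx f).symm) (self_subset_cthickening _)
  obtain ⟨k, hk1, hk2⟩ := (((tendsto_integral_moll_mul hw hd hdc).eventually
    (lt_mem_nhds (sub_lt_self (∫ x, w x * vdiv n Φ x) hη))).and
    (tendsto_bumpSeq_rOut.eventually (gt_mem_nhds (half_pos hρ)))).exists
  set φ := bumpSeq n k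
  rw [integral_moll_mul hw hd hM] at hk1
  set D : EuclideanSpace ℝ (Fin n) → ℝ := fun x => moll φ (vdiv n Φ) x / 4
  have hD : Continuous D :=
    (contDiff_moll (m := 0) hd.locallyIntegrable).continuous.div_const 4
  have hDM : ∀ x, |D x| ≤ M := fun x => by
    have := norm_moll_le (φ := φ) hM x
    rw [Real.norm_eq_abs] at this
    simp only [D, abs_div, abs_of_pos (show (0 : ℝ) < 4 by norm_num)]
    linarith
  have hwD : ∫ x, w x * D x = (∫ x, w x * moll φ (vdiv n Φ) x) / 4 := by
    rw [← integral_div]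
    exact integral_congr_ae (Eventually.of_forall fun x => by simp only [D]; ring)
  set N := ∫ x, |w x|
  have hN : 0 ≤ N := integral_nonneg fun _ => abs_nonneg _
  set θ := η / (4 * (N + 1))
  have hθ : 0 < θ := by positivity
  have hθN : θ * N ≤ η / 4 := by
    have : θ * (N + 1) = η / 4 := by simp only [θ]; field_simp
    rw [← this]; gcongr; linarith
  set β := η / (4 * (M + θ + 1))
  have hβ : 0 < β := by positivity
  have hβM : (M + θ) * β ≤ η / 4 := by
    have : (M + θ + 1) * β = η / 4 := by simp only [β]; field_simp
    linarith
  filter_upwards [eventually_exists_isAdapted_moll hn ⟨0, hn⟩ φ hΦW hW hWf hθ,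
    (hlim K hK hρΩ).eventually (ge_mem_nhds (ENNReal.ofReal_pos.2 hβ)), self_mem_nhdsWithin]
    with ε ⟨s, T, c, a, η', hA, hGD⟩ hεβ hε
  have hFK : IntegrableOn (F ε) K := (hF ε hε).integrableOn_compact_subset hρΩ hK
  have hfK : IntegrableOn f K := hf.integrableOn_compact_subset hρΩ hK
  refine (ENNReal.ofReal_le_ofReal ?_).trans (hA.ofReal_integral_mul_moll_le (φ := φ) hn hε
    hK.measurableSet hρΩ (fun x t hx ht => ?_) hFK)
  · have hS : LocallyIntegrable (signSum (⟨0, hn⟩ : Fin n) s T c a ε) :=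
      (locallyIntegrable_const (∑ j ∈ s, |a j / ε|)).mono measurable_signSum.aestronglyMeasurable
        (Eventually.of_forall fun x => (abs_signSum_le x).trans (le_abs_self _))
    have h1 := integral_mul_sub_integral_mul_le hw ((integrable_indicator_iff hK.measurableSet).2 hFK)
      (contDiff_moll (φ := φ) (m := 0) hS).continuous hD hDM hGD
    have h2 : ∫ x, |K.indicator (F ε) x - w x| ≤ β := by
      have e : ∀ x, |K.indicator (F ε) x - w x| = K.indicator (fun x => |F ε x - f x|) x := by
        intro x
        by_cases hx : x ∈ K <;> simp [w, hx]
      simp_rw [e]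
      have hm : AEStronglyMeasurable (fun x => |F ε x - f x|) (volume.restrict K) :=
        (hFK.sub hfK).abs.aestronglyMeasurable
      rw [integral_indicator hK.measurableSet, integral_eq_lintegral_of_nonneg_ae
        (Eventually.of_forall fun _ => abs_nonneg _) hm]
      refine ENNReal.toReal_le_of_le_ofReal hβ.le (le_trans (le_of_eq ?_) hεβ)
      simp_rw [← ofReal_norm, Real.norm_eq_abs]
    have h3 : (M + θ) * ∫ x, |K.indicator (F ε) x - w x| ≤ (M + θ) * β :=
      mul_le_mul_of_nonneg_left h2 (by positivity)
    rw [hfw]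
    rw [hwD] at h1
    linarith
  · obtain ⟨y, hy, hxy⟩ := mem_thickening_iff.1 hx
    refine mem_cthickening_of_dist_le x y _ _ hy ?_
    have h1 : dist x y ≤ ‖t‖ + dist (x - t) y := by
      rw [dist_eq_norm, dist_eq_norm]
      calc ‖x - y‖ = ‖t + (x - t - y)‖ := by congr 1; abel
        _ ≤ _ := norm_add_le _ _
    linarith

lemma variation_div_le_liminf (hn : 1 ≤ n) (hΩ : IsOpen Ω) (hf : LocallyIntegrableOn f Ω)
    (hF : ∀ ε, 0 < ε → LocallyIntegrableOn (F ε) Ω)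
    (hlim : ∀ K, IsCompact K → K ⊆ Ω →
      Tendsto (fun ε => ∫⁻ x in K, ‖F ε x - f x‖ₑ) (𝓝[>] (0 : ℝ)) (𝓝 0)) :
    variation n f Ω / 4 ≤ liminf (fun ε => kappa n ε (F ε) Ω) (𝓝[>] (0 : ℝ)) := by
  rw [ENNReal.div_le_iff (by simp) (by simp)]
  refine variation_le fun Φ hΦ => ?_
  rw [← ENNReal.div_le_iff (by simp) (by simp)]
  set I := ∫ x, f x * vdiv n Φ x
  have hI : ENNReal.ofReal I / 4 = ENNReal.ofReal (I / 4) := by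
    rw [ENNReal.ofReal_div_of_pos (by norm_num)]; norm_num
  rw [hI]
  have hc : Tendsto (fun η : ℝ => ENNReal.ofReal (I / 4 - η)) (𝓝[>] 0)
      (𝓝 (ENNReal.ofReal (I / 4))) := by
    refine ENNReal.tendsto_ofReal (tendsto_nhdsWithin_of_tendsto_nhds ?_)
    exact (continuous_const.sub continuous_id).tendsto' 0 _ (by simp)
  refine le_of_tendsto hc ?_
  filter_upwards [self_mem_nhdsWithin] with η hη
  exact le_liminf_of_le (by isBoundedDefault)
    (eventually_ofReal_le_kappa hn hΩ hf hF hlim hΦ hη)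

lemma tendsto_lintegral_of_tendsto_eLpNorm {α : Type*} [MeasurableSpace α] {μ : Measure α}
    [IsFiniteMeasure μ] {p : ℝ≥0∞} (hp : 1 ≤ p) {l : Filter ℝ} {g : ℝ → α → ℝ}
    (hg : ∀ᶠ ε in l, AEStronglyMeasurable (g ε) μ)
    (h : Tendsto (fun ε => eLpNorm (g ε) p μ) l (𝓝 0)) :
    Tendsto (fun ε => ∫⁻ x, ‖g ε x‖ₑ ∂μ) l (𝓝 0) := by
  have hC : μ Set.univ ^ (1 / (1 : ℝ≥0∞).toReal - 1 / p.toReal) ≠ ⊤ := by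
    refine (ENNReal.rpow_lt_top_of_nonneg ?_ (measure_ne_top _ _)).ne
    rcases eq_or_ne p ⊤ with rfl | hpt
    · simp
    · have : 1 ≤ p.toReal := by
        rw [← ENNReal.toReal_one]; exact ENNReal.toReal_mono hpt hp
      have h2 : 1 / p.toReal ≤ 1 := by rw [div_le_one (by linarith)]; exact this
      simpa using h2
  have h2 := ENNReal.Tendsto.mul_const h (Or.inr hC)
  rw [zero_mul] at h2
  refine tendsto_of_tendsto_of_tendsto_of_le_of_le' tendsto_const_nhds h2
    (Eventually.of_forall fun _ => zero_le) ?_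
  filter_upwards [hg] with ε hε
  rw [← eLpNorm_one_eq_lintegral_enorm]
  exact eLpNorm_le_eLpNorm_mul_rpow_measure_univ hp hε

end LowerBound

/-- The functionals `κ_ε(·, Ω)` `Γ_p`-converge as `ε → 0` to
`f ↦ (1/4)·Var(f, Ω)` on `L¹_loc(Ω)`, for `1 ≤ p < ∞`. -/
theorem gammaP_convergence
    (n : ℕ) (hn : 1 ≤ n)
    (Ω : Set (EuclideanSpace ℝ (Fin n))) (hΩ : IsOpen Ω)
    (p : ℝ) (hp : 1 ≤ p) :
    (∀ f : EuclideanSpace ℝ (Fin n) → ℝ, LocallyIntegrableOn f Ω volume →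
      ∀ F : ℝ → EuclideanSpace ℝ (Fin n) → ℝ,
        (∀ ε, 0 < ε → LocallyIntegrableOn (F ε) Ω volume) →
        (∀ ε, 0 < ε → ∀ K, IsCompact K → K ⊆ Ω →
          eLpNorm (fun x => F ε x - f x) (ENNReal.ofReal p)
            (volume.restrict K) < ⊤) →
        (∀ K, IsCompact K → K ⊆ Ω →
          Tendsto (fun ε => eLpNorm (fun x => F ε x - f x) (ENNReal.ofReal p)
            (volume.restrict K)) (𝓝[>] (0:ℝ)) (𝓝 0)) →
        variation n f Ω / 4 ≤
          liminf (fun ε => kappa n ε (F ε) Ω) (𝓝[>] (0:ℝ))) ∧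
    (∀ f : EuclideanSpace ℝ (Fin n) → ℝ, LocallyIntegrableOn f Ω volume →
      ∃ F : ℝ → EuclideanSpace ℝ (Fin n) → ℝ,
        (∀ ε, 0 < ε → LocallyIntegrableOn (F ε) Ω volume) ∧
        (∀ ε, 0 < ε → ∀ K, IsCompact K → K ⊆ Ω →
          eLpNorm (fun x => F ε x - f x) (ENNReal.ofReal p)
            (volume.restrict K) < ⊤) ∧
        (∀ K, IsCompact K → K ⊆ Ω →
          Tendsto (fun ε => eLpNorm (fun x => F ε x - f x) (ENNReal.ofReal p)
            (volume.restrict K)) (𝓝[>] (0:ℝ)) (𝓝 0)) ∧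
        limsup (fun ε => kappa n ε (F ε) Ω) (𝓝[>] (0:ℝ)) ≤
          variation n f Ω / 4) := by
  have hp1 : 1 ≤ ENNReal.ofReal p := ENNReal.one_le_ofReal.2 hp
  refine ⟨fun f hf F hF _ hconv => variation_div_le_liminf hn hΩ hf hF fun K hK hKΩ => ?_,
    fun f hf => ?_⟩
  · have : IsFiniteMeasure (volume.restrict K) :=
      isFiniteMeasure_restrict.2 hK.measure_lt_top.ne
    refine tendsto_lintegral_of_tendsto_eLpNorm hp1 ?_ (hconv K hK hKΩ)
    filter_upwards [self_mem_nhdsWithin] with ε hε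
    exact ((hF ε hε).integrableOn_compact_subset hKΩ hK).aestronglyMeasurable.sub
      (hf.integrableOn_compact_subset hKΩ hK).aestronglyMeasurable
  · obtain ⟨F, hF, hfin, hlim, hsup⟩ := exists_recovery_family hn hΩ hf
      (one_pos.trans_le hp1).ne' ENNReal.ofReal_ne_top
    have hle : ∀ (K : Set (EuclideanSpace ℝ (Fin n))) ε,
        eLpNorm (fun x => F ε x - f x) (ENNReal.ofReal p) (volume.restrict K) ≤
          eLpNorm (fun x => F ε x - f x) (ENNReal.ofReal p) volume :=
      fun K ε => eLpNorm_mono_measure _ Measure.restrict_le_self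
    exact ⟨F, fun ε _ => hF ε, fun ε _ K _ _ => (hle K ε).trans_lt (hfin ε),
      fun K _ _ => tendsto_of_tendsto_of_tendsto_of_le_of_le tendsto_const_nhds hlim
        (fun _ => zero_le) (hle K), hsup⟩

end
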